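/- Stability of degree ±1/2 point defects: Assume a² ≥ 0, b², c² > 0, k = 1 or k = −1, and R ∈ (0,∞]. Let (u,v) be a profile solution on (0,R) with u > 0 and v < 0 on (0,R), and assume that B(ξ,η) ≥ 0 for every pair (ξ,η) of continuously differentiable real-valued functions with compact support contained in (0,R). Let Q be the associated k-radially symmetric map on B_R. Then L[Q](P) ≥ 0 for every smooth compactly supported map P : B_R → S₀. -/

import Mathlib

open Real MeasureTheory Filter Set Topology
open scoped ENNReal

noncomputable section

/-- `s₊ = (b² + √(b⁴ + 24 a² c²)) / (4c²)`, where `a2 = a²`, `b2 = b²`, `c2 = c²`. -/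
def sPlus (a2 b2 c2 : ℝ) : ℝ := (b2 + Real.sqrt (b2 ^ 2 + 24 * a2 * c2)) / (4 * c2)

/-- `h(p,q) = p(−a² + (2b²/√6)q + c²(p² + q²))`. -/
def hfun (a2 b2 c2 p q : ℝ) : ℝ :=
  p * (-a2 + 2 * b2 / Real.sqrt 6 * q + c2 * (p ^ 2 + q ^ 2))

/-- `g(p,q) = q(−a² − (b²/√6)q + c²(p² + q²)) + (b²/√6)p²`. -/
def gfun (a2 b2 c2 p q : ℝ) : ℝ :=
  q * (-a2 - b2 / Real.sqrt 6 * q + c2 * (p ^ 2 + q ^ 2)) + b2 / Real.sqrt 6 * p ^ 2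

/-- The interval `(0, R)` for `R ∈ (0,∞]`, as a subset of `ℝ`. -/
def Iset (R : ℝ≥0∞) : Set ℝ := {r : ℝ | 0 < r ∧ ENNReal.ofReal r < R}

/-- The filter of left-approach to the right endpoint `R`; `atTop` when `R = ∞`. -/
def endFilter (R : ℝ≥0∞) : Filter ℝ :=
  if R = ⊤ then Filter.atTop else nhdsWithin R.toReal (Set.Iio R.toReal)

/-- A profile solution on `(0,R)`: a C² pair `(u,v)` solving the radial ODE system with the
natural boundary conditions at `0` and at `R`. -/
structure ProfileSolution (a2 b2 c2 : ℝ) (k : ℤ) (R : ℝ≥0∞) (u v : ℝ → ℝ) : Prop where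
  smooth_u : ContDiffOn ℝ 2 u (Iset R)
  smooth_v : ContDiffOn ℝ 2 v (Iset R)
  ode_u : ∀ r ∈ Iset R,
    deriv (deriv u) r + deriv u r / r - (k : ℝ) ^ 2 / r ^ 2 * u r
      = hfun a2 b2 c2 (u r) (v r)
  ode_v : ∀ r ∈ Iset R,
    deriv (deriv v) r + deriv v r / r = gfun a2 b2 c2 (u r) (v r)
  bc0_u : Filter.Tendsto u (nhdsWithin 0 (Set.Ioi 0)) (nhds 0)
  bc0_v : Filter.Tendsto (deriv v) (nhdsWithin 0 (Set.Ioi 0)) (nhds 0)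
  bcR_u : Filter.Tendsto u (endFilter R) (nhds (sPlus a2 b2 c2 / Real.sqrt 2))
  bcR_v : Filter.Tendsto v (endFilter R) (nhds (-(sPlus a2 b2 c2 / Real.sqrt 6)))

/-- The second variation `B(ξ,η)` of the profile energy at `(u,v)`. -/
def Bform (a2 b2 c2 : ℝ) (k : ℤ) (R : ℝ≥0∞) (u v ξ η : ℝ → ℝ) : ℝ :=
  ∫ r in Iset R,
    (deriv ξ r ^ 2 + (k : ℝ) ^ 2 / r ^ 2 * ξ r ^ 2 + deriv η r ^ 2
      + (-a2 + 2 * b2 / Real.sqrt 6 * v r + c2 * (3 * u r ^ 2 + v r ^ 2)) * ξ r ^ 2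
      + (-a2 - 2 * b2 / Real.sqrt 6 * v r + c2 * (u r ^ 2 + 3 * v r ^ 2)) * η r ^ 2
      + 4 * u r * ξ r * η r * (b2 / Real.sqrt 6 + c2 * v r)) * r

/-- The matrix `e₃⊗e₃ − I₃/3`. -/
def E0base : Matrix (Fin 3) (Fin 3) ℝ :=
  !![-(1:ℝ)/3, 0, 0; 0, -1/3, 0; 0, 0, 2/3]

/-- The matrix `M_k(x)`, with upper-left 2×2 block `[[x₁, k x₂],[k x₂, −x₁]]` and all other
entries zero. -/
def Mk (k : ℤ) (x : EuclideanSpace ℝ (Fin 2)) : Matrix (Fin 3) (Fin 3) ℝ :=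
  !![x 0, (k : ℝ) * x 1, 0; (k : ℝ) * x 1, -(x 0), 0; 0, 0, 0]

open scoped Classical in
/-- The `k`-radially symmetric map associated with the profile `(u,v)`:
`Q(x) = (u(|x|)/(√2 |x|)) M_k(x) + v(|x|) √(3/2) (e₃⊗e₃ − I₃/3)` for `x ≠ 0`, and
`Q(0) = (lim_{r→0⁺} v(r)) √(3/2) (e₃⊗e₃ − I₃/3)`. -/
def Qmap (k : ℤ) (u v : ℝ → ℝ) (x : EuclideanSpace ℝ (Fin 2)) :
    Matrix (Fin 3) (Fin 3) ℝ :=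
  (u ‖x‖ / (Real.sqrt 2 * ‖x‖)) • Mk k x
    + (Real.sqrt (3 / 2) *
        (if x = 0 then limUnder (nhdsWithin 0 (Set.Ioi 0)) v else v ‖x‖)) • E0base

/-- The open disk `B_R ⊆ ℝ²` centered at the origin (all of `ℝ²` when `R = ∞`). -/
def ball2 (R : ℝ≥0∞) : Set (EuclideanSpace ℝ (Fin 2)) := {x | ENNReal.ofReal ‖x‖ < R}

/-- `|∇P|²`: the sum of squares of all first partial derivatives of the entries of `P`. -/
def gradSq (P : EuclideanSpace ℝ (Fin 2) → Matrix (Fin 3) (Fin 3) ℝ)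
    (x : EuclideanSpace ℝ (Fin 2)) : ℝ :=
  ∑ α : Fin 2, ∑ i : Fin 3, ∑ j : Fin 3,
    (fderiv ℝ (fun y => P y i j) x (EuclideanSpace.single α 1)) ^ 2

/-- The second variation of the Landau–de Gennes energy at `Q` in direction `P`:
`L[Q](P) = ∫_{B_R} (|∇P|² − a²|P|² − 2b² tr(P²Q) + c²(|Q|²|P|² + 2 tr(QP)²))`. -/
def Lform (a2 b2 c2 : ℝ) (R : ℝ≥0∞)
    (Q P : EuclideanSpace ℝ (Fin 2) → Matrix (Fin 3) (Fin 3) ℝ) : ℝ :=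
  ∫ x in ball2 R,
    (gradSq P x - a2 * (P x * P x).trace - 2 * b2 * (P x * P x * Q x).trace
      + c2 * ((Q x * Q x).trace * (P x * P x).trace + 2 * ((Q x * P x).trace) ^ 2))

lemma isOpen_Iset (R : ℝ≥0∞) : IsOpen (Iset R) :=
  isOpen_Ioi.inter (isOpen_Iio.preimage ENNReal.continuous_ofReal)

lemma Iset_of_le {R : ℝ≥0∞} {r s : ℝ} (hs : s ∈ Iset R) (hr : 0 < r) (hrs : r ≤ s) :
    r ∈ Iset R :=
  ⟨hr, (ENNReal.ofReal_le_ofReal hrs).trans_lt hs.2⟩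

lemma Iset_mem_nhds {R : ℝ≥0∞} {r : ℝ} (hr : r ∈ Iset R) : Iset R ∈ 𝓝 r :=
  (isOpen_Iset R).mem_nhds hr

lemma mem_Iset_of_ne_top {R : ℝ≥0∞} (hR : R ≠ ⊤) {r : ℝ} :
    r ∈ Iset R ↔ 0 < r ∧ r < R.toReal := by
  constructor
  · rintro ⟨h0, h⟩
    exact ⟨h0, (ENNReal.ofReal_lt_iff_lt_toReal h0.le hR).1 h⟩
  · rintro ⟨h0, h⟩
    exact ⟨h0, (ENNReal.ofReal_lt_iff_lt_toReal h0.le hR).2 h⟩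

lemma mem_Iset_top {r : ℝ} : r ∈ Iset ⊤ ↔ 0 < r := by
  simp [Iset]

instance endFilter_neBot (R : ℝ≥0∞) : (endFilter R).NeBot := by
  unfold endFilter
  split_ifs <;> infer_instance

lemma eventually_endFilter {R : ℝ≥0∞} {r : ℝ} (hr : r ∈ Iset R) :
    ∀ᶠ s in endFilter R, s ∈ Iset R ∧ r < s := by
  unfold endFilter
  split_ifs with h
  · subst h
    filter_upwards [eventually_gt_atTop r] with s hs
    exact ⟨mem_Iset_top.2 (hr.1.trans hs), hs⟩
  · have hr' := (mem_Iset_of_ne_top h).1 hr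
    filter_upwards [Ioo_mem_nhdsLT hr'.2] with s hs
    exact ⟨(mem_Iset_of_ne_top h).2 ⟨hr.1.trans hs.1, hs.2⟩, hs.1⟩

/-- At a local minimum of `y`, a weighted second derivative `(ω y')'` cannot be negative. -/
lemma not_isLocalMin_of_weighted_deriv_neg {y dy ω : ℝ → ℝ} {z r₀ : ℝ}
    (hy : ∀ᶠ r in 𝓝 r₀, HasDerivAt y (dy r) r) (hω : ∀ᶠ r in 𝓝 r₀, 0 < ω r)
    (hz : HasDerivAt (fun r => ω r * dy r) z r₀) (hneg : z < 0) : ¬ IsLocalMin y r₀ := by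
  intro hmin
  have h0 : dy r₀ = 0 := hmin.hasDerivAt_eq_zero hy.self_of_nhds
  have hslope := (hasDerivAt_iff_tendsto_slope.1 hz).eventually_lt_const hneg
  rw [eventually_nhdsWithin_iff] at hslope
  obtain ⟨ε, hε, hball⟩ := Metric.eventually_nhds_iff.1
    (hy.and (hω.and (hslope.and hmin)))
  have hmem : ∀ r, r ∈ Icc r₀ (r₀ + ε / 2) → dist r r₀ < ε := by
    intro r hr
    rw [Real.dist_eq, abs_of_nonneg (by linarith [hr.1])]
    linarith [hr.2]
  obtain ⟨c, hc, hcd⟩ := exists_hasDerivAt_eq_slope y dy (a := r₀) (b := r₀ + ε / 2)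
    (by linarith)
    (fun r hr => (hball (hmem r hr)).1.continuousAt.continuousWithinAt)
    (fun r hr => (hball (hmem r ⟨hr.1.le, hr.2.le⟩)).1)
  have hcc := hball (hmem c ⟨hc.1.le, hc.2.le⟩)
  have hend := hball (hmem (r₀ + ε / 2) ⟨by linarith, le_rfl⟩)
  have h1 : 0 ≤ dy c := by
    rw [hcd]
    exact div_nonneg (by linarith [hend.2.2.2]) (by linarith)
  have h2 := hcc.2.2.1 (by simpa using hc.1.ne')
  rw [slope_def_field, h0] at h2
  have h3 : 0 < c - r₀ := by linarith [hc.1]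
  have h4 := (div_lt_iff₀ h3).1 h2
  have h5 := mul_nonneg hcc.2.1.le h1
  linarith

/-- Minimum principle on `(0,R)` for operators `(ω y')'`. -/
lemma le_of_weighted_deriv_neg {R : ℝ≥0∞} {y dy ω Z : ℝ → ℝ} {c ℓ : ℝ}
    (hy : ∀ r ∈ Iset R, HasDerivAt y (dy r) r) (hω : ∀ r ∈ Iset R, 0 < ω r)
    (hZ : ∀ r ∈ Iset R, HasDerivAt (fun r => ω r * dy r) (Z r) r)
    (hneg : ∀ r ∈ Iset R, y r < c → Z r < 0)
    (h0 : Tendsto (fun r => ω r * dy r) (𝓝[>] 0) (𝓝 0))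
    (hend : Tendsto y (endFilter R) (𝓝 ℓ)) (hcl : c ≤ ℓ) :
    ∀ r ∈ Iset R, c ≤ y r := by
  intro r₁ hr₁
  by_contra! hlt
  obtain ⟨b, hby, hbI, hb⟩ := ((hend.eventually_const_lt (hlt.trans_le hcl)).and
    (eventually_endFilter hr₁)).exists
  have key : ∀ a, 0 < a → a ≤ r₁ → ∀ x ∈ Icc a b, y a ≤ y x := by
    intro a ha har x hx
    have hsub : ∀ t ∈ Icc a b, t ∈ Iset R := fun t ht =>
      Iset_of_le hbI (ha.trans_le ht.1) ht.2
    obtain ⟨m, hm, hmin⟩ := isCompact_Icc.exists_isMinOn (s := Icc a b) (f := y)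
      ⟨a, le_rfl, har.trans hb.le⟩
      (fun t ht => (hy t (hsub t ht)).continuousAt.continuousWithinAt)
    have hm1 : y m ≤ y r₁ := hmin ⟨har, hb.le⟩
    rcases eq_or_lt_of_le hm.1 with h | h
    · rw [h]; exact hmin hx
    rcases eq_or_lt_of_le hm.2 with h' | h'
    · rw [h'] at hm1; linarith
    exfalso
    refine not_isLocalMin_of_weighted_deriv_neg ?_ ?_ (hZ m (hsub m hm))
      (hneg m (hsub m hm) (hm1.trans_lt hlt)) (hmin.isLocalMin (Icc_mem_nhds h h'))
    · exact Filter.eventually_of_mem (Iset_mem_nhds (hsub m hm)) hy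
    · exact Filter.eventually_of_mem (Iset_mem_nhds (hsub m hm)) hω
  have hI : ∀ r, 0 < r → r ≤ r₁ → r ∈ Iset R := fun r h h' => Iset_of_le hr₁ h h'
  have hanti : ∀ s t, 0 < s → s < t → t ≤ r₁ → ω t * dy t < ω s * dy s := by
    intro s t hs hst ht
    obtain ⟨c', hc', hd⟩ := exists_hasDerivAt_eq_slope (fun r => ω r * dy r) Z hst
      (fun r hr => (hZ r (hI r (hs.trans_le hr.1) (hr.2.trans ht))).continuousAt.continuousWithinAt)
      (fun r hr => hZ r (hI r (hs.trans hr.1) (hr.2.le.trans ht)))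
    have hcr : c' ≤ r₁ := hc'.2.le.trans ht
    have := hneg c' (hI c' (hs.trans hc'.1) hcr)
      ((key c' (hs.trans hc'.1) hcr r₁ ⟨hcr, hb.le⟩).trans_lt hlt)
    rw [hd, div_lt_iff₀ (by linarith)] at this
    linarith
  have hzneg : ∀ t, 0 < t → t ≤ r₁ → ω t * dy t < 0 := by
    intro t ht htr
    have h1 : ω (t / 2) * dy (t / 2) ≤ 0 := by
      refine ge_of_tendsto h0 ?_
      filter_upwards [Ioo_mem_nhdsGT (half_pos ht)] with s hs
      exact (hanti s (t / 2) hs.1 hs.2 (by linarith)).le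
    linarith [hanti (t / 2) t (half_pos ht) (by linarith) htr]
  obtain ⟨c', hc', hd⟩ := exists_hasDerivAt_eq_slope y dy (a := r₁ / 2) (b := r₁)
    (by linarith [hr₁.1])
    (fun r hr => (hy r (hI r (by linarith [hr.1, hr₁.1]) hr.2)).continuousAt.continuousWithinAt)
    (fun r hr => hy r (hI r (by linarith [hr.1, hr₁.1]) hr.2.le))
  have hc0 : 0 < c' := by linarith [hc'.1, hr₁.1]
  have h1 : 0 ≤ dy c' := by
    rw [hd]
    refine div_nonneg ?_ (by linarith [hr₁.1])
    linarith [key (r₁ / 2) (by linarith [hr₁.1]) (by linarith [hr₁.1]) r₁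
      ⟨by linarith [hr₁.1], hb.le⟩]
  have h2 := hzneg c' hc0 hc'.2.le
  have h3 := mul_nonneg (hω c' (hI c' hc0 hc'.2.le)).le h1
  linarith

lemma HasDerivAt.of_eq {f g : ℝ → ℝ} {f' g' x : ℝ} (h : HasDerivAt f f' x)
    (hfg : ∀ s, g s = f s) (hder : g' = f') : HasDerivAt g g' x := by
  obtain rfl : g = f := funext hfg
  exact hder ▸ h

/-- The profile system in normalized constants: `a = a²`, `b = b²/√6`, `c = c²`, `y = s₊/√6`,
with `du`, `dv` the derivatives of `u`, `v`. -/
structure Profile (a b c y : ℝ) (R : ℝ≥0∞) (u v du dv : ℝ → ℝ) : Prop where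
  a_nonneg : 0 ≤ a
  b_pos : 0 < b
  c_pos : 0 < c
  y_pos : 0 < y
  a_eq : a = 4 * c * y ^ 2 - 2 * b * y
  deriv_u : ∀ r ∈ Iset R, HasDerivAt u (du r) r
  deriv_v : ∀ r ∈ Iset R, HasDerivAt v (dv r) r
  deriv_du : ∀ r ∈ Iset R, HasDerivAt du
    (u r * (-a + 2 * b * v r + c * (u r ^ 2 + v r ^ 2)) + u r / r ^ 2 - du r / r) r
  deriv_dv : ∀ r ∈ Iset R, HasDerivAt dv
    (v r * (-a - b * v r + c * (u r ^ 2 + v r ^ 2)) + b * u r ^ 2 - dv r / r) r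
  u_pos : ∀ r ∈ Iset R, 0 < u r
  v_neg : ∀ r ∈ Iset R, v r < 0
  u_zero : Tendsto u (𝓝[>] 0) (𝓝 0)
  dv_zero : Tendsto dv (𝓝[>] 0) (𝓝 0)
  u_end : Tendsto u (endFilter R) (𝓝 (√3 * y))
  v_end : Tendsto v (endFilter R) (𝓝 (-y))

namespace Profile

variable {a b c y : ℝ} {R : ℝ≥0∞} {u v du dv : ℝ → ℝ}

lemma b_le (H : Profile a b c y R u v du dv) : b ≤ 2 * c * y := by
  have h1 := H.a_nonneg
  rw [H.a_eq] at h1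
  have h2 : 0 ≤ 2 * y * (2 * c * y - b) := by linarith
  have := nonneg_of_mul_nonneg_right h2 (by linarith [H.y_pos])
  linarith

lemma deriv_mul_du (H : Profile a b c y R u v du dv) {r : ℝ} (hr : r ∈ Iset R) :
    HasDerivAt (fun r => r * du r)
      (r * (u r * (-a + 2 * b * v r + c * (u r ^ 2 + v r ^ 2)) + u r / r ^ 2)) r := by
  have h0 : r ≠ 0 := hr.1.ne'
  refine ((hasDerivAt_id' r).mul (H.deriv_du r hr)).of_eq (fun s => rfl) ?_
  field_simp
  ring

lemma deriv_mul_dv (H : Profile a b c y R u v du dv) {r : ℝ} (hr : r ∈ Iset R) :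
    HasDerivAt (fun r => r * dv r)
      (r * (v r * (-a - b * v r + c * (u r ^ 2 + v r ^ 2)) + b * u r ^ 2)) r := by
  have h0 : r ≠ 0 := hr.1.ne'
  refine ((hasDerivAt_id' r).mul (H.deriv_dv r hr)).of_eq (fun s => rfl) ?_
  field_simp
  ring

lemma bounded_near_zero (H : Profile a b c y R u v du dv) (hR : 0 < R) :
    ∃ C δ : ℝ, 0 < C ∧ δ ∈ Iset R ∧ ∀ r ∈ Ioc 0 δ,
      |u r| ≤ C ∧ |v r| ≤ C ∧ |du r| ≤ C ∧ |dv r| ≤ C := by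
  have hI : ∀ᶠ r in 𝓝[>] (0:ℝ), r ∈ Iset R := by
    have h1 : ∀ᶠ r in 𝓝[>] (0:ℝ), ENNReal.ofReal r < R :=
      ((ENNReal.continuous_ofReal.tendsto' 0 0 (by simp)).mono_left
        nhdsWithin_le_nhds).eventually_lt_const hR
    filter_upwards [h1, self_mem_nhdsWithin] with r h h' using ⟨h', h⟩
  have hu1 : ∀ᶠ r in 𝓝[>] (0:ℝ), |u r| < 1 :=
    H.u_zero.abs.eventually_lt_const (by simp)
  have hv1 : ∀ᶠ r in 𝓝[>] (0:ℝ), |dv r| < 1 :=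
    H.dv_zero.abs.eventually_lt_const (by simp)
  obtain ⟨δ', hδ', hsub⟩ := mem_nhdsGT_iff_exists_Ioo_subset.1 (hI.and (hu1.and hv1))
  obtain ⟨δ, hδ0, hδδ⟩ : ∃ δ, 0 < δ ∧ δ < δ' := ⟨δ' / 2, half_pos hδ', half_lt_self hδ'⟩
  have hall : ∀ r ∈ Ioc 0 δ, r ∈ Iset R ∧ |u r| < 1 ∧ |dv r| < 1 := fun r hr =>
    hsub ⟨hr.1, hr.2.trans_lt hδδ⟩
  have hδm : δ ∈ Ioc 0 δ := ⟨hδ0, le_rfl⟩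
  set V := |v δ| + δ with hV
  have hvb : ∀ r ∈ Ioc 0 δ, |v r| ≤ V := by
    intro r hr
    have := (convex_Ioc (0:ℝ) δ).norm_image_sub_le_of_norm_hasDerivWithin_le (f := v) (f' := dv)
      (C := 1) (fun x hx => (H.deriv_v x (hall x hx).1).hasDerivWithinAt)
      (fun x hx => (hall x hx).2.2.le) hδm hr
    rw [Real.norm_eq_abs, Real.norm_eq_abs, abs_sub_comm r δ,
      abs_of_nonneg (by linarith [hr.2] : 0 ≤ δ - r)] at this
    have h2 := abs_sub_abs_le_abs_sub (v r) (v δ)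
    linarith [hr.1]
  have hV0 : 0 ≤ V := by positivity
  set K := |a| + 2 * b * V + c * (1 + V ^ 2) with hK
  have hb := H.b_pos
  have hc := H.c_pos
  have hK0 : 0 ≤ K := by positivity
  have hhb : ∀ r ∈ Ioc 0 δ,
      |u r * (-a + 2 * b * v r + c * (u r ^ 2 + v r ^ 2))| ≤ K := by
    intro r hr
    have h1 := (hall r hr).2.1.le
    have h2 := hvb r hr
    have h3 : |-a + 2 * b * v r + c * (u r ^ 2 + v r ^ 2)| ≤ K := by
      refine (abs_add_le _ _).trans (add_le_add ((abs_add_le _ _).trans ?_) ?_)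
      · rw [abs_neg, abs_mul, abs_of_pos (by positivity : 0 < 2 * b)]
        gcongr
      · rw [abs_mul, abs_of_pos hc, abs_of_nonneg (by positivity)]
        have h4 : u r ^ 2 ≤ 1 := by rw [sq_le_one_iff_abs_le_one]; exact h1
        have h5 : v r ^ 2 ≤ V ^ 2 := by rw [← sq_abs (v r)]; gcongr
        gcongr
    rw [abs_mul]
    calc |u r| * _ ≤ 1 * K := mul_le_mul h1 h3 (abs_nonneg _) zero_le_one
      _ = K := one_mul K
  have hw : ∀ r ∈ Ioc 0 δ, HasDerivAt (fun r => du r + u r / r)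
      (u r * (-a + 2 * b * v r + c * (u r ^ 2 + v r ^ 2))) r := by
    intro r hr
    have h0 : r ≠ 0 := hr.1.ne'
    refine ((H.deriv_du r (hall r hr).1).add
      ((H.deriv_u r (hall r hr).1).div (hasDerivAt_id' r) h0)).of_eq (fun s => rfl) ?_
    field_simp
    ring
  set W := |du δ + u δ / δ| + K * δ with hW
  have hW0 : 0 ≤ W := by positivity
  have hwb : ∀ r ∈ Ioc 0 δ, |du r + u r / r| ≤ W := by
    intro r hr
    have := (convex_Ioc (0:ℝ) δ).norm_image_sub_le_of_norm_hasDerivWithin_le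
      (C := K) (fun x hx => (hw x hx).hasDerivWithinAt) hhb hδm hr
    rw [Real.norm_eq_abs, Real.norm_eq_abs, abs_sub_comm r δ,
      abs_of_nonneg (by linarith [hr.2] : 0 ≤ δ - r)] at this
    have h2 := abs_sub_abs_le_abs_sub (du r + u r / r) (du δ + u δ / δ)
    have h3 : K * (δ - r) ≤ K * δ := by gcongr; linarith [hr.1]
    linarith
  have hru : ∀ r ∈ Ioc 0 δ, |u r / r| ≤ W := by
    intro r hr
    have hle : ∀ s ∈ Ioo 0 r, |r * u r - s * u s| ≤ W * r * r := by
      intro s hs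
      have := (convex_Icc s r).norm_image_sub_le_of_norm_hasDerivWithin_le
        (f := fun t => t * u t) (f' := fun t => t * (du t + u t / t)) (C := W * r)
        (fun x hx => by
          have hx' : x ∈ Ioc 0 δ := ⟨hs.1.trans_le hx.1, hx.2.trans hr.2⟩
          have hx0 : x ≠ 0 := hx'.1.ne'
          refine HasDerivAt.hasDerivWithinAt ?_
          refine ((hasDerivAt_id' x).mul (H.deriv_u x (hall x hx').1)).of_eq (fun s => rfl) ?_
          field_simp
          ring)
        (fun x hx => by
          have hx' : x ∈ Ioc 0 δ := ⟨hs.1.trans_le hx.1, hx.2.trans hr.2⟩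
          rw [Real.norm_eq_abs, abs_mul, abs_of_pos hx'.1, mul_comm]
          exact mul_le_mul (hwb x hx') hx.2 hx'.1.le hW0)
        (left_mem_Icc.2 hs.2.le) (right_mem_Icc.2 hs.2.le)
      rw [Real.norm_eq_abs, Real.norm_eq_abs,
        abs_of_nonneg (by linarith [hs.2] : 0 ≤ r - s)] at this
      refine this.trans ?_
      have : 0 ≤ W * r := mul_nonneg hW0 hr.1.le
      gcongr
      linarith [hs.1]
    have hlim : Tendsto (fun s => |r * u r - s * u s|) (𝓝[>] 0) (𝓝 |r * u r - 0 * 0|) :=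
      (tendsto_const_nhds.sub ((tendsto_id.mono_left nhdsWithin_le_nhds).mul H.u_zero)).abs
    have h1 : |r * u r - 0 * 0| ≤ W * r * r :=
      le_of_tendsto hlim (Filter.eventually_of_mem (Ioo_mem_nhdsGT hr.1) hle)
    rw [mul_zero, sub_zero, abs_mul, abs_of_pos hr.1] at h1
    rw [abs_div, abs_of_pos hr.1, div_le_iff₀ hr.1]
    have hr0 := hr.1
    nlinarith
  refine ⟨1 + V + 2 * W, δ, by positivity, (hall δ hδm).1, fun r hr => ⟨?_, ?_, ?_, ?_⟩⟩
  · linarith [(hall r hr).2.1]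
  · linarith [hvb r hr]
  · have h1 := abs_sub (du r + u r / r) (u r / r)
    rw [add_sub_cancel_right] at h1
    linarith [hwb r hr, hru r hr]
  · linarith [(hall r hr).2.2]

lemma tendsto_zero_mul {ε : ℝ} (hε : 0 < ε) {C : ℝ} {f : ℝ → ℝ}
    (hf : ∀ r ∈ Ioc 0 ε, |f r| ≤ C) : Tendsto (fun r => r * f r) (𝓝[>] 0) (𝓝 0) := by
  have h1 : Tendsto (fun r : ℝ => r) (𝓝[>] 0) (𝓝 0) := tendsto_id.mono_left nhdsWithin_le_nhds
  refine squeeze_zero_norm' (a := fun r => r * C) ?_ (by simpa using h1.mul_const C)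
  filter_upwards [Ioc_mem_nhdsGT hε] with r hr
  rw [Real.norm_eq_abs, abs_mul, abs_of_pos hr.1]
  exact mul_le_mul_of_nonneg_left (hf r hr) hr.1.le

lemma norm_sq_le (H : Profile a b c y R u v du dv) (hR : 0 < R) :
    ∀ r ∈ Iset R, u r ^ 2 + v r ^ 2 ≤ 4 * y ^ 2 := by
  obtain ⟨C, δ, hC, hδ, hb⟩ := H.bounded_near_zero hR
  have hy := H.y_pos
  have hbb := H.b_pos
  have hc := H.c_pos
  have hby := H.b_le
  have hs3 : √3 ^ 2 = (3:ℝ) := Real.sq_sqrt (by norm_num)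
  have key := le_of_weighted_deriv_neg (R := R) (y := fun r => -(u r ^ 2 + v r ^ 2))
    (dy := fun r => -(2 * u r * du r + 2 * v r * dv r)) (ω := fun r => r)
    (Z := fun r => -(2 * r * (du r ^ 2 + dv r ^ 2
      + u r * (u r * (-a + 2 * b * v r + c * (u r ^ 2 + v r ^ 2)) + u r / r ^ 2)
      + v r * (v r * (-a - b * v r + c * (u r ^ 2 + v r ^ 2)) + b * u r ^ 2))))
    (c := -(4 * y ^ 2)) (ℓ := -((√3 * y) ^ 2 + (-y) ^ 2))
    ?_ (fun r hr => hr.1) ?_ ?_ ?_ ?_ ?_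
  · intro r hr
    have := key r hr
    simp only [neg_le_neg_iff] at this
    exact this
  · intro r hr
    refine (((H.deriv_u r hr).pow 2).add ((H.deriv_v r hr).pow 2)).neg.of_eq (fun s => rfl) ?_
    simp
  · intro r hr
    have h1 := ((H.deriv_u r hr).mul (H.deriv_mul_du hr)).const_mul (-2)
    have h2 := ((H.deriv_v r hr).mul (H.deriv_mul_dv hr)).const_mul (-2)
    refine (h1.add h2).of_eq (fun s => ?_) ?_
    · simp only [Pi.add_apply, Pi.mul_apply]
      ring
    · ring
  · intro r hr hlt
    have hr0 := hr.1
    simp only [neg_lt_neg_iff] at hlt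
    set n := √(u r ^ 2 + v r ^ 2) with hn
    have hn2 : n ^ 2 = u r ^ 2 + v r ^ 2 := Real.sq_sqrt (by positivity)
    have hny : 2 * y < n := by
      refine lt_of_pow_lt_pow_left₀ 2 (Real.sqrt_nonneg _) ?_
      rw [hn2]; linarith
    have hcub : -(n ^ 3) ≤ 3 * u r ^ 2 * v r - v r ^ 3 := by
      have h1 : (3 * u r ^ 2 * v r - v r ^ 3) ^ 2 ≤ (n ^ 3) ^ 2 := by
        have : (n ^ 3) ^ 2 = (n ^ 2) ^ 3 := by ring
        rw [this, hn2]
        nlinarith [sq_nonneg (u r ^ 3 - 3 * u r * v r ^ 2)]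
      have hn3 : 0 ≤ n ^ 3 := by positivity
      exact (abs_le.1 (abs_le_of_sq_le_sq h1 hn3)).1
    have hpos : 0 < n ^ 2 * (-a - b * n + c * n ^ 2) := by
      have : -a - b * n + c * n ^ 2 = (n - 2 * y) * (c * n + 2 * c * y - b) := by
        rw [H.a_eq]; ring
      rw [this]
      have : 0 < c * n + 2 * c * y - b := by
        have : 0 < c * n := mul_pos hc (by linarith)
        linarith
      have hn' : 0 < n := by linarith
      have : 0 < n - 2 * y := by linarith
      positivity
    have hu2 : 0 ≤ u r * (u r / r ^ 2) := by
      have := H.u_pos r hr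
      positivity
    have : 0 < du r ^ 2 + dv r ^ 2
      + u r * (u r * (-a + 2 * b * v r + c * (u r ^ 2 + v r ^ 2)) + u r / r ^ 2)
      + v r * (v r * (-a - b * v r + c * (u r ^ 2 + v r ^ 2)) + b * u r ^ 2) := by
      have e : n ^ 2 * (-a - b * n + c * n ^ 2)
        = n ^ 2 * (-a + c * n ^ 2) - b * n ^ 3 := by ring
      rw [e, hn2] at hpos
      nlinarith [sq_nonneg (du r), sq_nonneg (dv r), mul_le_mul_of_nonneg_left hcub hbb.le]
    have := mul_pos (mul_pos two_pos hr0) this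
    linarith
  · refine tendsto_zero_mul hδ.1 (C := 4 * C * C) fun r hr => ?_
    obtain ⟨h1, h2, h3, h4⟩ := hb r hr
    rw [abs_neg]
    refine (abs_add_le _ _).trans ?_
    rw [abs_mul, abs_mul, abs_mul, abs_mul, abs_two]
    have := mul_le_mul h1 h3 (abs_nonneg _) hC.le
    have := mul_le_mul h2 h4 (abs_nonneg _) hC.le
    linarith
  · exact ((H.u_end.pow 2).add (H.v_end.pow 2)).neg
  · rw [mul_pow, hs3]; linarith

lemma neg_y_le_v (H : Profile a b c y R u v du dv) (hR : 0 < R) (hcy : c * y ≤ b) :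
    ∀ r ∈ Iset R, -y ≤ v r := by
  obtain ⟨C, δ, hC, hδ, hb⟩ := H.bounded_near_zero hR
  have hy := H.y_pos
  have hbb := H.b_pos
  have hc := H.c_pos
  refine le_of_weighted_deriv_neg H.deriv_v (fun r hr => hr.1)
    (fun r hr => H.deriv_mul_dv hr) ?_ ?_ H.v_end le_rfl
  · intro r hr hlt
    have hn := H.norm_sq_le hR r hr
    refine mul_neg_of_pos_of_neg hr.1 ?_
    have hr0 := H.v_neg r hr
    rcases le_total 0 (b + c * v r) with hk | hk
    · have h1 := mul_le_mul_of_nonneg_right (by linarith : u r ^ 2 ≤ 4 * y ^ 2 - v r ^ 2) hk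
      have h2 : 0 < b * ((v r - 2 * y) * (v r + y)) :=
        mul_pos hbb (mul_pos_of_neg_of_neg (by linarith) (by linarith))
      rw [H.a_eq]
      nlinarith
    · have h1 : u r ^ 2 * (b + c * v r) ≤ 0 :=
        mul_nonpos_of_nonneg_of_nonpos (sq_nonneg _) hk
      have h2 : 0 < -a + b * (-v r) + c * v r ^ 2 := by
        have h3 : b * (-v r) ≤ c * v r ^ 2 := by nlinarith
        have h4 : b * y < b * (-v r) := by gcongr; linarith
        have h5 : c * y * y ≤ b * y := by gcongr
        rw [H.a_eq]
        nlinarith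
      nlinarith
  · exact tendsto_zero_mul hδ.1 fun r hr => (hb r hr).2.2.2

lemma v_le_neg_y (H : Profile a b c y R u v du dv) (hR : 0 < R) (hcy : b ≤ c * y) :
    ∀ r ∈ Iset R, v r ≤ -y := by
  obtain ⟨C, δ, hC, hδ, hb⟩ := H.bounded_near_zero hR
  have hy := H.y_pos
  have hbb := H.b_pos
  have hc := H.c_pos
  have key := le_of_weighted_deriv_neg (c := y) (fun r hr => (H.deriv_v r hr).neg)
    (fun r hr => hr.1)
    (Z := fun r => -(r * (v r * (-a - b * v r + c * (u r ^ 2 + v r ^ 2)) + b * u r ^ 2)))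
    (fun r hr => by
      exact (H.deriv_mul_dv hr).neg.of_eq (fun s => by simp) rfl) ?_ ?_ H.v_end.neg (by simp)
  · intro r hr
    have := key r hr
    simp only [Pi.neg_apply] at this
    linarith
  · intro r hr hlt
    have hn := H.norm_sq_le hR r hr
    simp only [Pi.neg_apply] at hlt
    refine neg_neg_of_pos (mul_pos hr.1 ?_)
    have hr0 := H.v_neg r hr
    rcases le_total (b + c * v r) 0 with hk | hk
    · have h1 := mul_le_mul_of_nonpos_right (by linarith : u r ^ 2 ≤ 4 * y ^ 2 - v r ^ 2) hk
      have h2 : 0 < b * ((2 * y - v r) * (v r + y)) :=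
        mul_pos hbb (mul_pos (by linarith) (by linarith))
      rw [H.a_eq]
      nlinarith
    · have h1 : 0 ≤ u r ^ 2 * (b + c * v r) := mul_nonneg (sq_nonneg _) hk
      have h2 : 0 < a - b * (-v r) - c * v r ^ 2 := by
        have h3 : c * v r ^ 2 ≤ b * (-v r) := by nlinarith
        have h4 : b * (-v r) < b * y := by gcongr
        have h5 : b * y ≤ c * y * y := by gcongr
        rw [H.a_eq]
        nlinarith
      nlinarith
  · exact tendsto_zero_mul hδ.1 (C := C) fun r hr => by rw [abs_neg]; exact (hb r hr).2.2.2

lemma u_le (H : Profile a b c y R u v du dv) (hR : 0 < R) :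
    ∀ r ∈ Iset R, u r ≤ √3 * y := by
  have hy := H.y_pos
  have hbb := H.b_pos
  have hc := H.c_pos
  have hs3 : √3 ^ 2 = (3:ℝ) := Real.sq_sqrt (by norm_num)
  have hs0 : 0 ≤ √3 * y := by positivity
  rcases le_total b (c * y) with hcy | hcy
  · intro r hr
    refine le_of_sq_le_sq ?_ hs0
    rw [mul_pow, hs3]
    have h1 := H.norm_sq_le hR r hr
    have h2 := H.v_le_neg_y hR hcy r hr
    nlinarith
  · obtain ⟨C, δ, hC, hδ, hb⟩ := H.bounded_near_zero hR
    have key := le_of_weighted_deriv_neg (c := -(√3 * y)) (fun r hr => (H.deriv_u r hr).neg)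
      (fun r hr => hr.1)
      (Z := fun r => -(r * (u r * (-a + 2 * b * v r + c * (u r ^ 2 + v r ^ 2)) + u r / r ^ 2)))
      (fun r hr => by
        exact (H.deriv_mul_du hr).neg.of_eq (fun s => by simp) rfl) ?_ ?_ H.u_end.neg le_rfl
    · intro r hr
      have := key r hr
      simp only [Pi.neg_apply] at this
      linarith
    · intro r hr hlt
      simp only [Pi.neg_apply, neg_lt_neg_iff] at hlt
      have hr0 := hr.1
      have hup := H.u_pos r hr
      have hv1 := H.neg_y_le_v hR hcy r hr
      refine neg_neg_of_pos (mul_pos hr.1 ?_)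
      have h1 : 3 * y ^ 2 < u r ^ 2 := by
        rw [← hs3, ← mul_pow]; gcongr
      have h2 : 0 ≤ (v r + y) * (2 * b + c * (v r - y)) := by
        refine mul_nonneg (by linarith) ?_
        nlinarith
      have h3 : 0 < -a + 2 * b * v r + c * (u r ^ 2 + v r ^ 2) := by
        rw [H.a_eq]
        nlinarith [mul_lt_mul_of_pos_left h1 hc]
      positivity
    · exact tendsto_zero_mul hδ.1 (C := C) fun r hr => by rw [abs_neg]; exact (hb r hr).2.2.1

lemma u_lt (H : Profile a b c y R u v du dv) (hR : 0 < R) :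
    ∀ r ∈ Iset R, u r < -(√3 * v r) := by
  obtain ⟨C, δ, hC, hδ, hb⟩ := H.bounded_near_zero hR
  have hy := H.y_pos
  have hbb := H.b_pos
  have hs3 : √3 ^ 2 = (3:ℝ) := Real.sq_sqrt (by norm_num)
  have hs0 : 0 ≤ √3 := by positivity
  set Z : ℝ → ℝ := fun r => r * (b * u r * (3 * v r ^ 2 - u r ^ 2) + u r * v r / r ^ 2) with hZdef
  have hy' : ∀ r ∈ Iset R, HasDerivAt (fun r => u r / v r)
      ((du r * v r - u r * dv r) / v r ^ 2) r := fun r hr =>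
    (H.deriv_u r hr).div (H.deriv_v r hr) (H.v_neg r hr).ne
  have hZ : ∀ r ∈ Iset R, HasDerivAt
      (fun r => (r * v r ^ 2) * ((du r * v r - u r * dv r) / v r ^ 2)) (Z r) r := by
    intro r hr
    have hr0 : r ≠ 0 := hr.1.ne'
    have h1 := ((H.deriv_mul_du hr).mul (H.deriv_v r hr)).sub
      ((H.deriv_mul_dv hr).mul (H.deriv_u r hr))
    have h2 : (fun r => (r * v r ^ 2) * ((du r * v r - u r * dv r) / v r ^ 2)) =ᶠ[𝓝 r]
        ((fun r => r * du r) * v - (fun r => r * dv r) * u) := by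
      filter_upwards [Iset_mem_nhds hr] with s hs
      have := (H.v_neg s hs).ne
      simp only [Pi.sub_apply, Pi.mul_apply]
      field_simp
    refine HasDerivAt.congr_of_eventuallyEq ?_ h2
    convert h1 using 1
    simp only [hZdef]
    field_simp
    ring
  have hω : ∀ r ∈ Iset R, 0 < r * v r ^ 2 := fun r hr =>
    mul_pos hr.1 (sq_pos_of_neg (H.v_neg r hr))
  have hneg : ∀ r ∈ Iset R, u r / v r ≤ -√3 → Z r < 0 := by
    intro r hr hle
    have hv := H.v_neg r hr
    have hu := H.u_pos r hr
    have hr0 := hr.1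
    rw [div_le_iff_of_neg hv] at hle
    have h1 : 3 * v r ^ 2 ≤ u r ^ 2 := by
      have : (√3 * -v r) ^ 2 ≤ u r ^ 2 := by
        have : 0 ≤ √3 * -v r := mul_nonneg hs0 (by linarith)
        gcongr
        linarith
      rw [mul_pow, hs3] at this
      linarith [neg_sq (v r)]
    refine mul_neg_of_pos_of_neg hr.1 ?_
    have h2 : u r * v r / r ^ 2 < 0 :=
      div_neg_of_neg_of_pos (mul_neg_of_pos_of_neg hu hv) (by positivity)
    have h3 : b * u r * (3 * v r ^ 2 - u r ^ 2) ≤ 0 :=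
      mul_nonpos_of_nonneg_of_nonpos (by positivity) (by linarith)
    linarith
  have key := le_of_weighted_deriv_neg (c := -√3) hy' hω hZ
    (fun r hr h => hneg r hr h.le) ?_
    (H.u_end.div H.v_end (by linarith : -y ≠ 0)) (by
      rw [mul_div_assoc, div_neg, div_self hy.ne']; simp)
  · intro r hr
    by_contra! hle
    have hv := H.v_neg r hr
    have hr1 : u r / v r ≤ -√3 := by
      rw [div_le_iff_of_neg hv]; linarith
    have heq : u r / v r = -√3 := le_antisymm hr1 (key r hr)
    refine not_isLocalMin_of_weighted_deriv_neg
      (Filter.eventually_of_mem (Iset_mem_nhds hr) hy')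
      (Filter.eventually_of_mem (Iset_mem_nhds hr) hω) (hZ r hr) (hneg r hr hr1) ?_
    filter_upwards [Iset_mem_nhds hr] with s hs
    rw [heq]
    exact key s hs
  · have h1 : Tendsto (fun r => r * (du r * v r - u r * dv r)) (𝓝[>] 0) (𝓝 0) := by
      refine tendsto_zero_mul hδ.1 (C := 2 * C * C) fun r hr => ?_
      obtain ⟨h1, h2, h3, h4⟩ := hb r hr
      refine (abs_sub _ _).trans ?_
      rw [abs_mul, abs_mul]
      have := mul_le_mul h3 h2 (abs_nonneg _) hC.le
      have := mul_le_mul h1 h4 (abs_nonneg _) hC.le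
      linarith
    refine h1.congr' ?_
    filter_upwards [Ioc_mem_nhdsGT hδ.1] with r hr
    have := (H.v_neg r (Iset_of_le hδ hr.1 hr.2)).ne
    field_simp

end Profile

lemma exists_Icc_of_tsupport {R : ℝ≥0∞} (hR : 0 < R) {χ : ℝ → ℝ} (hc : HasCompactSupport χ)
    (hs : tsupport χ ⊆ Iset R) :
    ∃ α β, 0 < α ∧ α < β ∧ β ∈ Iset R ∧ ∀ r ∉ Ioo α β, χ r = 0 := by
  rcases (tsupport χ).eq_empty_or_nonempty with he | hne
  · obtain ⟨δ, hδ0, hδR⟩ : ∃ δ : ℝ, 0 < δ ∧ ENNReal.ofReal δ < R := by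
      obtain ⟨q, hq0, hqR⟩ := ENNReal.lt_iff_exists_nnreal_btwn.1 hR
      exact ⟨q, by exact_mod_cast hq0, by simpa using hqR⟩
    refine ⟨δ / 2, δ, half_pos hδ0, half_lt_self hδ0, ⟨hδ0, hδR⟩, fun r _ => ?_⟩
    exact image_eq_zero_of_notMem_tsupport (by simp [he])
  · obtain ⟨m, hm, hmin⟩ := hc.exists_isMinOn hne continuousOn_id
    obtain ⟨M, hM, hmax⟩ := hc.exists_isMaxOn hne continuousOn_id
    obtain ⟨β, hβ, hMβ⟩ := (eventually_endFilter (hs hM)).exists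
    have hm0 := (hs hm).1
    have hmM : m ≤ M := hmin hM
    refine ⟨m / 2, β, half_pos hm0, by linarith, hβ, fun r hr => ?_⟩
    refine image_eq_zero_of_notMem_tsupport fun hrt => hr ⟨?_, ?_⟩
    · have : m ≤ r := hmin hrt
      linarith
    · have : r ≤ M := hmax hrt
      linarith

lemma setIntegral_Iset_eq {R : ℝ≥0∞} {α β : ℝ} (hα : 0 < α) (hαβ : α < β) (hβ : β ∈ Iset R)
    {F : ℝ → ℝ} (hF : ∀ r ∉ Ioo α β, F r = 0) :
    ∫ r in Iset R, F r = ∫ r in α..β, F r := by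
  rw [intervalIntegral.integral_of_le hαβ.le]
  refine setIntegral_eq_of_subset_of_forall_sdiff_eq_zero (isOpen_Iset R).measurableSet
    (fun r hr => Iset_of_le hβ (hα.trans hr.1) hr.2) fun r hr => hF r fun h => hr.2 ⟨h.1, h.2.le⟩

lemma deriv_eq_zero_of_notMem_Ioo {α β : ℝ} {χ : ℝ → ℝ} (h1 : ContDiff ℝ 1 χ)
    (h : ∀ r ∉ Ioo α β, χ r = 0) : ∀ r ∉ Ioo α β, deriv χ r = 0 := by
  have hcont : Continuous (deriv χ) := h1.continuous_deriv_one
  intro r hr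
  have hr' : r ≤ α ∨ β ≤ r := by
    by_contra! h'
    exact hr h'
  rcases hr' with hr' | hr'
  · have hz : ∀ s ∈ Iio α, deriv χ s = 0 := by
      intro s hs
      have : χ =ᶠ[𝓝 s] fun _ => 0 := by
        filter_upwards [Iio_mem_nhds hs] with t ht
        exact h t fun h' => absurd h'.1 (not_lt.2 (le_of_lt ht))
      rw [this.deriv_eq, deriv_const]
    have : closure (Iio α) ⊆ {s | deriv χ s = 0} :=
      closure_minimal hz (isClosed_eq hcont continuous_const)
    rw [closure_Iio] at this
    exact this hr'
  · have hz : ∀ s ∈ Ioi β, deriv χ s = 0 := by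
      intro s hs
      have : χ =ᶠ[𝓝 s] fun _ => 0 := by
        filter_upwards [Ioi_mem_nhds hs] with t ht
        exact h t fun h' => absurd h'.2 (not_lt.2 (le_of_lt ht))
      rw [this.deriv_eq, deriv_const]
    have : closure (Ioi β) ⊆ {s | deriv χ s = 0} :=
      closure_minimal hz (isClosed_eq hcont continuous_const)
    rw [closure_Ioi] at this
    exact this hr'

lemma exists_deriv_smoothTransition_bound :
    ∃ C : ℝ, 0 < C ∧ ∀ t, |deriv Real.smoothTransition t| ≤ C := by
  have hd : ContDiff ℝ 1 Real.smoothTransition := Real.smoothTransition.contDiff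
  obtain ⟨C, hC⟩ := isCompact_Icc.exists_bound_of_continuousOn (s := Icc (0:ℝ) 1)
    hd.continuous_deriv_one.continuousOn
  refine ⟨|C| + 1, by positivity, fun t => ?_⟩
  by_cases ht : t ∈ Icc (0:ℝ) 1
  · have := hC t ht
    rw [Real.norm_eq_abs] at this
    linarith [le_abs_self C]
  · have : deriv Real.smoothTransition t = 0 := by
      rcases not_and_or.1 ht with h | h
      · have : Real.smoothTransition =ᶠ[𝓝 t] fun _ => 0 := by
          filter_upwards [Iio_mem_nhds (not_le.1 h)] with s hs
          exact Real.smoothTransition.zero_of_nonpos (le_of_lt hs)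
        rw [this.deriv_eq, deriv_const]
      · have : Real.smoothTransition =ᶠ[𝓝 t] fun _ => 1 := by
          filter_upwards [Ioi_mem_nhds (not_le.1 h)] with s hs
          exact Real.smoothTransition.one_of_one_le (le_of_lt hs)
        rw [this.deriv_eq, deriv_const]
    rw [this, abs_zero]
    positivity

/-- Logarithmic cut-off functions near the origin. -/
lemma exists_log_cutoff : ∃ C : ℝ, 0 < C ∧ ∀ n : ℝ, 0 < n → ∃ l : ℝ → ℝ,
    ContDiff ℝ (⊤ : ℕ∞) l ∧ (∀ r, 0 ≤ l r ∧ l r ≤ 1) ∧ (∀ r ≤ exp (-(2 * n)), l r = 0) ∧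
    (∀ r, exp (-n) ≤ r → l r = 1) ∧ ∀ r, 0 < r → |deriv l r| ≤ C / (n * r) := by
  obtain ⟨C, hC, hb⟩ := exists_deriv_smoothTransition_bound
  refine ⟨C, hC, fun n hn => ?_⟩
  set l : ℝ → ℝ := fun r => if 0 < r then Real.smoothTransition (2 + log r / n) else 0 with hl
  have hpos : ∀ r, 0 < r → l =ᶠ[𝓝 r] fun r => Real.smoothTransition (2 + log r / n) := by
    intro r hr
    filter_upwards [Ioi_mem_nhds hr] with s hs
    simp only [hl]
    rw [if_pos (show 0 < s from hs)]
  have hzero : ∀ r ≤ exp (-(2 * n)), l r = 0 := by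
    intro r hr
    simp only [hl]
    split_ifs with h
    · refine Real.smoothTransition.zero_of_nonpos ?_
      have : log r ≤ -(2 * n) := by rwa [Real.log_le_iff_le_exp h]
      have : log r / n ≤ -2 := by rw [div_le_iff₀ hn]; linarith
      linarith
    · rfl
  refine ⟨l, ?_, ?_, hzero, ?_, ?_⟩
  · rw [contDiff_iff_contDiffAt]
    intro r
    rcases lt_or_ge 0 r with h | h
    · refine ContDiffAt.congr_of_eventuallyEq ?_ (hpos r h)
      exact Real.smoothTransition.contDiff.contDiffAt.comp r
        (contDiffAt_const.add ((Real.contDiffAt_log.2 h.ne').div_const n))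
    · refine (contDiffAt_const (c := (0:ℝ))).congr_of_eventuallyEq ?_
      filter_upwards [Iio_mem_nhds (h.trans_lt (exp_pos (-(2 * n))))] with s hs
      exact hzero s (le_of_lt hs)
  · intro r
    simp only [hl]
    split_ifs
    · exact ⟨Real.smoothTransition.nonneg _, Real.smoothTransition.le_one _⟩
    · norm_num
  · intro r hr
    have h0 : 0 < r := (exp_pos _).trans_le hr
    simp only [hl]
    rw [if_pos h0]
    refine Real.smoothTransition.one_of_one_le ?_
    have : -n ≤ log r := by rwa [Real.le_log_iff_exp_le h0]
    have : -1 ≤ log r / n := by rw [le_div_iff₀ hn]; linarith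
    linarith
  · intro r hr
    have hd : HasDerivAt (fun r => Real.smoothTransition (2 + log r / n))
        (deriv Real.smoothTransition (2 + log r / n) * (r⁻¹ / n)) r :=
      HasDerivAt.comp r (h₂ := Real.smoothTransition) (h := fun r => 2 + log r / n)
        ((Real.smoothTransition.contDiff (n := 1)).differentiable one_ne_zero _).hasDerivAt
        (((Real.hasDerivAt_log hr.ne').div_const n).const_add 2)
    rw [(hpos r hr).deriv_eq, hd.deriv, abs_mul, abs_of_pos (by positivity : 0 < r⁻¹ / n)]
    calc |deriv Real.smoothTransition (2 + log r / n)| * (r⁻¹ / n) ≤ C * (r⁻¹ / n) := by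
          gcongr; exact hb _
      _ = C / (n * r) := by field_simp

lemma exists_start_cutoff {R : ℝ≥0∞} {m : ℝ → ℝ} (hm : ∀ r ∈ Iset R, 0 ≤ m r) {C δ : ℝ}
    (hδ : 0 < δ) (hC : ∀ r ∈ Ioc 0 δ, m r ≤ C) {ε α : ℝ} (hε : 0 < ε) (hα : 0 < α) :
    ∃ l G : ℝ → ℝ, ContDiff ℝ 1 l ∧ (∀ r, 0 ≤ l r ∧ l r ≤ 1) ∧ (∀ r, α ≤ r → l r = 1) ∧
      (∃ α' > 0, ∀ r ≤ α', l r = 0) ∧ IntegrableOn G (Iset R) ∧ ∫ r in Iset R, G r ≤ ε ∧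
      ∀ r ∈ Iset R, deriv l r ^ 2 * m r * r ≤ G r := by
  obtain ⟨D, hD, hcut⟩ := exists_log_cutoff
  obtain ⟨n, hn0, hn1, hn2⟩ : ∃ n : ℝ, 0 < n ∧ exp (-n) ≤ min α δ ∧ D ^ 2 * |C| / n ≤ ε := by
    have h1 : Tendsto (fun n : ℝ => exp (-n)) atTop (𝓝 0) :=
      Real.tendsto_exp_neg_atTop_nhds_zero
    have h2 : Tendsto (fun n : ℝ => D ^ 2 * |C| / n) atTop (𝓝 0) :=
      tendsto_const_nhds.div_atTop tendsto_id
    obtain ⟨n, h1, h2, h3⟩ := ((eventually_gt_atTop (0:ℝ)).and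
      ((h1.eventually_le_const (lt_min hα hδ)).and (h2.eventually_le_const hε))).exists
    exact ⟨n, h1, h2, h3⟩
  obtain ⟨l, hl1, hl2, hl3, hl4, hl5⟩ := hcut n hn0
  have hee : exp (-(2 * n)) ≤ exp (-n) := exp_le_exp.2 (by linarith)
  set G : ℝ → ℝ := (Icc (exp (-(2 * n))) (exp (-n))).indicator
    (fun r => D ^ 2 * |C| / n ^ 2 * r⁻¹) with hG
  have hcont : ContinuousOn (fun r : ℝ => D ^ 2 * |C| / n ^ 2 * r⁻¹)
      (Icc (exp (-(2 * n))) (exp (-n))) :=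
    continuousOn_const.mul (continuousOn_inv₀.mono fun r hr => ((exp_pos _).trans_le hr.1).ne')
  have hGi : Integrable G := hcont.integrableOn_Icc.integrable_indicator measurableSet_Icc
  have hG0 : ∀ r, 0 ≤ G r := fun r => indicator_nonneg (fun s hs => by
    have : 0 < s := (exp_pos _).trans_le hs.1
    positivity) r
  refine ⟨l, G, hl1.of_le (by exact_mod_cast le_top), hl2, fun r hr => hl4 r
    ((hn1.trans (min_le_left _ _)).trans hr), ⟨_, exp_pos _, hl3⟩, hGi.integrableOn, ?_, ?_⟩
  · calc ∫ r in Iset R, G r ≤ ∫ r, G r :=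
          setIntegral_le_integral hGi (Filter.Eventually.of_forall hG0)
      _ = D ^ 2 * |C| / n := by
          rw [hG, integral_indicator measurableSet_Icc, integral_Icc_eq_integral_Ioc,
            ← intervalIntegral.integral_of_le hee, intervalIntegral.integral_const_mul,
            integral_inv_of_pos (exp_pos _) (exp_pos _), ← exp_sub, log_exp]
          field_simp
          ring
      _ ≤ ε := hn2
  · intro r hr
    by_cases hr' : r ∈ Icc (exp (-(2 * n))) (exp (-n))
    · rw [hG, indicator_of_mem hr']
      have hr0 := hr.1
      have h1 : deriv l r ^ 2 ≤ (D / (n * r)) ^ 2 := by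
        rw [← sq_abs (deriv l r)]; gcongr; exact hl5 r hr0
      have h2 : m r ≤ |C| :=
        (hC r ⟨hr0, hr'.2.trans (hn1.trans (min_le_right _ _))⟩).trans (le_abs_self _)
      calc deriv l r ^ 2 * m r * r ≤ (D / (n * r)) ^ 2 * |C| * r := by
            gcongr
            exact hm r hr
        _ = D ^ 2 * |C| / n ^ 2 * r⁻¹ := by field_simp
    · rw [hG, indicator_of_notMem hr']
      have : deriv l r = 0 := by
        rcases not_and_or.1 hr' with h | h
        · have : l =ᶠ[𝓝 r] fun _ => 0 := by
            filter_upwards [Iio_mem_nhds (not_le.1 h)] with s hs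
            exact hl3 s (le_of_lt hs)
          rw [this.deriv_eq, deriv_const]
        · have : l =ᶠ[𝓝 r] fun _ => 1 := by
            filter_upwards [Ioi_mem_nhds (not_le.1 h)] with s hs
            exact hl4 s (le_of_lt hs)
          rw [this.deriv_eq, deriv_const]
      rw [this]
      simp

lemma exists_end_cutoff_top {m : ℝ → ℝ} (hm : ∀ r ∈ Iset ⊤, 0 ≤ m r) {C r₀ : ℝ}
    (hC : ∀ r, r₀ ≤ r → m r ≤ C) {ε β : ℝ} (hε : 0 < ε) :
    ∃ l G : ℝ → ℝ, ContDiff ℝ 1 l ∧ (∀ r, 0 ≤ l r ∧ l r ≤ 1) ∧ (∀ r ≤ β, l r = 1) ∧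
      (∃ β' ∈ Iset ⊤, ∀ r, β' ≤ r → l r = 0) ∧ IntegrableOn G (Iset ⊤) ∧
      ∫ r in Iset ⊤, G r ≤ ε ∧ ∀ r ∈ Iset ⊤, deriv l r ^ 2 * m r * r ≤ G r := by
  obtain ⟨D, hD, hcut⟩ := exists_log_cutoff
  obtain ⟨n, hn0, hn1, hn2⟩ : ∃ n : ℝ, 0 < n ∧ max β r₀ ≤ exp n ∧ D ^ 2 * |C| / n ≤ ε := by
    have h2 : Tendsto (fun n : ℝ => D ^ 2 * |C| / n) atTop (𝓝 0) :=
      tendsto_const_nhds.div_atTop tendsto_id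
    obtain ⟨n, h1, h2, h3⟩ := ((eventually_gt_atTop (0:ℝ)).and
      ((Real.tendsto_exp_atTop.eventually_ge_atTop (max β r₀)).and
        (h2.eventually_le_const hε))).exists
    exact ⟨n, h1, h2, h3⟩
  obtain ⟨l₀, hl1, hl2, hl3, hl4, hl5⟩ := hcut n hn0
  have hee : exp n ≤ exp (2 * n) := exp_le_exp.2 (by linarith)
  set q := exp (-(3 * n)) with hq
  have hq0 : 0 < q := exp_pos _
  set l : ℝ → ℝ := fun r => 1 - l₀ (q * r) with hl
  have e1 : q * exp n = exp (-(2 * n)) := by rw [hq, ← exp_add]; ring_nf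
  have e2 : q * exp (2 * n) = exp (-n) := by rw [hq, ← exp_add]; ring_nf
  have hone : ∀ r ≤ exp n, l r = 1 := by
    intro r hr
    simp only [hl]
    rw [hl3, sub_zero]
    rw [← e1]; gcongr
  have hzero : ∀ r, exp (2 * n) ≤ r → l r = 0 := by
    intro r hr
    simp only [hl]
    rw [hl4, sub_self]
    rw [← e2]; gcongr
  have hd1 : ContDiff ℝ 1 l₀ := hl1.of_le (by exact_mod_cast le_top)
  have hld : ∀ r, 0 < r → |deriv l r| ≤ D / (n * r) := by
    intro r hr
    have hd : HasDerivAt l (-(deriv l₀ (q * r) * (q * 1))) r :=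
      (HasDerivAt.comp r (h₂ := l₀) (h := fun r => q * r)
        (hd1.differentiable one_ne_zero _).hasDerivAt
        ((hasDerivAt_id' r).const_mul q)).const_sub 1
    rw [hd.deriv, abs_neg, abs_mul, mul_one, abs_of_pos hq0]
    calc |deriv l₀ (q * r)| * q ≤ D / (n * (q * r)) * q := by
          gcongr; exact hl5 _ (by positivity)
      _ = D / (n * r) := by field_simp
  set G : ℝ → ℝ := (Icc (exp n) (exp (2 * n))).indicator
    (fun r => D ^ 2 * |C| / n ^ 2 * r⁻¹) with hG
  have hcont : ContinuousOn (fun r : ℝ => D ^ 2 * |C| / n ^ 2 * r⁻¹)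
      (Icc (exp n) (exp (2 * n))) :=
    continuousOn_const.mul (continuousOn_inv₀.mono fun r hr => ((exp_pos _).trans_le hr.1).ne')
  have hGi : Integrable G := hcont.integrableOn_Icc.integrable_indicator measurableSet_Icc
  have hG0 : ∀ r, 0 ≤ G r := fun r => indicator_nonneg (fun s hs => by
    have : 0 < s := (exp_pos _).trans_le hs.1
    positivity) r
  refine ⟨l, G, contDiff_const.sub (hd1.comp (contDiff_const.mul contDiff_id)),
    fun r => ⟨by linarith [(hl2 (q * r)).2], by linarith [(hl2 (q * r)).1]⟩,
    fun r hr => hone r (hr.trans ((le_max_left _ _).trans hn1)),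
    ⟨exp (2 * n), mem_Iset_top.2 (exp_pos _), hzero⟩, hGi.integrableOn, ?_, ?_⟩
  · calc ∫ r in Iset ⊤, G r ≤ ∫ r, G r :=
          setIntegral_le_integral hGi (Filter.Eventually.of_forall hG0)
      _ = D ^ 2 * |C| / n := by
          rw [hG, integral_indicator measurableSet_Icc, integral_Icc_eq_integral_Ioc,
            ← intervalIntegral.integral_of_le hee, intervalIntegral.integral_const_mul,
            integral_inv_of_pos (exp_pos _) (exp_pos _), ← exp_sub, log_exp]
          field_simp
          ring
      _ ≤ ε := hn2
  · intro r hr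
    by_cases hr' : r ∈ Icc (exp n) (exp (2 * n))
    · rw [hG, indicator_of_mem hr']
      have hr0 := hr.1
      have h1 : deriv l r ^ 2 ≤ (D / (n * r)) ^ 2 := by
        rw [← sq_abs (deriv l r)]; gcongr; exact hld r hr0
      have h2 : m r ≤ |C| :=
        (hC r (((le_max_right _ _).trans hn1).trans hr'.1)).trans (le_abs_self _)
      calc deriv l r ^ 2 * m r * r ≤ (D / (n * r)) ^ 2 * |C| * r := by
            gcongr
            exact hm r hr
        _ = D ^ 2 * |C| / n ^ 2 * r⁻¹ := by field_simp
    · rw [hG, indicator_of_notMem hr']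
      have : deriv l r = 0 := by
        rcases not_and_or.1 hr' with h | h
        · have : l =ᶠ[𝓝 r] fun _ => 1 := by
            filter_upwards [Iio_mem_nhds (not_le.1 h)] with s hs
            exact hone s (le_of_lt hs)
          rw [this.deriv_eq, deriv_const]
        · have : l =ᶠ[𝓝 r] fun _ => 0 := by
            filter_upwards [Ioi_mem_nhds (not_le.1 h)] with s hs
            exact hzero s (le_of_lt hs)
          rw [this.deriv_eq, deriv_const]
      rw [this]
      simp

lemma exists_end_cutoff_fin {R : ℝ≥0∞} (hR : R ≠ ⊤) {m : ℝ → ℝ} (hm : ∀ r ∈ Iset R, 0 ≤ m r)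
    {C r₀ : ℝ} (hr₀ : r₀ ∈ Iset R)
    (hC : ∀ r ∈ Iset R, r₀ ≤ r → m r ≤ C * (R.toReal - r) ^ 2) {ε β : ℝ} (hε : 0 < ε)
    (hβ : β ∈ Iset R) :
    ∃ l G : ℝ → ℝ, ContDiff ℝ 1 l ∧ (∀ r, 0 ≤ l r ∧ l r ≤ 1) ∧ (∀ r ≤ β, l r = 1) ∧
      (∃ β' ∈ Iset R, ∀ r, β' ≤ r → l r = 0) ∧ IntegrableOn G (Iset R) ∧
      ∫ r in Iset R, G r ≤ ε ∧ ∀ r ∈ Iset R, deriv l r ^ 2 * m r * r ≤ G r := by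
  obtain ⟨D, hD, hb⟩ := exists_deriv_smoothTransition_bound
  set T := R.toReal with hT
  have hr₀' := (mem_Iset_of_ne_top hR).1 hr₀
  have hβ' := (mem_Iset_of_ne_top hR).1 hβ
  have hT0 : 0 < T := hβ'.1.trans hβ'.2
  obtain ⟨n, hn0, hn1, hn2⟩ : ∃ n : ℝ, 0 < n ∧ 2 / n ≤ min (T - β) (T - r₀) ∧
      4 * D ^ 2 * |C| * T / n ≤ ε := by
    have h1 : Tendsto (fun n : ℝ => 2 / n) atTop (𝓝 0) :=
      tendsto_const_nhds.div_atTop tendsto_id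
    have h2 : Tendsto (fun n : ℝ => 4 * D ^ 2 * |C| * T / n) atTop (𝓝 0) :=
      tendsto_const_nhds.div_atTop tendsto_id
    obtain ⟨n, h1, h2, h3⟩ := ((eventually_gt_atTop (0:ℝ)).and
      ((h1.eventually_le_const (lt_min (sub_pos.2 hβ'.2) (sub_pos.2 hr₀'.2))).and
        (h2.eventually_le_const hε))).exists
    exact ⟨n, h1, h2, h3⟩
  have hnβ : β ≤ T - 2 / n := by linarith [min_le_left (T - β) (T - r₀)]
  have hnr : r₀ ≤ T - 2 / n := by linarith [min_le_right (T - β) (T - r₀)]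
  have hnn : 2 / n = 1 / n + 1 / n := by ring
  have hn' : 0 < 1 / n := by positivity
  set l : ℝ → ℝ := fun r => Real.smoothTransition (n * (T - r) - 1) with hl
  have hone : ∀ r ≤ T - 2 / n, l r = 1 := by
    intro r hr
    refine Real.smoothTransition.one_of_one_le ?_
    have : n * (2 / n) ≤ n * (T - r) := by gcongr; linarith
    have e : n * (2 / n) = 2 := by field_simp
    linarith
  have hzero : ∀ r, T - 1 / n ≤ r → l r = 0 := by
    intro r hr
    refine Real.smoothTransition.zero_of_nonpos ?_
    have : n * (T - r) ≤ n * (1 / n) := by gcongr; linarith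
    have e : n * (1 / n) = 1 := by field_simp
    linarith
  have hd1 : ContDiff ℝ 1 Real.smoothTransition := Real.smoothTransition.contDiff
  have hld : ∀ r, |deriv l r| ≤ D * n := by
    intro r
    have hd : HasDerivAt l (deriv Real.smoothTransition (n * (T - r) - 1) * (n * (-1))) r :=
      HasDerivAt.comp r (h₂ := Real.smoothTransition) (h := fun r => n * (T - r) - 1)
        (hd1.differentiable one_ne_zero _).hasDerivAt
        ((((hasDerivAt_id' r).const_sub T).const_mul n).sub_const 1)
    rw [hd.deriv, abs_mul, mul_neg_one, abs_neg, abs_of_pos hn0]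
    gcongr
    exact hb _
  set G : ℝ → ℝ := (Icc (T - 2 / n) (T - 1 / n)).indicator
    (fun _ => 4 * D ^ 2 * |C| * T) with hG
  have hGi : Integrable G := (integrableOn_const (by simp)).integrable_indicator measurableSet_Icc
  have hG0 : ∀ r, 0 ≤ G r := fun r => indicator_nonneg (fun s hs => by positivity) r
  refine ⟨l, G, hd1.comp ((contDiff_const.mul (contDiff_const.sub contDiff_id)).sub
    contDiff_const), fun r => ⟨Real.smoothTransition.nonneg _, Real.smoothTransition.le_one _⟩,
    fun r hr => hone r (hr.trans hnβ),
    ⟨T - 1 / n, (mem_Iset_of_ne_top hR).2 ⟨by linarith, by linarith⟩, hzero⟩,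
    hGi.integrableOn, ?_, ?_⟩
  · calc ∫ r in Iset R, G r ≤ ∫ r, G r :=
          setIntegral_le_integral hGi (Filter.Eventually.of_forall hG0)
      _ = 4 * D ^ 2 * |C| * T / n := by
          rw [hG, integral_indicator measurableSet_Icc, setIntegral_const]
          simp only [measureReal_def, Real.volume_Icc, smul_eq_mul]
          rw [ENNReal.toReal_ofReal (by linarith)]
          rw [hnn]
          ring
      _ ≤ ε := hn2
  · intro r hr
    have hrT := (mem_Iset_of_ne_top hR).1 hr
    by_cases hr' : r ∈ Icc (T - 2 / n) (T - 1 / n)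
    · rw [hG, indicator_of_mem hr']
      have hr0 := hr.1
      have h1 : deriv l r ^ 2 ≤ (D * n) ^ 2 := by
        rw [← sq_abs (deriv l r)]; gcongr; exact hld r
      have h3 : (T - r) ^ 2 ≤ (2 / n) ^ 2 := by
        have : 0 ≤ T - r := by linarith [hrT.2]
        gcongr
        linarith [hr'.1]
      have h2 : m r ≤ |C| * (2 / n) ^ 2 :=
        (hC r hr (hnr.trans hr'.1)).trans (by gcongr; exact le_abs_self C)
      have hm0 := hm r hr
      calc deriv l r ^ 2 * m r * r ≤ (D * n) ^ 2 * (|C| * (2 / n) ^ 2) * T := by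
            gcongr
            exact hrT.2.le
        _ = 4 * D ^ 2 * |C| * T := by field_simp; ring
    · rw [hG, indicator_of_notMem hr']
      have : deriv l r = 0 := by
        rcases not_and_or.1 hr' with h | h
        · have : l =ᶠ[𝓝 r] fun _ => 1 := by
            filter_upwards [Iio_mem_nhds (not_le.1 h)] with s hs
            exact hone s (le_of_lt hs)
          rw [this.deriv_eq, deriv_const]
        · have : l =ᶠ[𝓝 r] fun _ => 0 := by
            filter_upwards [Ioi_mem_nhds (not_le.1 h)] with s hs
            exact hzero s (le_of_lt hs)
          rw [this.deriv_eq, deriv_const]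
      rw [this]
      simp

/-- A nonnegative `m` satisfying the reverse Hardy-type inequality
`∫ χ² m / r ≤ ∫ χ'² m r` for all cut-offs `χ` vanishes, provided it is small near the ends. -/
lemma eq_zero_of_cutoff_inequality {R : ℝ≥0∞} {m : ℝ → ℝ} (hm : ∀ r ∈ Iset R, 0 ≤ m r)
    (hmc : ContinuousOn m (Iset R)) {C δ : ℝ} (hδ : 0 < δ) (hC : ∀ r ∈ Ioc 0 δ, m r ≤ C)
    (htop : R = ⊤ → ∃ C r₀ : ℝ, ∀ r, r₀ ≤ r → m r ≤ C)
    (hfin : R ≠ ⊤ → ∃ C : ℝ, ∃ r₀ ∈ Iset R, ∀ r ∈ Iset R, r₀ ≤ r →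
      m r ≤ C * (R.toReal - r) ^ 2)
    (hin : ∀ χ : ℝ → ℝ, ContDiff ℝ 1 χ → HasCompactSupport χ → tsupport χ ⊆ Iset R →
      ∫ r in Iset R, χ r ^ 2 * (m r / r) ≤ ∫ r in Iset R, deriv χ r ^ 2 * m r * r) :
    ∀ r ∈ Iset R, m r = 0 := by
  intro r₁ hr₁
  by_contra hne
  have hpos : 0 < m r₁ := lt_of_le_of_ne (hm r₁ hr₁) (Ne.symm hne)
  obtain ⟨β, hβ, hr₁β⟩ := (eventually_endFilter hr₁).exists
  have hα : 0 < r₁ / 2 := half_pos hr₁.1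
  have hαβ : r₁ / 2 < β := by linarith [hr₁.1]
  have hsub : Icc (r₁ / 2) β ⊆ Iset R := fun r hr => Iset_of_le hβ (hα.trans_le hr.1) hr.2
  have hmr : ContinuousOn (fun r => m r / r) (Iset R) :=
    hmc.div continuousOn_id fun r hr => hr.1.ne'
  have hint : 0 < ∫ r in r₁ / 2..β, m r / r := by
    refine intervalIntegral.integral_pos hαβ (hmr.mono hsub) (fun r hr => ?_)
      ⟨r₁, ⟨by linarith [hr₁.1], hr₁β.le⟩, div_pos hpos hr₁.1⟩
    have := hsub ⟨hr.1.le, hr.2⟩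
    exact div_nonneg (hm r this) this.1.le
  set ε := (∫ r in r₁ / 2..β, m r / r) / 5 with hε
  have hε0 : 0 < ε := by positivity
  obtain ⟨l, G, hl1, hl2, hl3, ⟨α', hα', hl4⟩, hG1, hG2, hG3⟩ :=
    exists_start_cutoff hm hδ hC hε0 hα
  obtain ⟨l', G', hl1', hl2', hl3', ⟨β', hβ', hl4'⟩, hG1', hG2', hG3'⟩ :
      ∃ l G : ℝ → ℝ, ContDiff ℝ 1 l ∧ (∀ r, 0 ≤ l r ∧ l r ≤ 1) ∧ (∀ r ≤ β, l r = 1) ∧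
      (∃ β' ∈ Iset R, ∀ r, β' ≤ r → l r = 0) ∧ IntegrableOn G (Iset R) ∧
      ∫ r in Iset R, G r ≤ ε ∧ ∀ r ∈ Iset R, deriv l r ^ 2 * m r * r ≤ G r := by
    by_cases hR : R = ⊤
    · subst hR
      obtain ⟨C, r₀, h⟩ := htop rfl
      exact exists_end_cutoff_top hm h hε0
    · obtain ⟨C, r₀, hr₀, h⟩ := hfin hR
      exact exists_end_cutoff_fin hR hm hr₀ h hε0 hβ
  have hsupp : ∀ r ∉ Icc α' β', (l * l') r = 0 := by
    intro r hr
    simp only [Pi.mul_apply]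
    rcases not_and_or.1 hr with h | h
    · rw [hl4 r (not_le.1 h).le, zero_mul]
    · rw [hl4' r (not_le.1 h).le, mul_zero]
  have hts : tsupport (l * l') ⊆ Icc α' β' := by
    refine closure_minimal (fun r hr => ?_) isClosed_Icc
    by_contra h
    exact hr (hsupp r h)
  have hIsub : Icc α' β' ⊆ Iset R := fun r hr => Iset_of_le hβ' (hα'.trans_le hr.1) hr.2
  have h1 := hin (l * l') (hl1.mul hl1')
    (HasCompactSupport.of_support_subset_isCompact isCompact_Icc
      ((subset_tsupport _).trans hts)) (hts.trans hIsub)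
  have h2 : ∫ r in Iset R, deriv (l * l') r ^ 2 * m r * r
      ≤ ∫ r in Iset R, (2 * G r + 2 * G' r) := by
    refine integral_mono_of_nonneg ?_ ((hG1.const_mul 2).add (hG1'.const_mul 2)) ?_
    · filter_upwards [ae_restrict_mem (isOpen_Iset R).measurableSet] with r hr
      exact mul_nonneg (mul_nonneg (sq_nonneg _) (hm r hr)) hr.1.le
    · filter_upwards [ae_restrict_mem (isOpen_Iset R).measurableSet] with r hr
      have hd : deriv (l * l') r = deriv l r * l' r + l r * deriv l' r :=
        (((hl1.differentiable one_ne_zero r).hasDerivAt).mul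
          ((hl1'.differentiable one_ne_zero r).hasDerivAt)).deriv
      have e1 : (deriv l r * l' r) ^ 2 ≤ deriv l r ^ 2 := by
        rw [mul_pow]
        exact mul_le_of_le_one_right (sq_nonneg _) (pow_le_one₀ (hl2' r).1 (hl2' r).2)
      have e2 : (l r * deriv l' r) ^ 2 ≤ deriv l' r ^ 2 := by
        rw [mul_pow]
        exact mul_le_of_le_one_left (sq_nonneg _) (pow_le_one₀ (hl2 r).1 (hl2 r).2)
      have e3 : deriv (l * l') r ^ 2 ≤ 2 * deriv l r ^ 2 + 2 * deriv l' r ^ 2 := by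
        rw [hd]
        nlinarith [sq_nonneg (deriv l r * l' r - l r * deriv l' r)]
      have hmr0 : 0 ≤ m r * r := mul_nonneg (hm r hr) hr.1.le
      have e4 := mul_le_mul_of_nonneg_right e3 hmr0
      have := hG3 r hr
      have := hG3' r hr
      linarith
  rw [integral_add (hG1.const_mul 2) (hG1'.const_mul 2), integral_const_mul,
    integral_const_mul] at h2
  have h3 : ∫ r in r₁ / 2..β, m r / r ≤ ∫ r in Iset R, (l * l') r ^ 2 * (m r / r) := by
    have hcong : ∫ r in r₁ / 2..β, m r / r
        = ∫ r in Ioc (r₁ / 2) β, (l * l') r ^ 2 * (m r / r) := by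
      rw [intervalIntegral.integral_of_le hαβ.le]
      refine setIntegral_congr_fun measurableSet_Ioc fun r hr => ?_
      simp only [Pi.mul_apply]
      rw [hl3 r hr.1.le, hl3' r hr.2]
      simp
    rw [hcong]
    refine setIntegral_mono_set ?_ ?_ ?_
    · have hcont : ContinuousOn (fun r => (l * l') r ^ 2 * (m r / r)) (Icc α' β') :=
        (((hl1.mul hl1').continuous.pow 2).continuousOn).mul (hmr.mono hIsub)
      have hz : Function.support (fun r => (l * l') r ^ 2 * (m r / r)) ⊆ Icc α' β' := by
        intro r hr
        by_contra h
        exact hr (by simp only; rw [hsupp r h]; simp)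
      exact ((integrableOn_iff_integrable_of_support_subset hz).1
        hcont.integrableOn_Icc).integrableOn
    · filter_upwards [ae_restrict_mem (isOpen_Iset R).measurableSet] with r hr
      exact mul_nonneg (sq_nonneg _) (div_nonneg (hm r hr) hr.1.le)
    · exact (Filter.Eventually.of_forall fun r hr => hsub ⟨hr.1.le, hr.2⟩)
  linarith

lemma abs_deriv_le_of_weighted_deriv {Y dY e : ℝ → ℝ} {M K : ℝ}
    (hY : ∀ r, 1 ≤ r → HasDerivAt Y (dY r) r)
    (hdY : ∀ r, 1 ≤ r → HasDerivAt (fun r => r * dY r) (r * e r) r)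
    (hM : ∀ r, 1 ≤ r → |Y r| ≤ M) (hK : ∀ r, 1 ≤ r → |e r| ≤ K) :
    ∀ r, 1 ≤ r → |dY r| ≤ 4 * M + 2 * K := by
  intro r hr
  have hK0 : 0 ≤ K := (abs_nonneg _).trans (hK r hr)
  have hM0 : 0 ≤ M := (abs_nonneg _).trans (hM r hr)
  obtain ⟨s, hs, hsd⟩ := exists_hasDerivAt_eq_slope Y dY (lt_add_one r)
    (fun x hx => (hY x (hr.trans hx.1)).continuousAt.continuousWithinAt)
    (fun x hx => hY x (hr.trans hx.1.le))
  have h1 : |dY s| ≤ 2 * M := by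
    rw [hsd, add_sub_cancel_left, div_one]
    refine (abs_sub _ _).trans ?_
    linarith [hM r hr, hM (r + 1) (by linarith)]
  have h2 := (convex_Icc r s).norm_image_sub_le_of_norm_hasDerivWithin_le
    (f := fun t => t * dY t) (f' := fun t => t * e t) (C := s * K)
    (fun x hx => (hdY x (hr.trans hx.1)).hasDerivWithinAt)
    (fun x hx => by
      have hx0 : 0 < x := by linarith [hx.1]
      rw [Real.norm_eq_abs, abs_mul, abs_of_pos hx0]
      exact mul_le_mul hx.2 (hK x (hr.trans hx.1)) (abs_nonneg _) (hx0.le.trans hx.2))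
    (right_mem_Icc.2 hs.1.le) (left_mem_Icc.2 hs.1.le)
  rw [Real.norm_eq_abs, Real.norm_eq_abs, abs_sub_comm r s,
    abs_of_pos (sub_pos.2 hs.1)] at h2
  have h3 : |r * dY r| ≤ |s * dY s| + s * K * (s - r) := by
    have := abs_sub_abs_le_abs_sub (r * dY r) (s * dY s)
    linarith
  rw [abs_mul, abs_mul, abs_of_pos (by linarith : 0 < r),
    abs_of_pos (by linarith [hs.1] : 0 < s)] at h3
  have hs2 : s ≤ 2 * r := by linarith [hs.2]
  have h4 : s * |dY s| ≤ 2 * r * (2 * M) := by gcongr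
  have h5 : s * K * (s - r) ≤ 2 * r * K * 1 := by
    have : s - r ≤ 1 := by linarith [hs.2]
    have h0 : 0 ≤ s - r := by linarith [hs.1]
    gcongr
  have h6 : r * |dY r| ≤ r * (4 * M + 2 * K) := by linarith
  exact le_of_mul_le_mul_left h6 (by linarith)

lemma neg_mul_sub_le_deriv_of_le_limit {R : ℝ≥0∞} (hR : R ≠ ⊤) {Y dY e : ℝ → ℝ} {ℓ K r₀ : ℝ}
    (hr₀ : r₀ ∈ Iset R) (hY : ∀ r ∈ Iset R, HasDerivAt Y (dY r) r)
    (hdY : ∀ r ∈ Iset R, HasDerivAt (fun r => r * dY r) (r * e r) r)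
    (hle : ∀ r ∈ Iset R, Y r ≤ ℓ) (hlim : Tendsto Y (endFilter R) (𝓝 ℓ))
    (hK : ∀ r ∈ Iset R, r₀ ≤ r → |e r| ≤ K) :
    ∀ r ∈ Iset R, r₀ ≤ r → -(K * R.toReal / r₀ * (R.toReal - r)) ≤ dY r := by
  intro r hr hr0
  have hrT := (mem_Iset_of_ne_top hR).1 hr
  have hK0 : 0 ≤ K := (abs_nonneg _).trans (hK r hr hr0)
  have hT0 : 0 < R.toReal := hrT.1.trans hrT.2
  have hpos := hr₀.1
  suffices hmain : -(K * R.toReal * (R.toReal - r)) ≤ r * dY r by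
    by_contra! h
    have h1 : r * dY r < r * -(K * R.toReal / r₀ * (R.toReal - r)) :=
      mul_lt_mul_of_pos_left h hrT.1
    have h2 : K * R.toReal * (R.toReal - r)
        ≤ r * (K * R.toReal / r₀ * (R.toReal - r)) := by
      have h3 : 0 ≤ K * R.toReal * (R.toReal - r) :=
        mul_nonneg (mul_nonneg hK0 hT0.le) (by linarith)
      have h4 : r * (K * R.toReal / r₀ * (R.toReal - r))
          = (K * R.toReal * (R.toReal - r)) * (r / r₀) := by field_simp
      rw [h4]
      exact le_mul_of_one_le_right h3 ((one_le_div hpos).2 hr0)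
    linarith
  by_contra! hlt
  have hmem : ∀ s, r ≤ s → s < R.toReal → s ∈ Iset R := fun s h1 h2 =>
    (mem_Iset_of_ne_top hR).2 ⟨hrT.1.trans_le h1, h2⟩
  have hneg : ∀ s, r ≤ s → s < R.toReal → dY s < 0 := by
    intro s h1 h2
    have h := (convex_Icc r s).norm_image_sub_le_of_norm_hasDerivWithin_le
      (f := fun t => t * dY t) (f' := fun t => t * e t) (C := R.toReal * K)
      (fun x hx => (hdY x (hmem x hx.1 (hx.2.trans_lt h2))).hasDerivWithinAt)
      (fun x hx => by
        have hx' := hmem x hx.1 (hx.2.trans_lt h2)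
        rw [Real.norm_eq_abs, abs_mul, abs_of_pos hx'.1]
        exact mul_le_mul (hx.2.trans h2.le) (hK x hx' (hr0.trans hx.1)) (abs_nonneg _) hT0.le)
      (left_mem_Icc.2 h1) (right_mem_Icc.2 h1)
    rw [Real.norm_eq_abs, Real.norm_eq_abs, abs_of_nonneg (sub_nonneg.2 h1)] at h
    have h3 := (le_abs_self _).trans h
    have h4 : R.toReal * K * (s - r) ≤ R.toReal * K * (R.toReal - r) := by gcongr
    have h5 : s * dY s < 0 := by linarith
    by_contra! h6
    have := mul_nonneg (hrT.1.trans_le h1).le h6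
    linarith
  have hanti : StrictAntiOn Y (Ico r R.toReal) := by
    refine strictAntiOn_of_deriv_neg (convex_Ico _ _)
      (fun x hx => (hY x (hmem x hx.1 hx.2)).continuousAt.continuousWithinAt) fun x hx => ?_
    rw [interior_Ico] at hx
    rw [(hY x (hmem x hx.1.le hx.2)).deriv]
    exact hneg x hx.1.le hx.2
  obtain ⟨s, hs1, hs2⟩ := exists_between hrT.2
  have h1 : Y s < Y r := hanti ⟨le_rfl, hrT.2⟩ ⟨hs1.le, hs2⟩ hs1
  have h2 : ℓ ≤ Y s := by
    refine le_of_tendsto hlim ?_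
    filter_upwards [eventually_endFilter (hmem s hs1.le hs2)] with t ht
    have htT := ((mem_Iset_of_ne_top hR).1 ht.1).2
    exact (hanti ⟨hs1.le, hs2⟩ ⟨hs1.le.trans ht.2.le, htT⟩ ht.2).le
  linarith [hle r hr]

/-- A smooth convex approximation of the negative part. -/
def rho (ε t : ℝ) : ℝ := (√(t ^ 2 + ε ^ 2) - t) / 2

lemma rho_sqrt_pos {ε : ℝ} (hε : 0 < ε) (t : ℝ) : 0 < √(t ^ 2 + ε ^ 2) :=
  Real.sqrt_pos.2 (by positivity)

lemma abs_le_rho_sqrt (ε t : ℝ) : |t| ≤ √(t ^ 2 + ε ^ 2) :=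
  Real.abs_le_sqrt (by nlinarith [sq_nonneg ε])

lemma rho_sqrt_le {ε : ℝ} (hε : 0 < ε) (t : ℝ) : √(t ^ 2 + ε ^ 2) ≤ |t| + ε := by
  refine Real.sqrt_le_iff.2 ⟨by positivity, ?_⟩
  rw [← sq_abs t]
  nlinarith [abs_nonneg t]

lemma rho_nonneg (ε t : ℝ) : 0 ≤ rho ε t := by
  have := abs_le_rho_sqrt ε t
  have := le_abs_self t
  unfold rho
  linarith

lemma neg_rho_le (ε t : ℝ) : -rho ε t ≤ t := by
  have := abs_le_rho_sqrt ε t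
  have := neg_abs_le t
  unfold rho
  linarith

lemma rho_le_sqrt (ε t : ℝ) : rho ε t ≤ √(t ^ 2 + ε ^ 2) := by
  have := abs_le_rho_sqrt ε t
  have := neg_abs_le t
  unfold rho
  linarith

lemma rho_mul_sub (ε t : ℝ) :
    rho ε t * (√(t ^ 2 + ε ^ 2) - rho ε t) = ε ^ 2 / 4 := by
  have := Real.sq_sqrt (by positivity : 0 ≤ t ^ 2 + ε ^ 2)
  unfold rho
  nlinarith

lemma sq_min_le_rho_sq (ε t : ℝ) : min t 0 ^ 2 ≤ rho ε t ^ 2 := by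
  have h0 := rho_nonneg ε t
  have h1 := neg_rho_le ε t
  have h2 : min t 0 ≤ 0 := min_le_right _ _
  have h3 : -rho ε t ≤ min t 0 := le_min h1 (by linarith)
  nlinarith

lemma rho_sq_le {ε : ℝ} (hε : 0 < ε) (t : ℝ) :
    rho ε t ^ 2 ≤ min t 0 ^ 2 + (|t| * ε + ε ^ 2) := by
  have h0 := rho_nonneg ε t
  have h1 := rho_sqrt_le hε t
  rcases le_total t 0 with h | h
  · rw [min_eq_left h, abs_of_nonpos h] at *
    have : rho ε t ≤ -t + ε / 2 := by unfold rho; linarith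
    nlinarith
  · rw [min_eq_right h, abs_of_nonneg h] at *
    have : rho ε t ≤ ε / 2 := by unfold rho; linarith
    nlinarith [mul_nonneg h hε.le]

lemma hasDerivAt_rho {ε : ℝ} (hε : 0 < ε) (t : ℝ) :
    HasDerivAt (rho ε) (-(rho ε t / √(t ^ 2 + ε ^ 2))) t := by
  have hS := rho_sqrt_pos hε t
  have h1 : HasDerivAt (fun t : ℝ => t ^ 2 + ε ^ 2) (2 * t) t := by
    simpa using (hasDerivAt_pow 2 t).add_const (ε ^ 2)
  refine (((h1.sqrt (by positivity)).sub (hasDerivAt_id' t)).div_const 2).of_eq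
    (fun s => rfl) ?_
  unfold rho
  field_simp
  ring

lemma continuous_rho (ε : ℝ) : Continuous (rho ε) := by
  unfold rho
  fun_prop

/-- `-rho * rho'`. -/
def rhoFlux (ε t : ℝ) : ℝ := rho ε t - ε ^ 2 / (4 * √(t ^ 2 + ε ^ 2))

lemma rhoFlux_eq {ε : ℝ} (hε : 0 < ε) (t : ℝ) :
    rhoFlux ε t = rho ε t ^ 2 / √(t ^ 2 + ε ^ 2) := by
  have hS := rho_sqrt_pos hε t
  have := rho_mul_sub ε t
  rw [rhoFlux, eq_div_iff hS.ne']
  field_simp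
  linarith

lemma rhoFlux_nonneg {ε : ℝ} (hε : 0 < ε) (t : ℝ) : 0 ≤ rhoFlux ε t := by
  rw [rhoFlux_eq hε]
  positivity

lemma rhoFlux_le {ε : ℝ} (hε : 0 < ε) (t : ℝ) : rhoFlux ε t ≤ rho ε t := by
  have hS := rho_sqrt_pos hε t
  have : 0 ≤ ε ^ 2 / (4 * √(t ^ 2 + ε ^ 2)) := by positivity
  unfold rhoFlux
  linarith

lemma continuous_rhoFlux {ε : ℝ} (hε : 0 < ε) : Continuous (rhoFlux ε) := by
  unfold rhoFlux
  refine (continuous_rho ε).sub (continuous_const.div (by fun_prop) fun t => ?_)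
  have := rho_sqrt_pos hε t
  positivity

/-- `-(rho * rho')' ≥ rho'²`. -/
lemma exists_hasDerivAt_rhoFlux {ε : ℝ} (hε : 0 < ε) : ∃ φ : ℝ → ℝ, Continuous φ ∧
    (∀ t, HasDerivAt (rhoFlux ε) (φ t) t) ∧
      ∀ t, (rho ε t / √(t ^ 2 + ε ^ 2)) ^ 2 ≤ -φ t := by
  refine ⟨fun t => -(rho ε t / √(t ^ 2 + ε ^ 2)) + ε ^ 2 * t / (4 * √(t ^ 2 + ε ^ 2) ^ 3),
    ?_, fun t => ?_, fun t => ?_⟩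
  · refine ((continuous_rho ε).div (by fun_prop) fun t => (rho_sqrt_pos hε t).ne').neg.add
      (Continuous.div (by fun_prop) (by fun_prop) fun t => ?_)
    have := rho_sqrt_pos hε t
    positivity
  · have hS := rho_sqrt_pos hε t
    have h1 : HasDerivAt (fun t : ℝ => t ^ 2 + ε ^ 2) (2 * t) t := by
      simpa using (hasDerivAt_pow 2 t).add_const (ε ^ 2)
    have h2 := (((h1.sqrt (by positivity)).const_mul 4).inv (by positivity)).const_mul (ε ^ 2)
    refine ((hasDerivAt_rho hε t).sub h2).of_eq (fun s => ?_) ?_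
    · simp [rhoFlux, div_eq_mul_inv]
    · field_simp
      ring
  · have hS := rho_sqrt_pos hε t
    have h1 := rho_mul_sub ε t
    have h2 : t ≤ √(t ^ 2 + ε ^ 2) := (le_abs_self t).trans (abs_le_rho_sqrt ε t)
    set S := √(t ^ 2 + ε ^ 2)
    have h3 : -(-(rho ε t / S) + ε ^ 2 * t / (4 * S ^ 3)) - (rho ε t / S) ^ 2
        = (rho ε t * (S - rho ε t) - ε ^ 2 / 4 * (t / S)) / S ^ 2 := by
      field_simp
      ring
    have h4 : 0 ≤ (rho ε t * (S - rho ε t) - ε ^ 2 / 4 * (t / S)) / S ^ 2 := by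
      rw [h1]
      have : t / S ≤ 1 := (div_le_one hS).2 h2
      have : 0 ≤ ε ^ 2 / 4 * (1 - t / S) := mul_nonneg (by positivity) (by linarith)
      apply div_nonneg _ (by positivity)
      linarith
    linarith

lemma eq_zero_of_notMem_tsupport {f : ℝ → ℝ} {s : Set ℝ} (hs : tsupport f ⊆ s) {r : ℝ}
    (hr : r ∉ s) : f =ᶠ[𝓝 r] 0 :=
  notMem_tsupport_iff_eventuallyEq.1 fun h => hr (hs h)

lemma contDiff_one_mul_of_tsupport {s : Set ℝ} (hs : IsOpen s) {χ f f' : ℝ → ℝ}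
    (hχ : ContDiff ℝ 1 χ) (hsupp : tsupport χ ⊆ s) (hf : ∀ r ∈ s, HasDerivAt f (f' r) r)
    (hf' : ContinuousOn f' s) : ContDiff ℝ 1 (fun r => χ r * f r) := by
  have hfs : ContDiffOn ℝ 1 f s := by
    rw [show (1 : WithTop ℕ∞) = 0 + 1 by simp, contDiffOn_succ_iff_deriv_of_isOpen hs]
    refine ⟨fun r hr => (hf r hr).differentiableAt.differentiableWithinAt, by simp, ?_⟩
    rw [contDiffOn_zero]
    exact hf'.congr fun r hr => (hf r hr).deriv
  rw [contDiff_iff_contDiffAt]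
  intro r
  by_cases hr : r ∈ s
  · exact hχ.contDiffAt.mul ((hfs r hr).contDiffAt (hs.mem_nhds hr))
  · have h0 := eq_zero_of_notMem_tsupport hsupp hr
    refine (contDiffAt_const (c := (0:ℝ))).congr_of_eventuallyEq ?_
    filter_upwards [h0] with t ht
    simp [ht]

lemma integral_deriv_mul_rho_le {R : ℝ≥0∞} {p dp z χ : ℝ → ℝ} {α β ε : ℝ}
    (hp : ∀ r ∈ Iset R, HasDerivAt p (dp r) r) (hdpc : ContinuousOn dp (Iset R))
    (hz : ∀ r ∈ Iset R, HasDerivAt (fun r => r * dp r) (r * z r) r)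
    (hzc : ContinuousOn z (Iset R)) (hε : 0 < ε) (hα : 0 < α) (hαβ : α < β) (hβ : β ∈ Iset R)
    (hχ : ContDiff ℝ 1 χ) (hχ0 : ∀ r ∉ Ioo α β, χ r = 0) :
    ∫ r in α..β, deriv (fun r => χ r * rho ε (p r)) r ^ 2 * r
      ≤ ∫ r in α..β, (deriv χ r ^ 2 * rho ε (p r) ^ 2
        + χ r ^ 2 * rhoFlux ε (p r) * z r) * r := by
  obtain ⟨φ, hφc, hφ, hφle⟩ := exists_hasDerivAt_rhoFlux hε
  have hI : Icc α β ⊆ Iset R := fun r hr => Iset_of_le hβ (hα.trans_le hr.1) hr.2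
  have hu : uIcc α β = Icc α β := uIcc_of_le hαβ.le
  have hpc : ContinuousOn p (Icc α β) :=
    fun r hr => (hp r (hI hr)).continuousAt.continuousWithinAt
  have hdpc' := hdpc.mono hI
  have hzc' := hzc.mono hI
  have hχc := hχ.continuous
  have hχ'c : Continuous (deriv χ) := hχ.continuous_deriv_one
  have hρc : ContinuousOn (fun r => rho ε (p r)) (Icc α β) :=
    (continuous_rho ε).comp_continuousOn hpc
  have hfc : ContinuousOn (fun r => rhoFlux ε (p r)) (Icc α β) :=
    (continuous_rhoFlux hε).comp_continuousOn hpc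
  have hφpc : ContinuousOn (fun r => φ (p r)) (Icc α β) := hφc.comp_continuousOn hpc
  have hSc : ContinuousOn (fun r => √(p r ^ 2 + ε ^ 2)) (Icc α β) := by fun_prop
  have hχd : ∀ r, HasDerivAt χ (deriv χ r) r := fun r =>
    (hχ.differentiable one_ne_zero r).hasDerivAt
  set G' : ℝ → ℝ := fun r => (2 * χ r * deriv χ r * rhoFlux ε (p r)
    + χ r ^ 2 * (φ (p r) * dp r)) * (r * dp r) + χ r ^ 2 * rhoFlux ε (p r) * (r * z r) with hG'
  have hG'c : ContinuousOn G' (Icc α β) := by fun_prop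
  have hG : ∀ r ∈ uIcc α β,
      HasDerivAt (fun r => χ r ^ 2 * rhoFlux ε (p r) * (r * dp r)) (G' r) r := by
    intro r hr
    rw [hu] at hr
    have h1 : HasDerivAt (fun r => rhoFlux ε (p r)) (φ (p r) * dp r) r :=
      (hφ (p r)).comp r (hp r (hI hr))
    have h2 : HasDerivAt (fun r => χ r ^ 2) (2 * χ r * deriv χ r) r := by
      refine ((hχd r).pow 2).of_eq (fun s => rfl) ?_
      simp
    exact ((h2.mul h1).mul (hz r (hI hr)))
  have hder : ∀ r ∈ Icc α β, deriv (fun r => χ r * rho ε (p r)) r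
      = deriv χ r * rho ε (p r) - χ r * (rho ε (p r) / √(p r ^ 2 + ε ^ 2) * dp r) := by
    intro r hr
    have h1 : HasDerivAt (fun r => rho ε (p r)) _ r :=
      (hasDerivAt_rho hε (p r)).comp r (hp r (hI hr))
    rw [((hχd r).fun_mul h1).deriv]
    ring
  have hint : ∫ r in α..β, G' r = 0 := by
    rw [intervalIntegral.integral_eq_sub_of_hasDerivAt hG (by
      rw [← hu] at hG'c; exact hG'c.intervalIntegrable)]
    simp [hχ0 α (by simp), hχ0 β (by simp)]
  have hS : ∀ r, √(p r ^ 2 + ε ^ 2) ≠ 0 := fun r => (rho_sqrt_pos hε _).ne'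
  have hLc : ContinuousOn (fun r => deriv (fun r => χ r * rho ε (p r)) r ^ 2 * r) (Icc α β) := by
    have : ContinuousOn (fun r => (deriv χ r * rho ε (p r)
        - χ r * (rho ε (p r) / √(p r ^ 2 + ε ^ 2) * dp r)) ^ 2 * r) (Icc α β) := by
      have hq : ContinuousOn (fun r => rho ε (p r) / √(p r ^ 2 + ε ^ 2)) (Icc α β) :=
        hρc.div hSc fun r _ => hS r
      fun_prop
    exact this.congr fun r hr => by simp only [hder r hr]
  have hRc : ContinuousOn (fun r => (deriv χ r ^ 2 * rho ε (p r) ^ 2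
        + χ r ^ 2 * rhoFlux ε (p r) * z r) * r) (Icc α β) := by fun_prop
  have hmono : ∫ r in α..β, deriv (fun r => χ r * rho ε (p r)) r ^ 2 * r
      ≤ ∫ r in α..β, ((deriv χ r ^ 2 * rho ε (p r) ^ 2
        + χ r ^ 2 * rhoFlux ε (p r) * z r) * r - G' r) := by
    refine intervalIntegral.integral_mono_on hαβ.le
      (by rw [← hu] at hLc; exact hLc.intervalIntegrable)
      (by have := hRc.sub hG'c; rw [← hu] at this; exact this.intervalIntegrable) fun r hr => ?_
    rw [hder r hr]
    have hr0 : 0 < r := hα.trans_le hr.1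
    have h1 := hφle (p r)
    have h2 : rhoFlux ε (p r) = rho ε (p r) * (rho ε (p r) / √(p r ^ 2 + ε ^ 2)) := by
      rw [rhoFlux_eq hε]
      ring
    have h3 : 0 ≤ (-φ (p r) - (rho ε (p r) / √(p r ^ 2 + ε ^ 2)) ^ 2)
        * (χ r ^ 2 * dp r ^ 2 * r) := mul_nonneg (by linarith) (by positivity)
    simp only [hG', h2]
    nlinarith
  rw [intervalIntegral.integral_sub (by rw [← hu] at hRc; exact hRc.intervalIntegrable)
    (by rw [← hu] at hG'c; exact hG'c.intervalIntegrable), hint, sub_zero] at hmono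
  exact hmono

lemma le_of_forall_pos_quadratic {A B C D : ℝ} (h : ∀ ε > 0, A ≤ B + ε * C + ε ^ 2 * D) :
    A ≤ B := by
  have h1 : Tendsto (fun ε : ℝ => B + ε * C + ε ^ 2 * D) (𝓝[>] 0) (𝓝 (B + 0 * C + 0 ^ 2 * D)) :=
    (Continuous.tendsto (by fun_prop) _).mono_left nhdsWithin_le_nhds
  have := ge_of_tendsto h1 (eventually_nhdsWithin_of_forall h)
  simpa using this

lemma rhoFlux_mul_le {ε : ℝ} (hε : 0 < ε) (t A : ℝ) :
    rhoFlux ε t * (A * t) ≤ -A * rho ε t ^ 2 + |A| * ε ^ 2 := by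
  have hS := rho_sqrt_pos hε t
  have h1 := rho_mul_sub ε t
  have h2 := rho_le_sqrt ε t
  have h3 := rho_nonneg ε t
  have h4 : rhoFlux ε t * t + rho ε t ^ 2 = ε ^ 2 / 2 * (rho ε t / √(t ^ 2 + ε ^ 2)) := by
    have ht : t + √(t ^ 2 + ε ^ 2) = 2 * (√(t ^ 2 + ε ^ 2) - rho ε t) := by unfold rho; ring
    rw [rhoFlux_eq hε]
    calc rho ε t ^ 2 / √(t ^ 2 + ε ^ 2) * t + rho ε t ^ 2
        = rho ε t ^ 2 * (t + √(t ^ 2 + ε ^ 2)) / √(t ^ 2 + ε ^ 2) := by field_simp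
      _ = 2 * rho ε t * (rho ε t * (√(t ^ 2 + ε ^ 2) - rho ε t)) / √(t ^ 2 + ε ^ 2) := by
        rw [ht]; ring
      _ = _ := by rw [h1]; ring
  have h5 : rho ε t / √(t ^ 2 + ε ^ 2) ≤ 1 := (div_le_one hS).2 h2
  have h6 : 0 ≤ rho ε t / √(t ^ 2 + ε ^ 2) := by positivity
  have h7 : A * (ε ^ 2 / 2 * (rho ε t / √(t ^ 2 + ε ^ 2))) ≤ |A| * (ε ^ 2 / 2 * 1) := by
    refine (mul_le_mul_of_nonneg_right (le_abs_self A) (by positivity)).trans ?_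
    gcongr
  have h8 : 0 ≤ |A| * ε ^ 2 := by positivity
  have h9 : rhoFlux ε t * (A * t) = A * (rhoFlux ε t * t + rho ε t ^ 2) - A * rho ε t ^ 2 := by ring
  rw [h9, h4]
  linarith

lemma rho_coupling_nonneg {ε : ℝ} (hε : 0 < ε) (s t : ℝ) :
    0 ≤ 2 * rho ε s * rho ε t + rhoFlux ε s * t + rhoFlux ε t * s := by
  have f1 := neg_rho_le ε s
  have f2 := neg_rho_le ε t
  have g1 : 0 ≤ rhoFlux ε s * (t + rho ε t) :=
    mul_nonneg (rhoFlux_nonneg hε s) (by linarith)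
  have g2 : 0 ≤ rhoFlux ε t * (s + rho ε s) :=
    mul_nonneg (rhoFlux_nonneg hε t) (by linarith)
  have g3 : 0 ≤ (rho ε s - rhoFlux ε s) * rho ε t :=
    mul_nonneg (by linarith [rhoFlux_le hε s]) (rho_nonneg ε t)
  have g4 : 0 ≤ (rho ε t - rhoFlux ε t) * rho ε s :=
    mul_nonneg (by linarith [rhoFlux_le hε t]) (rho_nonneg ε s)
  linarith

set_option maxHeartbeats 1000000 in
lemma cutoff_inequality {R : ℝ≥0∞} (hR : 0 < R) {A₁ A₂ w s p q dp dq : ℝ → ℝ}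
    (hA₁ : ContinuousOn A₁ (Iset R)) (hA₂ : ContinuousOn A₂ (Iset R))
    (hwc : ContinuousOn w (Iset R)) (hsc : ContinuousOn s (Iset R))
    (hw : ∀ r ∈ Iset R, 0 ≤ w r) (hs : ∀ r ∈ Iset R, 0 ≤ s r)
    (hp : ∀ r ∈ Iset R, HasDerivAt p (dp r) r) (hq : ∀ r ∈ Iset R, HasDerivAt q (dq r) r)
    (hdpc : ContinuousOn dp (Iset R)) (hdqc : ContinuousOn dq (Iset R))
    (hdp : ∀ r ∈ Iset R, HasDerivAt (fun r => r * dp r)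
      (r * ((2 / r ^ 2 + A₁ r) * p r - s r - w r * q r)) r)
    (hdq : ∀ r ∈ Iset R, HasDerivAt (fun r => r * dq r)
      (r * ((1 / r ^ 2 + A₂ r) * q r - w r * p r)) r)
    (hstab : ∀ ξ η : ℝ → ℝ, ContDiff ℝ 1 ξ → ContDiff ℝ 1 η →
      HasCompactSupport ξ → HasCompactSupport η → tsupport ξ ⊆ Iset R → tsupport η ⊆ Iset R →
      0 ≤ ∫ r in Iset R, (deriv ξ r ^ 2 + 1 / r ^ 2 * ξ r ^ 2 + deriv η r ^ 2
        + A₁ r * ξ r ^ 2 + A₂ r * η r ^ 2 - 2 * w r * ξ r * η r) * r)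
    {χ : ℝ → ℝ} (hχ : ContDiff ℝ 1 χ) (hχc : HasCompactSupport χ) (hχs : tsupport χ ⊆ Iset R) :
    ∫ r in Iset R, χ r ^ 2 * ((min (p r) 0 ^ 2 + min (q r) 0 ^ 2) / r)
      ≤ ∫ r in Iset R, deriv χ r ^ 2 * (min (p r) 0 ^ 2 + min (q r) 0 ^ 2) * r := by
  obtain ⟨α, β, hα, hαβ, hβ, hχ0⟩ := exists_Icc_of_tsupport hR hχc hχs
  have hχ'0 := deriv_eq_zero_of_notMem_Ioo hχ hχ0
  have hI : Icc α β ⊆ Iset R := fun r hr => Iset_of_le hβ (hα.trans_le hr.1) hr.2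
  have hu : uIcc α β = Icc α β := uIcc_of_le hαβ.le
  have hII : ∀ {f : ℝ → ℝ}, ContinuousOn f (Icc α β) → IntervalIntegrable f volume α β :=
    fun {f} hf => by rw [← hu] at hf; exact hf.intervalIntegrable
  rw [setIntegral_Iset_eq hα hαβ hβ (F := fun r => χ r ^ 2 *
      ((min (p r) 0 ^ 2 + min (q r) 0 ^ 2) / r)) fun r hr => by simp [hχ0 r hr],
    setIntegral_Iset_eq hα hαβ hβ (F := fun r => deriv χ r ^ 2 *
      (min (p r) 0 ^ 2 + min (q r) 0 ^ 2) * r) fun r hr => by simp [hχ'0 r hr]]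
  have hr0 : ∀ r ∈ Icc α β, r ≠ 0 := fun r hr => (hα.trans_le hr.1).ne'
  have hpc' : ContinuousOn p (Iset R) := fun r hr => (hp r hr).continuousAt.continuousWithinAt
  have hqc' : ContinuousOn q (Iset R) := fun r hr => (hq r hr).continuousAt.continuousWithinAt
  have hpc := hpc'.mono hI
  have hqc := hqc'.mono hI
  have hA₁' := hA₁.mono hI
  have hA₂' := hA₂.mono hI
  have hwc' := hwc.mono hI
  have hsc' := hsc.mono hI
  have hχcont := hχ.continuous
  have hχ'c : Continuous (deriv χ) := hχ.continuous_deriv_one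
  have hinv : ContinuousOn (fun r : ℝ => 1 / r ^ 2) (Iset R) :=
    continuousOn_const.div (by fun_prop) fun r hr => (pow_pos hr.1 2).ne'
  have hinv2 : ContinuousOn (fun r : ℝ => 2 / r ^ 2) (Iset R) :=
    continuousOn_const.div (by fun_prop) fun r hr => (pow_pos hr.1 2).ne'
  have hinvI := hinv.mono hI
  have hinvI2 := hinv2.mono hI
  refine le_of_forall_pos_quadratic
    (C := ∫ r in α..β, deriv χ r ^ 2 * (|p r| + |q r|) * r)
    (D := ∫ r in α..β, (2 * deriv χ r ^ 2 + χ r ^ 2 *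
      (|2 / r ^ 2 + A₁ r| + |1 / r ^ 2 + A₂ r|)) * r) fun ε hε => ?_
  have hP := integral_deriv_mul_rho_le hp hdpc hdp (by fun_prop) hε hα hαβ hβ hχ hχ0
  have hQ := integral_deriv_mul_rho_le hq hdqc hdq (by fun_prop) hε hα hαβ hβ hχ hχ0
  have hρp : ContinuousOn (fun r => rho ε (p r)) (Icc α β) :=
    (continuous_rho ε).comp_continuousOn hpc
  have hρq : ContinuousOn (fun r => rho ε (q r)) (Icc α β) :=
    (continuous_rho ε).comp_continuousOn hqc
  have hfp : ContinuousOn (fun r => rhoFlux ε (p r)) (Icc α β) :=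
    (continuous_rhoFlux hε).comp_continuousOn hpc
  have hfq : ContinuousOn (fun r => rhoFlux ε (q r)) (Icc α β) :=
    (continuous_rhoFlux hε).comp_continuousOn hqc
  have hrho' : ∀ {f df : ℝ → ℝ}, (∀ r ∈ Iset R, HasDerivAt f (df r) r) →
      ContinuousOn df (Iset R) → ContDiff ℝ 1 (fun r => χ r * rho ε (f r)) := by
    intro f df hf hdf
    refine contDiff_one_mul_of_tsupport (isOpen_Iset R) hχ hχs
      (fun r hr => (hasDerivAt_rho hε (f r)).comp r (hf r hr)) ?_
    have hfc : ContinuousOn f (Iset R) := fun r hr => (hf r hr).continuousAt.continuousWithinAt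
    have h1 : ContinuousOn (fun r => rho ε (f r)) (Iset R) :=
      (continuous_rho ε).comp_continuousOn hfc
    exact ((h1.div (by fun_prop) fun r _ => (rho_sqrt_pos hε _).ne').neg).mul hdf
  have hξ := hrho' hp hdpc
  have hη := hrho' hq hdqc
  have hst := hstab _ _ hξ hη hχc.mul_right hχc.mul_right
    ((tsupport_mul_subset_left).trans hχs) ((tsupport_mul_subset_left).trans hχs)
  have hξ0 : ∀ r ∉ Ioo α β, χ r * rho ε (p r) = 0 := fun r hr => by simp [hχ0 r hr]
  have hη0 : ∀ r ∉ Ioo α β, χ r * rho ε (q r) = 0 := fun r hr => by simp [hχ0 r hr]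
  rw [setIntegral_Iset_eq hα hαβ hβ fun r hr => by
    simp only [deriv_eq_zero_of_notMem_Ioo hξ hξ0 r hr, deriv_eq_zero_of_notMem_Ioo hη hη0 r hr,
      hξ0 r hr, hη0 r hr]
    simp] at hst
  set ξ' := deriv (fun r => χ r * rho ε (p r)) with hξ'
  set η' := deriv (fun r => χ r * rho ε (q r)) with hη'
  have hξ'c : Continuous ξ' := hξ.continuous_deriv_one
  have hη'c : Continuous η' := hη.continuous_deriv_one
  set T : ℝ → ℝ := fun r => (1 / r ^ 2 * (χ r * rho ε (p r)) ^ 2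
    + A₁ r * (χ r * rho ε (p r)) ^ 2 + A₂ r * (χ r * rho ε (q r)) ^ 2
    - 2 * w r * (χ r * rho ε (p r)) * (χ r * rho ε (q r))) * r with hT
  have hTc : ContinuousOn T (Icc α β) := by fun_prop
  have hst' : ∫ r in α..β, (ξ' r ^ 2 + 1 / r ^ 2 * (χ r * rho ε (p r)) ^ 2 + η' r ^ 2
      + A₁ r * (χ r * rho ε (p r)) ^ 2 + A₂ r * (χ r * rho ε (q r)) ^ 2
      - 2 * w r * (χ r * rho ε (p r)) * (χ r * rho ε (q r))) * r
      = (∫ r in α..β, ξ' r ^ 2 * r) + (∫ r in α..β, η' r ^ 2 * r) + ∫ r in α..β, T r := by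
    rw [← intervalIntegral.integral_add, ← intervalIntegral.integral_add]
    · congr 1
      ext r
      simp only [hT]
      ring
    · exact (Continuous.intervalIntegrable (by fun_prop) _ _)
    · exact hII hTc
    · exact (Continuous.intervalIntegrable (by fun_prop) _ _)
    · exact (Continuous.intervalIntegrable (by fun_prop) _ _)
  rw [hst'] at hst
  set X : ℝ → ℝ := fun r => (deriv χ r ^ 2 * rho ε (p r) ^ 2 + χ r ^ 2 * rhoFlux ε (p r) *
    ((2 / r ^ 2 + A₁ r) * p r - s r - w r * q r)) * r with hX
  set Y : ℝ → ℝ := fun r => (deriv χ r ^ 2 * rho ε (q r) ^ 2 + χ r ^ 2 * rhoFlux ε (q r) *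
    ((1 / r ^ 2 + A₂ r) * q r - w r * p r)) * r with hY
  have hXc : ContinuousOn X (Icc α β) := by fun_prop
  have hYc : ContinuousOn Y (Icc α β) := by fun_prop
  set L : ℝ → ℝ := fun r => χ r ^ 2 * ((min (p r) 0 ^ 2 + min (q r) 0 ^ 2) / r) with hL
  set B : ℝ → ℝ := fun r => deriv χ r ^ 2 * (min (p r) 0 ^ 2 + min (q r) 0 ^ 2) * r with hB
  set C : ℝ → ℝ := fun r => deriv χ r ^ 2 * (|p r| + |q r|) * r with hC
  set D : ℝ → ℝ := fun r => (2 * deriv χ r ^ 2 + χ r ^ 2 *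
      (|2 / r ^ 2 + A₁ r| + |1 / r ^ 2 + A₂ r|)) * r with hD
  have hmp : ContinuousOn (fun r => min (p r) 0) (Icc α β) := hpc.inf continuousOn_const
  have hmq : ContinuousOn (fun r => min (q r) 0) (Icc α β) := hqc.inf continuousOn_const
  have hLc : ContinuousOn L (Icc α β) := by
    have := (((hmp.pow 2).add (hmq.pow 2)).div continuousOn_id hr0)
    exact (hχcont.pow 2).continuousOn.mul this
  have hBc : ContinuousOn B (Icc α β) := by fun_prop
  have hap : ContinuousOn (fun r => |p r|) (Icc α β) := hpc.abs
  have haq : ContinuousOn (fun r => |q r|) (Icc α β) := hqc.abs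
  have hCc : ContinuousOn C (Icc α β) := by fun_prop
  have ha1 : ContinuousOn (fun r => |2 / r ^ 2 + A₁ r|) (Icc α β) := (hinvI2.add hA₁').abs
  have ha2 : ContinuousOn (fun r => |1 / r ^ 2 + A₂ r|) (Icc α β) := (hinvI.add hA₂').abs
  have hDc : ContinuousOn D (Icc α β) := by fun_prop
  have hkey : (∫ r in α..β, (X r + Y r + T r))
      ≤ ∫ r in α..β, (B r + ε * C r + ε ^ 2 * D r - L r) := by
    refine intervalIntegral.integral_mono_on hαβ.le (hII (by fun_prop)) (hII (by fun_prop))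
      fun r hr => ?_
    have hr1 : 0 < r := hα.trans_le hr.1
    have e2 := rhoFlux_mul_le hε (p r) (2 / r ^ 2 + A₁ r)
    have e3 := rhoFlux_mul_le hε (q r) (1 / r ^ 2 + A₂ r)
    have e4 : 0 ≤ rhoFlux ε (p r) * s r := mul_nonneg (rhoFlux_nonneg hε _) (hs r (hI hr))
    have e5 : 0 ≤ w r * (2 * rho ε (p r) * rho ε (q r) + rhoFlux ε (p r) * q r
        + rhoFlux ε (q r) * p r) := mul_nonneg (hw r (hI hr)) (rho_coupling_nonneg hε _ _)
    have e6 := sq_min_le_rho_sq ε (p r)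
    have e7 := sq_min_le_rho_sq ε (q r)
    have e8 := rho_sq_le hε (p r)
    have e9 := rho_sq_le hε (q r)
    have hdχ : 0 ≤ deriv χ r ^ 2 * r := by positivity
    have hχ2 : 0 ≤ χ r ^ 2 * r := by positivity
    have hχ3 : 0 ≤ χ r ^ 2 / r := by positivity
    have k1 : deriv χ r ^ 2 * r * (rho ε (p r) ^ 2 + rho ε (q r) ^ 2)
        ≤ B r + ε * C r + ε ^ 2 * (2 * deriv χ r ^ 2 * r) := by
      have := mul_le_mul_of_nonneg_left (add_le_add e8 e9) hdχ
      simp only [hB, hC]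
      linarith
    have k2 : L r ≤ χ r ^ 2 / r * (rho ε (p r) ^ 2 + rho ε (q r) ^ 2) := by
      have := mul_le_mul_of_nonneg_left (add_le_add e6 e7) hχ3
      refine le_trans (le_of_eq ?_) this
      simp only [hL]
      ring
    have k3 : χ r ^ 2 * r * (rhoFlux ε (p r) * ((2 / r ^ 2 + A₁ r) * p r - s r - w r * q r)
        + rhoFlux ε (q r) * ((1 / r ^ 2 + A₂ r) * q r - w r * p r)
        - 2 * w r * rho ε (p r) * rho ε (q r))
        ≤ χ r ^ 2 * r * (-(2 / r ^ 2 + A₁ r) * rho ε (p r) ^ 2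
          - (1 / r ^ 2 + A₂ r) * rho ε (q r) ^ 2
          + (|2 / r ^ 2 + A₁ r| + |1 / r ^ 2 + A₂ r|) * ε ^ 2) := by
      refine mul_le_mul_of_nonneg_left ?_ hχ2
      linarith
    have k4 : X r + Y r + T r = deriv χ r ^ 2 * r * (rho ε (p r) ^ 2 + rho ε (q r) ^ 2)
        + χ r ^ 2 * r * (rhoFlux ε (p r) * ((2 / r ^ 2 + A₁ r) * p r - s r - w r * q r)
        + rhoFlux ε (q r) * ((1 / r ^ 2 + A₂ r) * q r - w r * p r)
        - 2 * w r * rho ε (p r) * rho ε (q r))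
        + χ r ^ 2 * r * ((1 / r ^ 2 + A₁ r) * rho ε (p r) ^ 2 + A₂ r * rho ε (q r) ^ 2) := by
      simp only [hX, hY, hT]
      ring
    have k5 : χ r ^ 2 * r * ((1 / r ^ 2 + A₁ r) * rho ε (p r) ^ 2 + A₂ r * rho ε (q r) ^ 2)
        + χ r ^ 2 * r * (-(2 / r ^ 2 + A₁ r) * rho ε (p r) ^ 2
          - (1 / r ^ 2 + A₂ r) * rho ε (q r) ^ 2
          + (|2 / r ^ 2 + A₁ r| + |1 / r ^ 2 + A₂ r|) * ε ^ 2)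
        = -(χ r ^ 2 / r * (rho ε (p r) ^ 2 + rho ε (q r) ^ 2))
          + ε ^ 2 * (χ r ^ 2 * (|2 / r ^ 2 + A₁ r| + |1 / r ^ 2 + A₂ r|) * r) := by
      field_simp
      ring
    have k6 : ε ^ 2 * D r = ε ^ 2 * (2 * deriv χ r ^ 2 * r)
        + ε ^ 2 * (χ r ^ 2 * (|2 / r ^ 2 + A₁ r| + |1 / r ^ 2 + A₂ r|) * r) := by
      simp only [hD]
      ring
    rw [k4, k6]
    linarith
  rw [intervalIntegral.integral_add (f := fun r => X r + Y r) (hII (hXc.add hYc)) (hII hTc),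
    intervalIntegral.integral_add (hII hXc) (hII hYc),
    intervalIntegral.integral_sub (hII (by fun_prop)) (hII hLc),
    intervalIntegral.integral_add (hII (by fun_prop)) (hII (by fun_prop)),
    intervalIntegral.integral_add (hII hBc) (hII (by fun_prop)),
    intervalIntegral.integral_const_mul, intervalIntegral.integral_const_mul] at hkey
  linarith

/-- Nonnegativity of the second variation of the profile energy, in normalized constants. -/
def RadiallyStable (a b c : ℝ) (R : ℝ≥0∞) (u v : ℝ → ℝ) : Prop :=
  ∀ ξ η : ℝ → ℝ, ContDiff ℝ 1 ξ → ContDiff ℝ 1 η →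
    HasCompactSupport ξ → HasCompactSupport η → tsupport ξ ⊆ Iset R → tsupport η ⊆ Iset R →
    0 ≤ ∫ r in Iset R, (deriv ξ r ^ 2 + 1 / r ^ 2 * ξ r ^ 2 + deriv η r ^ 2
      + (-a + 2 * b * v r + c * (3 * u r ^ 2 + v r ^ 2)) * ξ r ^ 2
      + (-a - 2 * b * v r + c * (u r ^ 2 + 3 * v r ^ 2)) * η r ^ 2
      + 4 * u r * ξ r * η r * (b + c * v r)) * r

namespace Profile

variable {a b c y : ℝ} {R : ℝ≥0∞} {u v du dv : ℝ → ℝ}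

lemma continuousOn_u (H : Profile a b c y R u v du dv) : ContinuousOn u (Iset R) :=
  fun r hr => (H.deriv_u r hr).continuousAt.continuousWithinAt

lemma continuousOn_v (H : Profile a b c y R u v du dv) : ContinuousOn v (Iset R) :=
  fun r hr => (H.deriv_v r hr).continuousAt.continuousWithinAt

lemma continuousOn_du (H : Profile a b c y R u v du dv) : ContinuousOn du (Iset R) :=
  fun r hr => (H.deriv_du r hr).continuousAt.continuousWithinAt

lemma continuousOn_dv (H : Profile a b c y R u v du dv) : ContinuousOn dv (Iset R) :=
  fun r hr => (H.deriv_dv r hr).continuousAt.continuousWithinAt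

lemma deriv_mul_ddu (H : Profile a b c y R u v du dv) {r : ℝ} (hr : r ∈ Iset R) :
    HasDerivAt (fun r => r * (u r * (-a + 2 * b * v r + c * (u r ^ 2 + v r ^ 2))
        + u r / r ^ 2 - du r / r))
      (r * ((2 / r ^ 2 + (-a + 2 * b * v r + c * (3 * u r ^ 2 + v r ^ 2))) * du r
        - 2 * u r / r ^ 3 + 2 * u r * (b + c * v r) * dv r)) r := by
  have h0 : r ≠ 0 := hr.1.ne'
  have hu := H.deriv_u r hr
  have hv := H.deriv_v r hr
  have h1 := (hu.fun_mul ((((hv.const_mul (2 * b)).const_add (-a)).fun_add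
    (((hu.fun_pow 2).fun_add (hv.fun_pow 2)).const_mul c))))
  have h2 := hu.fun_div ((hasDerivAt_id' r).fun_pow 2) (pow_ne_zero 2 h0)
  have h3 := (H.deriv_du r hr).fun_div (hasDerivAt_id' r) h0
  refine ((hasDerivAt_id' r).fun_mul ((h1.fun_add h2).fun_sub h3)).of_eq (fun s => rfl) ?_
  field_simp
  ring

lemma deriv_mul_ddv (H : Profile a b c y R u v du dv) {r : ℝ} (hr : r ∈ Iset R) :
    HasDerivAt (fun r => r * (v r * (-a - b * v r + c * (u r ^ 2 + v r ^ 2))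
        + b * u r ^ 2 - dv r / r))
      (r * ((1 / r ^ 2 + (-a - 2 * b * v r + c * (u r ^ 2 + 3 * v r ^ 2))) * dv r
        + 2 * u r * (b + c * v r) * du r)) r := by
  have h0 : r ≠ 0 := hr.1.ne'
  have hu := H.deriv_u r hr
  have hv := H.deriv_v r hr
  have h1 := (hv.fun_mul ((((hv.const_mul b).const_sub (-a)).fun_add
    (((hu.fun_pow 2).fun_add (hv.fun_pow 2)).const_mul c))))
  have h2 := (hu.fun_pow 2).const_mul b
  have h3 := (H.deriv_dv r hr).fun_div (hasDerivAt_id' r) h0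
  refine ((hasDerivAt_id' r).fun_mul ((h1.fun_add h2).fun_sub h3)).of_eq (fun s => rfl) ?_
  field_simp
  ring

lemma abs_u_le (H : Profile a b c y R u v du dv) (hR : 0 < R) {r : ℝ} (hr : r ∈ Iset R) :
    |u r| ≤ 2 * y :=
  abs_le_of_sq_le_sq (by nlinarith [H.norm_sq_le hR r hr, sq_nonneg (v r)])
    (by linarith [H.y_pos])

lemma abs_v_le (H : Profile a b c y R u v du dv) (hR : 0 < R) {r : ℝ} (hr : r ∈ Iset R) :
    |v r| ≤ 2 * y :=
  abs_le_of_sq_le_sq (by nlinarith [H.norm_sq_le hR r hr, sq_nonneg (u r)])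
    (by linarith [H.y_pos])

lemma abs_source_u_le (H : Profile a b c y R u v du dv) (hR : 0 < R) {r r₀ : ℝ} (hr₀ : 0 < r₀)
    (hr : r ∈ Iset R) (hle : r₀ ≤ r) :
    |u r * (-a + 2 * b * v r + c * (u r ^ 2 + v r ^ 2)) + u r / r ^ 2|
      ≤ 2 * y * (a + 2 * b * (2 * y) + c * (4 * y ^ 2)) + 2 * y / r₀ ^ 2 := by
  have hu := H.abs_u_le hR hr
  have hv := H.abs_v_le hR hr
  have hn := H.norm_sq_le hR r hr
  have ha := H.a_nonneg
  have hb := H.b_pos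
  have hc := H.c_pos
  have hy := H.y_pos
  refine (abs_add_le _ _).trans (add_le_add ?_ ?_)
  · rw [abs_mul]
    refine mul_le_mul hu ?_ (abs_nonneg _) (by positivity)
    refine (abs_add_le _ _).trans (add_le_add ((abs_add_le _ _).trans (add_le_add ?_ ?_)) ?_)
    · rw [abs_neg, abs_of_nonneg ha]
    · rw [abs_mul, abs_of_pos (by positivity : 0 < 2 * b)]
      gcongr
    · rw [abs_mul, abs_of_pos hc, abs_of_nonneg (by positivity)]
      gcongr
  · rw [abs_div, abs_of_nonneg (sq_nonneg r)]
    gcongr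

lemma abs_source_v_le (H : Profile a b c y R u v du dv) (hR : 0 < R) {r : ℝ}
    (hr : r ∈ Iset R) :
    |v r * (-a - b * v r + c * (u r ^ 2 + v r ^ 2)) + b * u r ^ 2|
      ≤ 2 * y * (a + b * (2 * y) + c * (4 * y ^ 2)) + b * (4 * y ^ 2) := by
  have hu := H.abs_u_le hR hr
  have hv := H.abs_v_le hR hr
  have hn := H.norm_sq_le hR r hr
  have ha := H.a_nonneg
  have hb := H.b_pos
  have hc := H.c_pos
  have hy := H.y_pos
  refine (abs_add_le _ _).trans (add_le_add ?_ ?_)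
  · rw [abs_mul]
    refine mul_le_mul hv ?_ (abs_nonneg _) (by positivity)
    refine (abs_add_le _ _).trans (add_le_add ((abs_sub _ _).trans (add_le_add ?_ ?_)) ?_)
    · rw [abs_neg, abs_of_nonneg ha]
    · rw [abs_mul, abs_of_pos hb]
      gcongr
    · rw [abs_mul, abs_of_pos hc, abs_of_nonneg (by positivity)]
      gcongr
  · rw [abs_mul, abs_of_pos hb, abs_of_nonneg (sq_nonneg _)]
    have : u r ^ 2 ≤ 4 * y ^ 2 := by linarith [sq_nonneg (v r)]
    gcongr

lemma sq_min_le_of_neg_mul_le {p C t : ℝ} (ht : 0 ≤ C * t) (h : -(C * t) ≤ p) :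
    min p 0 ^ 2 ≤ C ^ 2 * t ^ 2 := by
  have h1 : -(C * t) ≤ min p 0 := le_min h (by linarith)
  have h2 : min p 0 ≤ 0 := min_le_right _ _
  nlinarith

lemma sq_min_le_of_abs_le {p C : ℝ} (h : |p| ≤ C) : min p 0 ^ 2 ≤ C ^ 2 := by
  have h1 := (abs_le.1 h).1
  have h3 : 0 ≤ C := (abs_nonneg p).trans h
  have h4 : -C ≤ min p 0 := le_min h1 (by linarith)
  have h2 : min p 0 ≤ 0 := min_le_right _ _
  nlinarith

lemma monotone_of_stable (H : Profile a b c y R u v du dv) (hR : 0 < R)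
    (hstab : RadiallyStable a b c R u v) {σ : ℝ} (hσ : σ ^ 2 = 1)
    (hκ : ∀ r ∈ Iset R, σ * (b + c * v r) ≤ 0) (hvσ : ∀ r ∈ Iset R, σ * v r ≤ σ * -y) :
    ∀ r ∈ Iset R, 0 ≤ du r ∧ 0 ≤ σ * dv r := by
  have hσabs : |σ| = 1 := by rw [← Real.sqrt_sq_eq_abs, hσ, Real.sqrt_one]
  have hy := H.y_pos
  have hcu := H.continuousOn_u
  have hcv := H.continuousOn_v
  have hcdu := H.continuousOn_du
  have hcdv := H.continuousOn_dv
  have hinv : ContinuousOn (fun r : ℝ => 1 / r ^ 2) (Iset R) :=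
    continuousOn_const.div (by fun_prop) fun r hr => (pow_pos hr.1 2).ne'
  have hd1 : ContinuousOn (fun r => u r / r ^ 2) (Iset R) :=
    hcu.div (by fun_prop) fun r hr => (pow_pos hr.1 2).ne'
  have hd2 : ContinuousOn (fun r => 2 * u r / r ^ 3) (Iset R) :=
    (hcu.const_mul 2).div (by fun_prop) fun r hr => (pow_pos hr.1 3).ne'
  have hd3 : ContinuousOn (fun r => du r / r) (Iset R) :=
    hcdu.div (by fun_prop) fun r hr => hr.1.ne'
  have hd4 : ContinuousOn (fun r => dv r / r) (Iset R) :=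
    hcdv.div (by fun_prop) fun r hr => hr.1.ne'
  obtain ⟨C, δ, hC, hδ, hb0⟩ := H.bounded_near_zero hR
  have hcut := fun (χ : ℝ → ℝ) (h1 : ContDiff ℝ 1 χ) h2 h3 => cutoff_inequality hR
    (A₁ := fun r => -a + 2 * b * v r + c * (3 * u r ^ 2 + v r ^ 2))
    (A₂ := fun r => -a - 2 * b * v r + c * (u r ^ 2 + 3 * v r ^ 2))
    (w := fun r => -2 * u r * (σ * (b + c * v r))) (s := fun r => 2 * u r / r ^ 3)
    (p := du) (q := fun r => σ * dv r)
    (dp := fun r => u r * (-a + 2 * b * v r + c * (u r ^ 2 + v r ^ 2)) + u r / r ^ 2 - du r / r)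
    (dq := fun r => σ * (v r * (-a - b * v r + c * (u r ^ 2 + v r ^ 2)) + b * u r ^ 2 - dv r / r))
    (by fun_prop) (by fun_prop) (by fun_prop) hd2
    (fun r hr => by nlinarith [mul_nonneg (H.u_pos r hr).le (neg_nonneg.2 (hκ r hr))])
    (fun r hr => by have := H.u_pos r hr; have := hr.1; positivity)
    (fun r hr => H.deriv_du r hr) (fun r hr => (H.deriv_dv r hr).const_mul σ)
    (by fun_prop) (by fun_prop)
    (fun r hr => (H.deriv_mul_ddu hr).of_eq (fun _ => rfl) (by
      linear_combination (2 * r * u r * (b + c * v r) * dv r) * hσ))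
    (fun r hr => ((H.deriv_mul_ddv hr).const_mul σ).of_eq (fun _ => by ring) (by ring))
    (fun ξ η hξ hη hξc hηc hξs hηs => by
      have h := hstab ξ (fun r => σ * η r) hξ (contDiff_const.mul hη) hξc hηc.mul_left hξs
        ((tsupport_mul_subset_right).trans hηs)
      refine h.trans (le_of_eq (integral_congr_ae (Eventually.of_forall fun r => ?_)))
      have hd : deriv (fun r => σ * η r) r = σ * deriv η r :=
        ((hη.differentiable one_ne_zero r).hasDerivAt.const_mul σ).deriv
      simp only [hd]
      linear_combination (deriv η r ^ 2 + (-a - 2 * b * v r + c * (u r ^ 2 + 3 * v r ^ 2))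
        * η r ^ 2) * r * hσ)
    h1 h2 h3
  have hzero := eq_zero_of_cutoff_inequality
    (m := fun r => min (du r) 0 ^ 2 + min (σ * dv r) 0 ^ 2) (C := C ^ 2 + C ^ 2)
    (fun r _ => by positivity)
    (((hcdu.inf continuousOn_const).pow 2).add
      (((continuousOn_const.mul hcdv).inf continuousOn_const).pow 2)) hδ.1
    (fun r hr => add_le_add (sq_min_le_of_abs_le (hb0 r hr).2.2.1)
      (sq_min_le_of_abs_le (by rw [abs_mul, hσabs, one_mul]; exact (hb0 r hr).2.2.2)))
    (fun hT => by
      subst hT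
      have hI : ∀ r : ℝ, 1 ≤ r → r ∈ Iset ⊤ := fun r hr => mem_Iset_top.2 (by linarith)
      have e1 := abs_deriv_le_of_weighted_deriv (fun r hr => H.deriv_u r (hI r hr))
        (fun r hr => H.deriv_mul_du (hI r hr)) (fun r hr => H.abs_u_le hR (hI r hr))
        (fun r hr => H.abs_source_u_le hR one_pos (hI r hr) hr)
      have e2 := abs_deriv_le_of_weighted_deriv (fun r hr => H.deriv_v r (hI r hr))
        (fun r hr => H.deriv_mul_dv (hI r hr)) (fun r hr => H.abs_v_le hR (hI r hr))
        (fun r hr => H.abs_source_v_le hR (hI r hr))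
      exact ⟨_, 1, fun r hr => add_le_add (sq_min_le_of_abs_le (e1 r hr))
        (sq_min_le_of_abs_le (by rw [abs_mul, hσabs, one_mul]; exact e2 r hr))⟩)
    (fun hT => by
      have e1 := neg_mul_sub_le_deriv_of_le_limit hT hδ H.deriv_u
        (fun r hr => H.deriv_mul_du hr) (H.u_le hR) H.u_end
        (fun r hr h => H.abs_source_u_le hR hδ.1 hr h)
      have e2 := neg_mul_sub_le_deriv_of_le_limit hT hδ (Y := fun r => σ * v r)
        (fun r hr => (H.deriv_v r hr).const_mul σ)
        (fun r hr => ((H.deriv_mul_dv hr).const_mul σ).of_eq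
          (g' := r * (σ * (v r * (-a - b * v r + c * (u r ^ 2 + v r ^ 2)) + b * u r ^ 2)))
          (fun s => by ring) (by ring)) hvσ (H.v_end.const_mul σ)
        (fun r hr h => by
          rw [abs_mul, hσabs, one_mul]; exact H.abs_source_v_le hR hr)
      have hT0 : 0 ≤ R.toReal := ENNReal.toReal_nonneg
      have ha := H.a_nonneg
      have hb := H.b_pos
      have hc := H.c_pos
      have hδ0 := hδ.1
      refine ⟨_, δ, hδ, fun r hr h => (add_le_add
        (sq_min_le_of_neg_mul_le ?_ (e1 r hr h)) (sq_min_le_of_neg_mul_le ?_ (e2 r hr h))).trans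
        (add_mul _ _ _).ge⟩
      · have : 0 ≤ R.toReal - r := by linarith [((mem_Iset_of_ne_top hT).1 hr).2]
        positivity
      · have : 0 ≤ R.toReal - r := by linarith [((mem_Iset_of_ne_top hT).1 hr).2]
        positivity)
    hcut
  intro r hr
  have h := hzero r hr
  have h1 : min (du r) 0 = 0 := by
    have := sq_nonneg (min (du r) 0)
    have := sq_nonneg (min (σ * dv r) 0)
    exact pow_eq_zero_iff (two_ne_zero) |>.1 (by linarith)
  have h2 : min (σ * dv r) 0 = 0 := by
    have := sq_nonneg (min (du r) 0)
    have := sq_nonneg (min (σ * dv r) 0)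
    exact pow_eq_zero_iff (two_ne_zero) |>.1 (by linarith)
  exact ⟨min_eq_right_iff.1 h1, min_eq_right_iff.1 h2⟩

/-- Positive supersolutions of the linearized profile system. -/
lemma exists_weights (H : Profile a b c y R u v du dv) (hR : 0 < R)
    (hstab : RadiallyStable a b c R u v) :
    (∀ r ∈ Iset R, 0 < du r) ∧ ∃ q dq z : ℝ → ℝ, (∀ r ∈ Iset R, 0 < q r) ∧
      (∀ r ∈ Iset R, HasDerivAt q (dq r) r) ∧ ContinuousOn dq (Iset R) ∧
      (∀ r ∈ Iset R, HasDerivAt (fun r => r * dq r) (r * z r) r) ∧ ContinuousOn z (Iset R) ∧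
      (∀ r ∈ Iset R, z r ≤ (1 / r ^ 2 + (-a - 2 * b * v r + c * (u r ^ 2 + 3 * v r ^ 2))) * q r
        - 2 * u r * |b + c * v r| * du r) ∧
      ∀ r ∈ Iset R, 2 * u r * (b + c * v r) * dv r = -(2 * u r * |b + c * v r| * q r) := by
  have hy := H.y_pos
  have hc := H.c_pos
  have hcu := H.continuousOn_u
  have hcv := H.continuousOn_v
  have hcdu := H.continuousOn_du
  have hcdv := H.continuousOn_dv
  have hinv : ContinuousOn (fun r : ℝ => 1 / r ^ 2) (Iset R) :=
    continuousOn_const.div (by fun_prop) fun r hr => (pow_pos hr.1 2).ne'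
  have hd4 : ContinuousOn (fun r => dv r / r) (Iset R) :=
    hcdv.div (by fun_prop) fun r hr => hr.1.ne'
  obtain ⟨σ, hσ, hκ, hvσ⟩ : ∃ σ : ℝ, σ ^ 2 = 1 ∧
      (∀ r ∈ Iset R, σ * (b + c * v r) ≤ -|b - c * y|) ∧
      ∀ r ∈ Iset R, σ * v r ≤ σ * -y := by
    rcases le_total b (c * y) with h | h
    · refine ⟨1, by norm_num, fun r hr => ?_, fun r hr => ?_⟩
      · rw [abs_of_nonpos (by linarith)]
        nlinarith [H.v_le_neg_y hR h r hr]
      · linarith [H.v_le_neg_y hR h r hr]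
    · refine ⟨-1, by norm_num, fun r hr => ?_, fun r hr => ?_⟩
      · rw [abs_of_nonneg (by linarith)]
        nlinarith [H.neg_y_le_v hR h r hr]
      · linarith [H.neg_y_le_v hR h r hr]
  have hκ0 : ∀ r ∈ Iset R, σ * (b + c * v r) ≤ 0 := fun r hr =>
    (hκ r hr).trans (neg_nonpos.2 (abs_nonneg _))
  have hκabs : ∀ r ∈ Iset R, |b + c * v r| = -(σ * (b + c * v r)) := by
    intro r hr
    rw [← abs_of_nonpos (hκ0 r hr), abs_mul]
    have hσabs : |σ| = 1 := by rw [← Real.sqrt_sq_eq_abs, hσ, Real.sqrt_one]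
    rw [hσabs, one_mul]
  have hmono := H.monotone_of_stable hR hstab hσ hκ0 hvσ
  have hpos : ∀ r ∈ Iset R, 0 < du r := by
    intro r hr
    refine lt_of_le_of_ne (hmono r hr).1 fun h0 => ?_
    have hr0 := hr.1
    have hu := H.u_pos r hr
    refine not_isLocalMin_of_weighted_deriv_neg
      (eventually_of_mem (Iset_mem_nhds hr) H.deriv_du)
      (eventually_of_mem (Iset_mem_nhds hr) fun s hs => hs.1) (H.deriv_mul_ddu hr) ?_ ?_
    · rw [← h0]
      have h1 : 0 < 2 * u r / r ^ 3 := by positivity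
      have h2 : 2 * u r * (b + c * v r) * dv r = 2 * u r * ((σ * (b + c * v r)) * (σ * dv r)) := by
        linear_combination (-(2 * u r * (b + c * v r) * dv r)) * hσ
      have h3 := mul_nonneg_of_nonpos_of_nonpos (hκ0 r hr) (neg_nonpos.2 (hmono r hr).2)
      have h4 : 0 ≤ u r * (σ * (b + c * v r) * -(σ * dv r)) := mul_nonneg hu.le h3
      rw [h2]
      refine mul_neg_of_pos_of_neg hr0 ?_
      linarith
    · filter_upwards [Iset_mem_nhds hr] with s hs
      rw [← h0]
      exact (hmono s hs).1
  refine ⟨hpos, ?_⟩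
  by_cases hcy : b = c * y
  · have hv : ∀ r ∈ Iset R, v r = -y := fun r hr =>
      le_antisymm (H.v_le_neg_y hR hcy.le r hr) (H.neg_y_le_v hR hcy.ge r hr)
    refine ⟨fun _ => 1, fun _ => 0, fun _ => 0, fun _ _ => one_pos,
      fun r _ => hasDerivAt_const r 1, continuousOn_const, fun r _ => ?_, continuousOn_const,
      fun r hr => ?_, fun r hr => ?_⟩
    · simpa using hasDerivAt_const r (0:ℝ)
    · have hr0 := hr.1
      have : 0 < 1 / r ^ 2 := by positivity
      rw [hv r hr, H.a_eq, hcy]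
      have h0 : c * y + c * -y = 0 := by ring
      rw [h0, abs_zero]
      have : 0 ≤ c * u r ^ 2 := by positivity
      have : 0 ≤ c * y ^ 2 := by positivity
      nlinarith
    · have h0 : b + c * v r = 0 := by rw [hv r hr, hcy]; ring
      rw [h0]
      simp
  · have hlt : 0 < |b - c * y| := abs_pos.2 (sub_ne_zero.2 hcy)
    refine ⟨fun r => σ * dv r, fun r => σ * (v r * (-a - b * v r + c * (u r ^ 2 + v r ^ 2))
      + b * u r ^ 2 - dv r / r),
      fun r => (1 / r ^ 2 + (-a - 2 * b * v r + c * (u r ^ 2 + 3 * v r ^ 2))) * (σ * dv r)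
        + 2 * u r * (σ * (b + c * v r)) * du r, ?_,
      fun r hr => (H.deriv_dv r hr).const_mul σ, by fun_prop, ?_, by fun_prop, ?_, ?_⟩
    · intro r hr
      refine lt_of_le_of_ne (hmono r hr).2 fun (h0 : 0 = σ * dv r) => ?_
      refine not_isLocalMin_of_weighted_deriv_neg (y := fun r => σ * dv r)
        (eventually_of_mem (Iset_mem_nhds hr) fun s hs => (H.deriv_dv s hs).const_mul σ)
        (eventually_of_mem (Iset_mem_nhds hr) fun s hs => hs.1)
        (((H.deriv_mul_ddv hr).const_mul σ).of_eq (g' := r * (((1 / r ^ 2 +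
          (-a - 2 * b * v r + c * (u r ^ 2 + 3 * v r ^ 2))) * (σ * dv r)
          + 2 * u r * (σ * (b + c * v r)) * du r))) (fun s => by ring) (by ring)) ?_ ?_
      · rw [← h0, mul_zero, zero_add]
        have h1 : 0 < u r * du r := mul_pos (H.u_pos r hr) (hpos r hr)
        have h2 : σ * (b + c * v r) < 0 := (hκ r hr).trans_lt (by linarith)
        have h3 := mul_neg_of_pos_of_neg h1 h2
        refine mul_neg_of_pos_of_neg hr.1 ?_
        linarith
      · filter_upwards [Iset_mem_nhds hr] with s hs
        rw [← h0]
        exact (hmono s hs).2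
    · intro r hr
      exact ((H.deriv_mul_ddv hr).const_mul σ).of_eq (fun s => by ring) (by ring)
    · intro r hr
      rw [hκabs r hr]
      linarith
    · intro r hr
      rw [hκabs r hr]
      linear_combination (-(2 * u r * (b + c * v r) * dv r)) * hσ

end Profile

lemma dirichlet_wirtinger_aux {f f' : ℝ → ℝ} (hf : ∀ x, HasDerivAt f (f' x) x)
    (hf' : Continuous f') {a L μ : ℝ} (hL : 0 < L) (hμ : 0 ≤ μ) (hμL : μ * L < π)
    (h0 : f a = 0) (h1 : f (a + L) = 0) :
    μ ^ 2 * ∫ x in a..a + L, f x ^ 2 ≤ ∫ x in a..a + L, f' x ^ 2 := by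
  have hfc : Continuous f := continuous_iff_continuousAt.2 fun x => (hf x).continuousAt
  set θ : ℝ → ℝ := fun x => μ * (x - (a + L / 2)) with hθ
  have hu : uIcc a (a + L) = Icc a (a + L) := uIcc_of_le (by linarith)
  have hcos : ∀ x ∈ Icc a (a + L), 0 < cos (θ x) := by
    intro x hx
    apply cos_pos_of_mem_Ioo
    constructor <;> simp only [hθ] <;> nlinarith [hx.1, hx.2]
  have htan : ContinuousOn (fun x => tan (θ x)) (Icc a (a + L)) :=
    continuousOn_tan.comp (by simp only [hθ]; fun_prop) fun x hx => (hcos x hx).ne'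
  set g' : ℝ → ℝ := fun x => 2 * f x * f' x * (μ * tan (θ x))
    + f x ^ 2 * (μ ^ 2 * (1 + tan (θ x) ^ 2)) with hg'
  have hg'c : ContinuousOn g' (Icc a (a + L)) := by fun_prop
  have hg : ∀ x ∈ uIcc a (a + L), HasDerivAt (fun x => f x ^ 2 * (μ * tan (θ x))) (g' x) x := by
    intro x hx
    rw [hu] at hx
    have hc := (hcos x hx).ne'
    have e1 : HasDerivAt θ μ x := by
      simpa using ((hasDerivAt_id' x).sub_const (a + L / 2)).const_mul μ
    have e2 := ((hasDerivAt_tan hc).comp x e1).const_mul μ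
    refine (((hf x).fun_pow 2).fun_mul e2).of_eq (fun s => rfl) ?_
    simp only [hg', tan_eq_sin_div_cos, Function.comp]
    have := sin_sq_add_cos_sq (θ x)
    field_simp
    rw [add_comm (cos (θ x) ^ 2), this]
    push_cast
    ring
  have hint : ∫ x in a..a + L, g' x = 0 := by
    rw [intervalIntegral.integral_eq_sub_of_hasDerivAt hg
      (by rw [← hu] at hg'c; exact hg'c.intervalIntegrable), h0, h1]
    ring
  have hi1 : IntervalIntegrable (fun x => f' x ^ 2) volume a (a + L) :=
    Continuous.intervalIntegrable (by fun_prop) _ _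
  have hi2 : IntervalIntegrable (fun x => μ ^ 2 * f x ^ 2) volume a (a + L) :=
    Continuous.intervalIntegrable (by fun_prop) _ _
  have hi3 : IntervalIntegrable g' volume a (a + L) := by
    rw [← hu] at hg'c; exact hg'c.intervalIntegrable
  have hmono : ∫ x in a..a + L, (μ ^ 2 * f x ^ 2 - g' x) ≤ ∫ x in a..a + L, f' x ^ 2 := by
    refine intervalIntegral.integral_mono_on (by linarith) (hi2.sub hi3) hi1 fun x _ => ?_
    simp only [hg']
    nlinarith [sq_nonneg (f' x + μ * f x * tan (θ x))]
  rw [intervalIntegral.integral_sub hi2 hi3, hint, sub_zero,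
    intervalIntegral.integral_const_mul] at hmono
  exact hmono

lemma dirichlet_wirtinger {f f' : ℝ → ℝ} (hf : ∀ x, HasDerivAt f (f' x) x)
    (hf' : Continuous f') {a L : ℝ} (hL : 0 < L) (h0 : f a = 0) (h1 : f (a + L) = 0) :
    (π / L) ^ 2 * ∫ x in a..a + L, f x ^ 2 ≤ ∫ x in a..a + L, f' x ^ 2 := by
  have hpos : 0 < π / L := div_pos pi_pos hL
  have hlim : Tendsto (fun μ : ℝ => μ ^ 2 * ∫ x in a..a + L, f x ^ 2) (𝓝[<] (π / L))
      (𝓝 ((π / L) ^ 2 * ∫ x in a..a + L, f x ^ 2)) :=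
    (Continuous.tendsto (by fun_prop) _).mono_left nhdsWithin_le_nhds
  refine le_of_tendsto hlim ?_
  filter_upwards [Ioo_mem_nhdsLT hpos] with μ hμ
  exact dirichlet_wirtinger_aux hf hf' hL hμ.1.le ((lt_div_iff₀ hL).1 hμ.2) h0 h1

lemma periodic_of_hasDerivAt {f f' : ℝ → ℝ} (hf : ∀ x, HasDerivAt f (f' x) x) {T s : ℝ}
    (hp : ∀ x, f (x + T) = s * f x) (x : ℝ) : f' (x + T) = s * f' x := by
  have h1 : HasDerivAt (fun x => f (x + T)) (f' (x + T)) x := (hf (x + T)).comp_add_const x T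
  have h2 : HasDerivAt (fun x => f (x + T)) (s * f' x) x :=
    ((hf x).const_mul s).of_eq (fun t => hp t) rfl
  exact h1.unique h2

lemma exists_zero_of_neg_shift {h : ℝ → ℝ} (hc : Continuous h) {T : ℝ}
    (hT : ∀ x, h (x + T) = -h x) : ∃ a, h a = 0 := by
  have h0 := hT 0
  rcases le_total (h 0) 0 with h1 | h1
  · exact mem_range_of_exists_le_of_exists_ge hc ⟨0, h1⟩ ⟨0 + T, by linarith⟩
  · exact mem_range_of_exists_le_of_exists_ge hc ⟨0 + T, by linarith⟩ ⟨0, h1⟩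

lemma integral_neg_pi_pi_eq {F : ℝ → ℝ} (hp : ∀ x, F (x + 2 * π) = F x) (a : ℝ) :
    ∫ x in -π..π, F x = ∫ x in a..a + 2 * π, F x := by
  have h := Function.Periodic.intervalIntegral_add_eq (f := F) (T := 2 * π) hp (-π) a
  rwa [show -π + 2 * π = π by ring] at h

lemma periodic_wirtinger {f f' : ℝ → ℝ} (hf : ∀ x, HasDerivAt f (f' x) x)
    (hf' : Continuous f') (hp : ∀ x, f (x + 2 * π) = f x) (h0 : ∫ x in -π..π, f x = 0) :
    ∫ x in -π..π, f x ^ 2 ≤ ∫ x in -π..π, f' x ^ 2 := by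
  have hfc : Continuous f := continuous_iff_continuousAt.2 fun x => (hf x).continuousAt
  have hp' : ∀ x, f' (x + 2 * π) = f' x := fun x => by
    simpa using periodic_of_hasDerivAt hf (s := 1) (by simpa using hp) x
  obtain ⟨a, ha⟩ := exists_zero_of_neg_shift (h := fun x => f (x + π) - f x) (T := π)
    (by fun_prop) fun x => by
      rw [add_assoc x π π, ← two_mul, hp]
      ring
  have e1 : f (a + π) = f a := sub_eq_zero.1 ha
  have e2 : f (a + π + π) = f a := by rw [add_assoc, ← two_mul, hp]
  have k1 := dirichlet_wirtinger (f := fun x => f x - f a) (fun x => (hf x).sub_const _) hf'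
    (a := a) pi_pos (by simp) (by simp [e1])
  have k2 := dirichlet_wirtinger (f := fun x => f x - f a) (fun x => (hf x).sub_const _) hf'
    (a := a + π) pi_pos (by simp [e1]) (by simp [e2])
  rw [div_self pi_pos.ne', one_pow, one_mul] at k1 k2
  have hi : ∀ {F : ℝ → ℝ} (_ : Continuous F) (s t : ℝ), IntervalIntegrable F volume s t :=
    fun h s t => h.intervalIntegrable s t
  have k3 : ∫ x in a..a + 2 * π, (f x - f a) ^ 2 ≤ ∫ x in a..a + 2 * π, f' x ^ 2 := by
    rw [show a + 2 * π = a + π + π by ring,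
      ← intervalIntegral.integral_add_adjacent_intervals
        (hi (by fun_prop) a (a + π))
          (hi (by fun_prop) (a + π) (a + π + π)),
      ← intervalIntegral.integral_add_adjacent_intervals
        (hi (by fun_prop : Continuous fun x => f' x ^ 2) a (a + π))
          (hi (by fun_prop) (a + π) (a + π + π))]
    exact add_le_add k1 k2
  rw [← integral_neg_pi_pi_eq (F := fun x => (f x - f a) ^ 2) (fun x => by simp [hp]),
    ← integral_neg_pi_pi_eq (F := fun x => f' x ^ 2) (fun x => by simp [hp'])] at k3
  have k4 : ∫ x in -π..π, (f x - f a) ^ 2 = (∫ x in -π..π, f x ^ 2) + 2 * π * f a ^ 2 := by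
    have : ∀ x, (f x - f a) ^ 2 = f x ^ 2 - 2 * f a * f x + f a ^ 2 := fun x => by ring
    simp_rw [this]
    rw [intervalIntegral.integral_add (hi (by fun_prop) _ _) (hi (by fun_prop) _ _),
      intervalIntegral.integral_sub (hi (by fun_prop) _ _) (hi (by fun_prop) _ _),
      intervalIntegral.integral_const_mul, h0, intervalIntegral.integral_const]
    simp only [smul_eq_mul]
    ring
  have k5 : 0 ≤ 2 * π * f a ^ 2 := by have := pi_pos; positivity
  linarith

lemma antiperiodic_wirtinger {f f' : ℝ → ℝ} (hf : ∀ x, HasDerivAt f (f' x) x)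
    (hf' : Continuous f') (hp : ∀ x, f (x + 2 * π) = -f x) :
    (1 / 2) ^ 2 * ∫ x in -π..π, f x ^ 2 ≤ ∫ x in -π..π, f' x ^ 2 := by
  have hfc : Continuous f := continuous_iff_continuousAt.2 fun x => (hf x).continuousAt
  have hp' : ∀ x, f' (x + 2 * π) = -f' x := fun x => by
    simpa using periodic_of_hasDerivAt hf (s := -1) (by simpa using hp) x
  obtain ⟨a, ha⟩ := exists_zero_of_neg_shift hfc hp
  have k := dirichlet_wirtinger hf hf' (a := a) (L := 2 * π) (by positivity) ha (by simp [hp, ha])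
  rw [show π / (2 * π) = 1 / 2 by field_simp] at k
  rwa [integral_neg_pi_pi_eq (F := fun x => f x ^ 2) (fun x => by simp [hp]) a,
    integral_neg_pi_pi_eq (F := fun x => f' x ^ 2) (fun x => by simp [hp']) a]

lemma sq_integral_mul_le {f g : ℝ → ℝ} (hf : Continuous f) (hg : Continuous g) {a b : ℝ}
    (hab : a ≤ b) :
    (∫ x in a..b, f x * g x) ^ 2 ≤ (∫ x in a..b, f x ^ 2) * ∫ x in a..b, g x ^ 2 := by
  have hi : ∀ {F : ℝ → ℝ} (_ : Continuous F), IntervalIntegrable F volume a b :=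
    fun h => h.intervalIntegrable a b
  have key : ∀ t : ℝ, 0 ≤ (∫ x in a..b, g x ^ 2) * (t * t) + (2 * ∫ x in a..b, f x * g x) * t
      + ∫ x in a..b, f x ^ 2 := by
    intro t
    have h : 0 ≤ ∫ x in a..b, (f x + t * g x) ^ 2 :=
      intervalIntegral.integral_nonneg hab fun x _ => sq_nonneg _
    have e : ∀ x, (f x + t * g x) ^ 2 = t * t * g x ^ 2 + 2 * t * (f x * g x) + f x ^ 2 :=
      fun x => by ring
    simp_rw [e] at h
    rw [intervalIntegral.integral_add (hi (by fun_prop)) (hi (by fun_prop)),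
      intervalIntegral.integral_add (hi (by fun_prop)) (hi (by fun_prop)),
      intervalIntegral.integral_const_mul, intervalIntegral.integral_const_mul] at h
    linarith
  have := discrim_le_zero key
  unfold discrim at this
  nlinarith

/-- Angular inequality for a rotated pair of Fourier-gapped functions. -/
lemma angular_pair_inequality {f g f' g' : ℝ → ℝ} (hf : ∀ x, HasDerivAt f (f' x) x)
    (hg : ∀ x, HasDerivAt g (g' x) x) (hf' : Continuous f') (hg' : Continuous g')
    {l h t : ℝ} (hl : 0 < l) (hh : h ^ 2 = l ^ 2) (ht : 0 < t)
    (hbd : f π * g π = f (-π) * g (-π))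
    (hWf : l ^ 2 * ∫ x in -π..π, f x ^ 2 ≤ ∫ x in -π..π, f' x ^ 2)
    (hWg : l ^ 2 * ∫ x in -π..π, g x ^ 2 ≤ ∫ x in -π..π, g' x ^ 2) :
    2 * l ^ 2 * ((1 - t) * (∫ x in -π..π, f x ^ 2) + (1 - 1 / t) * ∫ x in -π..π, g x ^ 2)
      ≤ ∫ x in -π..π, ((f' x - h * g x) ^ 2 + (g' x + h * f x) ^ 2) := by
  have hfc : Continuous f := continuous_iff_continuousAt.2 fun x => (hf x).continuousAt
  have hgc : Continuous g := continuous_iff_continuousAt.2 fun x => (hg x).continuousAt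
  have hpi : -π ≤ π := by linarith [pi_pos]
  have hi : ∀ {F : ℝ → ℝ} (_ : Continuous F), IntervalIntegrable F volume (-π) π :=
    fun h => h.intervalIntegrable _ _
  have hn : ∀ F : ℝ → ℝ, 0 ≤ ∫ x in -π..π, F x ^ 2 := fun F =>
    intervalIntegral.integral_nonneg hpi fun x _ => sq_nonneg _
  have e : ∀ x, (f' x - h * g x) ^ 2 + (g' x + h * f x) ^ 2
      = f' x ^ 2 + g' x ^ 2 + h ^ 2 * f x ^ 2 + h ^ 2 * g x ^ 2
        + 2 * h * (f x * g' x) - 2 * h * (g x * f' x) := fun x => by ring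
  simp_rw [e]
  rw [intervalIntegral.integral_sub (hi (by fun_prop)) (hi (by fun_prop)),
    intervalIntegral.integral_add (hi (by fun_prop)) (hi (by fun_prop)),
    intervalIntegral.integral_add (hi (by fun_prop)) (hi (by fun_prop)),
    intervalIntegral.integral_add (hi (by fun_prop)) (hi (by fun_prop)),
    intervalIntegral.integral_add (hi (by fun_prop)) (hi (by fun_prop)),
    intervalIntegral.integral_const_mul, intervalIntegral.integral_const_mul,
    intervalIntegral.integral_const_mul, intervalIntegral.integral_const_mul]
  have hparts : (∫ x in -π..π, f x * g' x) + ∫ x in -π..π, g x * f' x = 0 := by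
    rw [← intervalIntegral.integral_add (hi (by fun_prop)) (hi (by fun_prop)),
      intervalIntegral.integral_eq_sub_of_hasDerivAt (f := fun x => f x * g x)
        (fun x _ => ((hf x).fun_mul (hg x)).of_eq (fun s => rfl) (by ring)) (hi (by fun_prop)), hbd,
      sub_self]
  have c1 := sq_integral_mul_le hfc hg' hpi
  have c2 := sq_integral_mul_le hgc hf' hpi
  set J := ∫ x in -π..π, f x * g' x
  set J' := ∫ x in -π..π, g x * f' x
  have hJ' : J' = -J := by linarith
  rw [hJ'] at c2 ⊢
  obtain ⟨F, hF0, hF⟩ : ∃ F, 0 ≤ F ∧ ∫ x in -π..π, f x ^ 2 = F ^ 2 :=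
    ⟨√_, Real.sqrt_nonneg _, (Real.sq_sqrt (hn f)).symm⟩
  obtain ⟨G, hG0, hG⟩ : ∃ F, 0 ≤ F ∧ ∫ x in -π..π, g x ^ 2 = F ^ 2 :=
    ⟨√_, Real.sqrt_nonneg _, (Real.sq_sqrt (hn g)).symm⟩
  obtain ⟨X, hX0, hX⟩ : ∃ F, 0 ≤ F ∧ ∫ x in -π..π, f' x ^ 2 = F ^ 2 :=
    ⟨√_, Real.sqrt_nonneg _, (Real.sq_sqrt (hn f')).symm⟩
  obtain ⟨Y, hY0, hY⟩ : ∃ F, 0 ≤ F ∧ ∫ x in -π..π, g' x ^ 2 = F ^ 2 :=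
    ⟨√_, Real.sqrt_nonneg _, (Real.sq_sqrt (hn g')).symm⟩
  rw [hF, hX] at hWf
  rw [hG, hY] at hWg
  rw [hF, hY] at c1
  rw [hG, hX] at c2
  rw [hF, hG, hX, hY, hh]
  have hXF : l * F ≤ X := by
    rw [← mul_pow] at hWf
    exact (pow_le_pow_iff_left₀ (by positivity) hX0 two_ne_zero).1 hWf
  have hYG : l * G ≤ Y := by
    rw [← mul_pow] at hWg
    exact (pow_le_pow_iff_left₀ (by positivity) hY0 two_ne_zero).1 hWg
  have hJ1 : |J| ≤ F * Y := abs_le_of_sq_le_sq (by rw [mul_pow]; exact c1) (by positivity)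
  have hJ2 : |J| ≤ G * X := by
    rw [neg_sq] at c2
    exact abs_le_of_sq_le_sq (by rw [mul_pow]; exact c2) (by positivity)
  have hhl : |h| = l := by
    rw [← Real.sqrt_sq_eq_abs, hh, Real.sqrt_sq hl.le]
  have hhJ : -(l * |J|) ≤ h * J := by
    rw [← hhl, ← abs_mul]
    exact neg_abs_le _
  have hAM : 2 * (F * G) ≤ t * F ^ 2 + 1 / t * G ^ 2 := by
    have : 0 ≤ (t * F - G) ^ 2 / t := by positivity
    have e : (t * F - G) ^ 2 / t = t * F ^ 2 + 1 / t * G ^ 2 - 2 * (F * G) := by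
      field_simp
      ring
    linarith
  obtain ⟨x, rfl⟩ : ∃ x, X = l * F + x := ⟨X - l * F, by ring⟩
  obtain ⟨w, rfl⟩ : ∃ w, Y = l * G + w := ⟨Y - l * G, by ring⟩
  have hx : 0 ≤ x := by linarith
  have hw : 0 ≤ w := by linarith
  have hm : 2 * (|J| - l * (F * G)) ≤ F * x + G * w := by
    by_contra! hlt
    have h1 : |J| - l * (F * G) ≤ F * w := by linarith
    have h2 : |J| - l * (F * G) ≤ G * x := by linarith
    have h4 : 0 ≤ F * x := by positivity
    have h5 : 0 ≤ G * w := by positivity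
    have h3 : 0 ≤ |J| - l * (F * G) := by linarith
    have h6 : (|J| - l * (F * G)) * (|J| - l * (F * G)) ≤ F * w * (G * x) :=
      mul_le_mul h1 h2 h3 (by positivity)
    nlinarith [sq_nonneg (F * x - G * w)]
  have hfin := mul_le_mul_of_nonneg_left hAM (sq_nonneg l)
  have hm' := mul_le_mul_of_nonneg_left hm hl.le
  nlinarith [sq_nonneg x, sq_nonneg w]

lemma hasDerivAt_intervalIntegral_of_continuous {F F' : ℝ → ℝ → ℝ}
    (hF : Continuous fun z : ℝ × ℝ => F z.1 z.2) (hF' : Continuous fun z : ℝ × ℝ => F' z.1 z.2)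
    (hd : ∀ r φ, HasDerivAt (fun r => F r φ) (F' r φ) r) (a b r : ℝ) :
    HasDerivAt (fun r => ∫ φ in a..b, F r φ) (∫ φ in a..b, F' r φ) r := by
  have hs : ∀ {G : ℝ → ℝ → ℝ} (_ : Continuous fun z : ℝ × ℝ => G z.1 z.2) (r : ℝ),
      Continuous (G r) := fun hG r => hG.comp (by fun_prop : Continuous fun φ : ℝ => (r, φ))
  obtain ⟨C, hC⟩ := (isCompact_Icc (a := r - 1) (b := r + 1)).prod
    (isCompact_uIcc (a := a) (b := b)) |>.exists_bound_of_continuousOn hF'.continuousOn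
  refine (intervalIntegral.hasDerivAt_integral_of_dominated_loc_of_deriv_le
    (s := Icc (r - 1) (r + 1)) (bound := fun _ => C)
    (Icc_mem_nhds (by linarith) (by linarith))
    (Eventually.of_forall fun x => (hs hF x).aestronglyMeasurable)
    ((hs hF r).intervalIntegrable _ _) (hs hF' r).aestronglyMeasurable
    (Eventually.of_forall fun φ hφ x hx => ?_) (by simp)
    (Eventually.of_forall fun φ _ x _ => hd x φ)).2
  exact hC (x, φ) ⟨hx, uIoc_subset_uIcc hφ⟩

/-- A `C¹` function on the circle (`s = 1`) or an antiperiodic one (`s = -1`). -/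
structure IsAngular (s : ℝ) (f f' : ℝ → ℝ) : Prop where
  deriv : ∀ x, HasDerivAt f (f' x) x
  cont' : Continuous f'
  per : ∀ x, f (x + 2 * π) = s * f x

namespace IsAngular

variable {s : ℝ} {f f' : ℝ → ℝ}

lemma cont (h : IsAngular s f f') : Continuous f :=
  continuous_iff_continuousAt.2 fun x => (h.deriv x).continuousAt

lemma at_pi (h : IsAngular s f f') : f π = s * f (-π) := by
  rw [← h.per, show -π + 2 * π = π by ring]

lemma integral_deriv (h : IsAngular 1 f f') : ∫ x in -π..π, f' x = 0 := by
  rw [intervalIntegral.integral_eq_sub_of_hasDerivAt (fun x _ => h.deriv x)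
    (h.cont'.intervalIntegrable _ _), h.at_pi, one_mul, sub_self]

lemma sub_const (h : IsAngular 1 f f') (m : ℝ) : IsAngular 1 (fun x => f x - m) f' :=
  ⟨fun x => (h.deriv x).sub_const m, h.cont', fun x => by rw [h.per]; ring⟩

end IsAngular

lemma picone_le {f g : ℝ → ℝ} (hf : Continuous f) (hg : Continuous g) (ρ : ℝ) :
    2 * ρ * (∫ x in -π..π, f x * g x) - ρ ^ 2 * ∫ x in -π..π, f x ^ 2
      ≤ ∫ x in -π..π, g x ^ 2 := by
  have h : 0 ≤ ∫ x in -π..π, (g x - ρ * f x) ^ 2 :=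
    intervalIntegral.integral_nonneg (by linarith [pi_pos]) fun x _ => sq_nonneg _
  have hi : ∀ {F : ℝ → ℝ} (_ : Continuous F), IntervalIntegrable F volume (-π) π :=
    fun h => h.intervalIntegrable _ _
  have e : ∀ x, (g x - ρ * f x) ^ 2 = g x ^ 2 - 2 * ρ * (f x * g x) + ρ ^ 2 * f x ^ 2 :=
    fun x => by ring
  simp_rw [e] at h
  rw [intervalIntegral.integral_add (hi (by fun_prop)) (hi (by fun_prop)),
    intervalIntegral.integral_sub (hi (by fun_prop)) (hi (by fun_prop)),
    intervalIntegral.integral_const_mul, intervalIntegral.integral_const_mul] at h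
  linarith

lemma integral_sub_mean {f : ℝ → ℝ} (hf : Continuous f) {m : ℝ}
    (hm : ∫ x in -π..π, f x = 2 * π * m) : ∫ x in -π..π, (f x - m) = 0 := by
  rw [intervalIntegral.integral_sub (hf.intervalIntegrable _ _) (by simp), hm,
    intervalIntegral.integral_const]
  simp only [smul_eq_mul]
  ring

lemma integral_mul_split {f g : ℝ → ℝ} (hf : Continuous f) (hg : Continuous g) {m n : ℝ}
    (hm : ∫ x in -π..π, f x = 2 * π * m) (hn : ∫ x in -π..π, g x = 2 * π * n) :
    ∫ x in -π..π, f x * g x = (∫ x in -π..π, (f x - m) * (g x - n)) + 2 * π * (m * n) := by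
  have hi : ∀ {F : ℝ → ℝ} (_ : Continuous F), IntervalIntegrable F volume (-π) π :=
    fun h => h.intervalIntegrable _ _
  have e : ∀ x, (f x - m) * (g x - n) = f x * g x - n * f x - m * g x + m * n :=
    fun x => by ring
  simp_rw [e]
  rw [intervalIntegral.integral_add (hi (by fun_prop)) (hi (by fun_prop)),
    intervalIntegral.integral_sub (hi (by fun_prop)) (hi (by fun_prop)),
    intervalIntegral.integral_sub (hi (by fun_prop)) (hi (by fun_prop)),
    intervalIntegral.integral_const_mul, intervalIntegral.integral_const_mul, hm, hn,
    intervalIntegral.integral_const]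
  simp only [smul_eq_mul]
  ring

lemma integral_sq_split {f : ℝ → ℝ} (hf : Continuous f) {m : ℝ}
    (hm : ∫ x in -π..π, f x = 2 * π * m) :
    ∫ x in -π..π, f x ^ 2 = (∫ x in -π..π, (f x - m) ^ 2) + 2 * π * m ^ 2 := by
  simp_rw [pow_two]
  exact integral_mul_split hf hf hm hm

/-- Quadratic form of the second variation on the components coupled to the profile. -/
def tripleForm (k r U κ A₀ A₁ A₂ f₀ f₁ f₂ g₀ g₁ g₂ d₀ d₁ d₂ : ℝ) : ℝ :=
  g₀ ^ 2 + g₁ ^ 2 + g₂ ^ 2 + (d₀ ^ 2 + ((d₁ - k * f₂) ^ 2 + (d₂ + k * f₁) ^ 2)) / r ^ 2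
    + A₀ * f₀ ^ 2 + A₁ * f₁ ^ 2 + A₂ * f₂ ^ 2 + 4 * U * κ * (f₀ * f₁)

/-- Quadratic form of the second variation on the components decoupled from the profile. -/
def pairForm (h r V₁ V₂ f₁ f₂ g₁ g₂ d₁ d₂ : ℝ) : ℝ :=
  g₁ ^ 2 + g₂ ^ 2 + ((d₁ - h * f₂) ^ 2 + (d₂ + h * f₁) ^ 2) / r ^ 2 + V₁ * f₁ ^ 2 + V₂ * f₂ ^ 2

lemma integral_tripleForm {f₀ f₁ f₂ g₀ g₁ g₂ d₀ d₁ d₂ : ℝ → ℝ} (hf₀ : Continuous f₀)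
    (hf₁ : Continuous f₁) (hf₂ : Continuous f₂) (hg₀ : Continuous g₀) (hg₁ : Continuous g₁)
    (hg₂ : Continuous g₂) (hd₀ : Continuous d₀) (hd₁ : Continuous d₁) (hd₂ : Continuous d₂)
    (k r U κ A₀ A₁ A₂ : ℝ) :
    ∫ x in -π..π, tripleForm k r U κ A₀ A₁ A₂ (f₀ x) (f₁ x) (f₂ x) (g₀ x) (g₁ x) (g₂ x)
        (d₀ x) (d₁ x) (d₂ x)
      = (∫ x in -π..π, g₀ x ^ 2) + (∫ x in -π..π, g₁ x ^ 2) + (∫ x in -π..π, g₂ x ^ 2)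
        + ((∫ x in -π..π, d₀ x ^ 2) + ((∫ x in -π..π, (d₁ x - k * f₂ x) ^ 2)
          + ∫ x in -π..π, (d₂ x + k * f₁ x) ^ 2)) / r ^ 2
        + A₀ * (∫ x in -π..π, f₀ x ^ 2) + A₁ * (∫ x in -π..π, f₁ x ^ 2)
        + A₂ * (∫ x in -π..π, f₂ x ^ 2) + 4 * U * κ * ∫ x in -π..π, f₀ x * f₁ x := by
  have hi : ∀ {F : ℝ → ℝ} (_ : Continuous F), IntervalIntegrable F volume (-π) π :=
    fun h => h.intervalIntegrable _ _
  unfold tripleForm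
  simp only [div_eq_mul_inv]
  rw [intervalIntegral.integral_add (hi (by fun_prop)) (hi (by fun_prop)),
    intervalIntegral.integral_add (hi (by fun_prop)) (hi (by fun_prop)),
    intervalIntegral.integral_add (hi (by fun_prop)) (hi (by fun_prop)),
    intervalIntegral.integral_add (hi (by fun_prop)) (hi (by fun_prop)),
    intervalIntegral.integral_add (hi (by fun_prop)) (hi (by fun_prop)),
    intervalIntegral.integral_add (hi (by fun_prop)) (hi (by fun_prop)),
    intervalIntegral.integral_add (hi (by fun_prop)) (hi (by fun_prop)),
    intervalIntegral.integral_const_mul, intervalIntegral.integral_const_mul,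
    intervalIntegral.integral_const_mul, intervalIntegral.integral_const_mul,
    intervalIntegral.integral_mul_const,
    intervalIntegral.integral_add (hi (by fun_prop)) (hi (by fun_prop)),
    intervalIntegral.integral_add (hi (by fun_prop)) (hi (by fun_prop))]

lemma integral_pairForm {f₁ f₂ g₁ g₂ d₁ d₂ : ℝ → ℝ}
    (hf₁ : Continuous f₁) (hf₂ : Continuous f₂) (hg₁ : Continuous g₁)
    (hg₂ : Continuous g₂) (hd₁ : Continuous d₁) (hd₂ : Continuous d₂) (h r V₁ V₂ : ℝ) :
    ∫ x in -π..π, pairForm h r V₁ V₂ (f₁ x) (f₂ x) (g₁ x) (g₂ x) (d₁ x) (d₂ x)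
      = (∫ x in -π..π, g₁ x ^ 2) + (∫ x in -π..π, g₂ x ^ 2)
        + (∫ x in -π..π, ((d₁ x - h * f₂ x) ^ 2 + (d₂ x + h * f₁ x) ^ 2)) / r ^ 2
        + V₁ * (∫ x in -π..π, f₁ x ^ 2) + V₂ * (∫ x in -π..π, f₂ x ^ 2) := by
  have hi : ∀ {F : ℝ → ℝ} (_ : Continuous F), IntervalIntegrable F volume (-π) π :=
    fun h => h.intervalIntegrable _ _
  unfold pairForm
  simp only [div_eq_mul_inv]
  rw [intervalIntegral.integral_add (hi (by fun_prop)) (hi (by fun_prop)),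
    intervalIntegral.integral_add (hi (by fun_prop)) (hi (by fun_prop)),
    intervalIntegral.integral_add (hi (by fun_prop)) (hi (by fun_prop)),
    intervalIntegral.integral_add (hi (by fun_prop)) (hi (by fun_prop)),
    intervalIntegral.integral_const_mul, intervalIntegral.integral_const_mul,
    intervalIntegral.integral_mul_const]

lemma zero_mean_triple_le {f₀ f₁ f₂ d₀ d₁ d₂ : ℝ → ℝ} (hf₀ : IsAngular 1 f₀ d₀)
    (hf₁ : IsAngular 1 f₁ d₁) (hf₂ : IsAngular 1 f₂ d₂) (h₀ : ∫ x in -π..π, f₀ x = 0)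
    (h₁ : ∫ x in -π..π, f₁ x = 0) (h₂ : ∫ x in -π..π, f₂ x = 0)
    {k r U κ A₀ A₁ A₂ p q z : ℝ} (hk : k ^ 2 = 1) (hr : 0 < r) (hU : 0 < U) (hp : 0 < p)
    (hq : 0 < q) (hz : z ≤ (1 / r ^ 2 + A₀) * q - 2 * U * |κ| * p) :
    z / q * (∫ x in -π..π, f₀ x ^ 2)
      + (2 / r ^ 2 + A₁ - 2 * U / (r ^ 3 * p) - 2 * U * |κ| * q / p) * (∫ x in -π..π, f₁ x ^ 2)
      + (2 / r ^ 2 + A₂ - 2 * p / (r * U)) * (∫ x in -π..π, f₂ x ^ 2)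
      ≤ ((∫ x in -π..π, d₀ x ^ 2) + ((∫ x in -π..π, (d₁ x - k * f₂ x) ^ 2)
          + ∫ x in -π..π, (d₂ x + k * f₁ x) ^ 2)) / r ^ 2
        + A₀ * (∫ x in -π..π, f₀ x ^ 2) + A₁ * (∫ x in -π..π, f₁ x ^ 2)
        + A₂ * (∫ x in -π..π, f₂ x ^ 2) + 4 * U * κ * ∫ x in -π..π, f₀ x * f₁ x := by
  have hi : ∀ {F : ℝ → ℝ} (_ : Continuous F), IntervalIntegrable F volume (-π) π :=
    fun h => h.intervalIntegrable _ _
  have hpi : -π ≤ π := by linarith [pi_pos]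
  have c0 := hf₀.cont; have c1 := hf₁.cont; have c2 := hf₂.cont
  have e0 := hf₀.cont'; have e1 := hf₁.cont'; have e2 := hf₂.cont'
  have w0 := periodic_wirtinger hf₀.deriv hf₀.cont' (by simpa using hf₀.per) h₀
  have w1 := periodic_wirtinger hf₁.deriv hf₁.cont' (by simpa using hf₁.per) h₁
  have w2 := periodic_wirtinger hf₂.deriv hf₂.cont' (by simpa using hf₂.per) h₂
  have ht : 0 < U / (r * p) := by positivity
  have hpair := angular_pair_inequality hf₁.deriv hf₂.deriv hf₁.cont' hf₂.cont' one_pos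
    (h := k) (by rw [hk, one_pow]) ht (by rw [hf₁.at_pi, hf₂.at_pi]; ring)
    (by simpa using w1) (by simpa using w2)
  rw [intervalIntegral.integral_add (hi (by fun_prop)) (hi (by fun_prop))] at hpair
  have hcross : 0 ≤ ∫ x in -π..π, (2 * U * |κ| * (p / q) * f₀ x ^ 2
      + 2 * U * |κ| * (q / p) * f₁ x ^ 2 + 4 * U * κ * (f₀ x * f₁ x)) := by
    refine intervalIntegral.integral_nonneg hpi fun x _ => ?_
    have h1 : 0 ≤ 2 * U * |κ| / (p * q) * (p * |f₀ x| - q * |f₁ x|) ^ 2 := by positivity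
    have h2 : 2 * U * |κ| / (p * q) * (p * |f₀ x| - q * |f₁ x|) ^ 2
        = 2 * U * |κ| * (p / q) * |f₀ x| ^ 2 + 2 * U * |κ| * (q / p) * |f₁ x| ^ 2
          - 4 * U * (|κ| * (|f₀ x| * |f₁ x|)) := by
      field_simp
      ring
    rw [h2, sq_abs, sq_abs, ← abs_mul, ← abs_mul] at h1
    have h3 := mul_le_mul_of_nonneg_left (neg_abs_le (κ * (f₀ x * f₁ x)))
      (by positivity : 0 ≤ 4 * U)
    linarith
  rw [intervalIntegral.integral_add (hi (by fun_prop)) (hi (by fun_prop)),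
    intervalIntegral.integral_add (hi (by fun_prop)) (hi (by fun_prop)),
    intervalIntegral.integral_const_mul, intervalIntegral.integral_const_mul,
    intervalIntegral.integral_const_mul] at hcross
  have n0 : 0 ≤ ∫ x in -π..π, f₀ x ^ 2 :=
    intervalIntegral.integral_nonneg hpi fun x _ => sq_nonneg _
  set N₀ := ∫ x in -π..π, f₀ x ^ 2
  set N₁ := ∫ x in -π..π, f₁ x ^ 2
  set N₂ := ∫ x in -π..π, f₂ x ^ 2
  set C := ∫ x in -π..π, f₀ x * f₁ x
  set D₀ := ∫ x in -π..π, d₀ x ^ 2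
  set D₁ := ∫ x in -π..π, (d₁ x - k * f₂ x) ^ 2
  set D₂ := ∫ x in -π..π, (d₂ x + k * f₁ x) ^ 2
  have hz' : z / q * N₀ ≤ (1 / r ^ 2 + A₀ - 2 * U * |κ| * (p / q)) * N₀ := by
    refine mul_le_mul_of_nonneg_right ?_ n0
    rw [div_le_iff₀ hq]
    refine hz.trans (le_of_eq ?_)
    field_simp
  have hang : (N₀ + 2 * ((1 - U / (r * p)) * N₁ + (1 - 1 / (U / (r * p))) * N₂)) / r ^ 2
      ≤ (D₀ + (D₁ + D₂)) / r ^ 2 := by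
    refine div_le_div_of_nonneg_right ?_ (by positivity)
    simp only [one_pow, mul_one] at hpair
    linarith
  have key : (N₀ + 2 * ((1 - U / (r * p)) * N₁ + (1 - 1 / (U / (r * p))) * N₂)) / r ^ 2
      = 1 / r ^ 2 * N₀ + (2 / r ^ 2 - 2 * U / (r ^ 3 * p)) * N₁
        + (2 / r ^ 2 - 2 * p / (r * U)) * N₂ := by
    field_simp
    ring
  rw [key] at hang
  have e3 : 2 * U * |κ| * (q / p) = 2 * U * |κ| * q / p := by ring
  rw [e3] at hcross
  linarith

/-- Lower bound for the triple form on a circle, separating angular means. -/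
lemma le_integral_tripleForm {f₀ f₁ f₂ g₀ g₁ g₂ d₀ d₁ d₂ : ℝ → ℝ} (hf₀ : IsAngular 1 f₀ d₀)
    (hf₁ : IsAngular 1 f₁ d₁) (hf₂ : IsAngular 1 f₂ d₂) (hg₀ : Continuous g₀)
    (hg₁ : Continuous g₁) (hg₂ : Continuous g₂) {m₀ m₁ m₂ n₀ n₁ n₂ : ℝ}
    (hm₀ : ∫ x in -π..π, f₀ x = 2 * π * m₀) (hm₁ : ∫ x in -π..π, f₁ x = 2 * π * m₁)
    (hm₂ : ∫ x in -π..π, f₂ x = 2 * π * m₂) (hn₀ : ∫ x in -π..π, g₀ x = 2 * π * n₀)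
    (hn₁ : ∫ x in -π..π, g₁ x = 2 * π * n₁) (hn₂ : ∫ x in -π..π, g₂ x = 2 * π * n₂)
    {k r U κ A₀ A₁ A₂ p q z : ℝ} (hk : k ^ 2 = 1) (hr : 0 < r) (hU : 0 < U) (hp : 0 < p)
    (hq : 0 < q) (hz : z ≤ (1 / r ^ 2 + A₀) * q - 2 * U * |κ| * p) (ρ₀ ρ₁ ρ₂ σ : ℝ) :
    (2 * ρ₀ * ((∫ x in -π..π, f₀ x * g₀ x) - 2 * π * (m₀ * n₀))
        + (z / q - ρ₀ ^ 2) * ((∫ x in -π..π, f₀ x ^ 2) - 2 * π * m₀ ^ 2))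
      + (2 * ρ₁ * ((∫ x in -π..π, f₁ x * g₁ x) - 2 * π * (m₁ * n₁))
        + (2 / r ^ 2 + A₁ - 2 * U / (r ^ 3 * p) - 2 * U * |κ| * q / p - ρ₁ ^ 2)
          * ((∫ x in -π..π, f₁ x ^ 2) - 2 * π * m₁ ^ 2))
      + (2 * ρ₂ * ((∫ x in -π..π, f₂ x * g₂ x) - 2 * π * (m₂ * n₂))
        + (2 / r ^ 2 + A₂ - 2 * p / (r * U) - ρ₂ ^ 2)
          * ((∫ x in -π..π, f₂ x ^ 2) - 2 * π * m₂ ^ 2))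
      + 2 * π * (2 * σ * (m₂ * n₂) + (1 / r ^ 2 + A₂ - σ ^ 2) * m₂ ^ 2)
      + 2 * π * (n₁ ^ 2 + 1 / r ^ 2 * m₁ ^ 2 + n₀ ^ 2 + A₁ * m₁ ^ 2 + A₀ * m₀ ^ 2
        + 4 * U * m₁ * m₀ * κ)
      ≤ ∫ x in -π..π, tripleForm k r U κ A₀ A₁ A₂ (f₀ x) (f₁ x) (f₂ x) (g₀ x) (g₁ x) (g₂ x)
        (d₀ x) (d₁ x) (d₂ x) := by
  have c0 := hf₀.cont; have c1 := hf₁.cont; have c2 := hf₂.cont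
  have e0 := hf₀.cont'; have e1 := hf₁.cont'; have e2 := hf₂.cont'
  have hi : ∀ {F : ℝ → ℝ} (_ : Continuous F), IntervalIntegrable F volume (-π) π :=
    fun h => h.intervalIntegrable _ _
  have b1 : ∫ x in -π..π, (d₁ x - k * f₂ x) = 2 * π * (-(k * m₂)) := by
    rw [intervalIntegral.integral_sub (hi e1) (hi (by fun_prop)),
      intervalIntegral.integral_const_mul, hf₁.integral_deriv, hm₂]
    ring
  have b2 : ∫ x in -π..π, (d₂ x + k * f₁ x) = 2 * π * (k * m₁) := by
    rw [intervalIntegral.integral_add (hi e2) (hi (by fun_prop)),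
      intervalIntegral.integral_const_mul, hf₂.integral_deriv, hm₁]
    ring
  rw [integral_tripleForm c0 c1 c2 hg₀ hg₁ hg₂ e0 e1 e2, integral_sq_split hg₀ hn₀,
    integral_sq_split hg₁ hn₁, integral_sq_split hg₂ hn₂,
    integral_sq_split (by fun_prop : Continuous fun x => d₁ x - k * f₂ x) b1,
    integral_sq_split (by fun_prop : Continuous fun x => d₂ x + k * f₁ x) b2,
    integral_sq_split c0 hm₀, integral_sq_split c1 hm₁, integral_sq_split c2 hm₂,
    integral_mul_split c0 c1 hm₀ hm₁, integral_mul_split c0 hg₀ hm₀ hn₀,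
    integral_mul_split c1 hg₁ hm₁ hn₁, integral_mul_split c2 hg₂ hm₂ hn₂]
  have key := zero_mean_triple_le (hf₀.sub_const m₀) (hf₁.sub_const m₁) (hf₂.sub_const m₂)
    (integral_sub_mean c0 hm₀) (integral_sub_mean c1 hm₁) (integral_sub_mean c2 hm₂)
    (A₁ := A₁) (A₂ := A₂) hk hr hU hp hq hz
  have x1 : ∀ x, d₁ x - k * f₂ x - -(k * m₂) = d₁ x - k * (f₂ x - m₂) := fun x => by ring
  have x2 : ∀ x, d₂ x + k * f₁ x - k * m₁ = d₂ x + k * (f₁ x - m₁) := fun x => by ring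
  simp_rw [x1, x2]
  have p0 := picone_le (f := fun x => f₀ x - m₀) (g := fun x => g₀ x - n₀)
    (by fun_prop) (by fun_prop) ρ₀
  have p1 := picone_le (f := fun x => f₁ x - m₁) (g := fun x => g₁ x - n₁)
    (by fun_prop) (by fun_prop) ρ₁
  have p2 := picone_le (f := fun x => f₂ x - m₂) (g := fun x => g₂ x - n₂)
    (by fun_prop) (by fun_prop) ρ₂
  have p3 : 0 ≤ 2 * π * (n₂ - σ * m₂) ^ 2 := by have := pi_pos; positivity
  have q1 : 2 * π * (-(k * m₂)) ^ 2 = 2 * π * m₂ ^ 2 := by rw [neg_sq, mul_pow, hk, one_mul]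
  have q2 : 2 * π * (k * m₁) ^ 2 = 2 * π * m₁ ^ 2 := by rw [mul_pow, hk, one_mul]
  rw [q1, q2]
  simp only [add_div] at key ⊢
  have q3 : 2 * π * m₂ ^ 2 / r ^ 2 = 2 * π * (1 / r ^ 2 * m₂ ^ 2) := by ring
  have q4 : 2 * π * m₁ ^ 2 / r ^ 2 = 2 * π * (1 / r ^ 2 * m₁ ^ 2) := by ring
  rw [q3, q4]
  linarith

/-- Lower bound for the pair form on a circle. -/
lemma le_integral_pairForm {f₁ f₂ g₁ g₂ d₁ d₂ : ℝ → ℝ} (hf₁ : IsAngular (-1) f₁ d₁)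
    (hf₂ : IsAngular (-1) f₂ d₂) (hg₁ : Continuous g₁) (hg₂ : Continuous g₂)
    {h r V₁ V₂ p q : ℝ} (hh : h ^ 2 = (1 / 2) ^ 2) (hp : 0 < p) (hq : 0 < q) (ρ₁ ρ₂ : ℝ) :
    (2 * ρ₁ * (∫ x in -π..π, f₁ x * g₁ x)
        + (V₁ + (p - q) / (2 * r ^ 2 * p) - ρ₁ ^ 2) * (∫ x in -π..π, f₁ x ^ 2))
      + (2 * ρ₂ * (∫ x in -π..π, f₂ x * g₂ x)
        + (V₂ + (q - p) / (2 * r ^ 2 * q) - ρ₂ ^ 2) * (∫ x in -π..π, f₂ x ^ 2))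
      ≤ ∫ x in -π..π, pairForm h r V₁ V₂ (f₁ x) (f₂ x) (g₁ x) (g₂ x) (d₁ x) (d₂ x) := by
  have w1 := antiperiodic_wirtinger hf₁.deriv hf₁.cont' (by simpa using hf₁.per)
  have w2 := antiperiodic_wirtinger hf₂.deriv hf₂.cont' (by simpa using hf₂.per)
  have hpair := angular_pair_inequality hf₁.deriv hf₂.deriv hf₁.cont' hf₂.cont'
    (by norm_num : (0 : ℝ) < 1 / 2) hh (div_pos hq hp) (by rw [hf₁.at_pi, hf₂.at_pi]; ring) w1 w2
  rw [integral_pairForm hf₁.cont hf₂.cont hg₁ hg₂ hf₁.cont' hf₂.cont']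
  have p1 := picone_le hf₁.cont hg₁ ρ₁
  have p2 := picone_le hf₂.cont hg₂ ρ₂
  have h1 := div_le_div_of_nonneg_right hpair (sq_nonneg r)
  set N₁ := ∫ x in -π..π, f₁ x ^ 2
  set N₂ := ∫ x in -π..π, f₂ x ^ 2
  have h2 : 2 * (1 / 2) ^ 2 * ((1 - q / p) * N₁ + (1 - 1 / (q / p)) * N₂) / r ^ 2
      = (p - q) / (2 * r ^ 2 * p) * N₁ + (q - p) / (2 * r ^ 2 * q) * N₂ := by
    field_simp
  rw [h2] at h1
  linarith

/-- A `C¹` function in polar coordinates, supported in the annulus `α < r < β`. -/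
structure IsPolar (s α β : ℝ) (W Wr Wφ : ℝ → ℝ → ℝ) : Prop where
  cont : Continuous fun z : ℝ × ℝ => W z.1 z.2
  cont_r : Continuous fun z : ℝ × ℝ => Wr z.1 z.2
  cont_φ : Continuous fun z : ℝ × ℝ => Wφ z.1 z.2
  deriv_r : ∀ r φ, HasDerivAt (fun r => W r φ) (Wr r φ) r
  deriv_φ : ∀ r φ, HasDerivAt (W r) (Wφ r φ) φ
  per : ∀ r φ, W r (φ + 2 * π) = s * W r φ
  zero : ∀ r ∉ Ioo α β, ∀ φ, W r φ = 0

lemma continuous_slice {G : ℝ → ℝ → ℝ} (hG : Continuous fun z : ℝ × ℝ => G z.1 z.2) (r : ℝ) :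
    Continuous (G r) := hG.comp (by fun_prop : Continuous fun φ : ℝ => (r, φ))

lemma continuous_angular_integral {G : ℝ → ℝ → ℝ}
    (hG : Continuous fun z : ℝ × ℝ => G z.1 z.2) :
    Continuous fun r => ∫ φ in -π..π, G r φ :=
  intervalIntegral.continuous_parametric_intervalIntegral_of_continuous' hG _ _

lemma exists_angular_integral {G : ℝ → ℝ → ℝ} (hG : Continuous fun z : ℝ × ℝ => G z.1 z.2) :
    ∃ K : ℝ → ℝ, (∀ r, ∫ φ in -π..π, G r φ = K r) ∧ Continuous K :=
  ⟨_, fun _ => rfl, continuous_angular_integral hG⟩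

namespace IsPolar

variable {s α β : ℝ} {W Wr Wφ : ℝ → ℝ → ℝ}

lemma angular (h : IsPolar s α β W Wr Wφ) (r : ℝ) : IsAngular s (W r) (Wφ r) :=
  ⟨h.deriv_φ r, continuous_slice h.cont_φ r, h.per r⟩

lemma deriv_integral_sq (h : IsPolar s α β W Wr Wφ) (r : ℝ) :
    HasDerivAt (fun r => ∫ φ in -π..π, W r φ ^ 2) (2 * ∫ φ in -π..π, W r φ * Wr r φ) r := by
  rw [← intervalIntegral.integral_const_mul]
  have h1 := h.cont
  have h2 := h.cont_r
  exact hasDerivAt_intervalIntegral_of_continuous (F := fun r φ => W r φ ^ 2)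
    (F' := fun r φ => 2 * (W r φ * Wr r φ)) (by fun_prop) (by fun_prop)
    (fun r φ => ((h.deriv_r r φ).fun_pow 2).of_eq (fun _ => rfl) (by push_cast; ring)) _ _ _

lemma integral_sq_eq_zero (h : IsPolar s α β W Wr Wφ) {r : ℝ} (hr : r ∉ Ioo α β) :
    ∫ φ in -π..π, W r φ ^ 2 = 0 := by
  simp [h.zero r hr]

end IsPolar

/-- Angular mean. -/
def angularMean (W : ℝ → ℝ → ℝ) (r : ℝ) : ℝ := (2 * π)⁻¹ * ∫ φ in -π..π, W r φ

lemma integral_eq_angularMean (W : ℝ → ℝ → ℝ) (r : ℝ) :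
    ∫ φ in -π..π, W r φ = 2 * π * angularMean W r := by
  have := pi_ne_zero
  unfold angularMean
  field_simp

namespace IsPolar

variable {s α β : ℝ} {W Wr Wφ : ℝ → ℝ → ℝ}

lemma deriv_mean (h : IsPolar s α β W Wr Wφ) (r : ℝ) :
    HasDerivAt (angularMean W) (angularMean Wr r) r :=
  (hasDerivAt_intervalIntegral_of_continuous h.cont h.cont_r h.deriv_r _ _ r).const_mul _

lemma continuous_mean (h : IsPolar s α β W Wr Wφ) : Continuous (angularMean W) :=
  (continuous_angular_integral h.cont).const_mul _

lemma continuous_mean_r (h : IsPolar s α β W Wr Wφ) : Continuous (angularMean Wr) :=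
  (continuous_angular_integral h.cont_r).const_mul _

lemma mean_eq_zero (h : IsPolar s α β W Wr Wφ) {r : ℝ} (hr : r ∉ Ioo α β) :
    angularMean W r = 0 := by
  simp [angularMean, h.zero r hr]

lemma contDiff_mean (h : IsPolar s α β W Wr Wφ) : ContDiff ℝ 1 (angularMean W) := by
  have h1 : deriv (angularMean W) = angularMean Wr := funext fun r => (h.deriv_mean r).deriv
  exact contDiff_one_iff_deriv.2 ⟨fun r => (h.deriv_mean r).differentiableAt,
    h1 ▸ h.continuous_mean_r⟩

lemma tsupport_mean (h : IsPolar s α β W Wr Wφ) : tsupport (angularMean W) ⊆ Icc α β := by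
  refine closure_minimal (fun r hr => ?_) isClosed_Icc
  by_contra hn
  exact hr (h.mean_eq_zero fun h' => hn (Ioo_subset_Icc_self h'))

lemma hasCompactSupport_mean (h : IsPolar s α β W Wr Wφ) : HasCompactSupport (angularMean W) :=
  isCompact_Icc.of_isClosed_subset (isClosed_tsupport _) h.tsupport_mean

lemma deriv_variance (h : IsPolar s α β W Wr Wφ) (r : ℝ) :
    HasDerivAt (fun r => (∫ φ in -π..π, W r φ ^ 2) - 2 * π * angularMean W r ^ 2)
      (2 * ((∫ φ in -π..π, W r φ * Wr r φ) - 2 * π * (angularMean W r * angularMean Wr r))) r :=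
  ((h.deriv_integral_sq r).fun_sub (((h.deriv_mean r).fun_pow 2).const_mul (2 * π))).of_eq
    (fun _ => rfl) (by push_cast; ring)

end IsPolar

lemma hasDerivAt_mul_logDeriv_mul {p dp N : ℝ → ℝ} {r Z M : ℝ}
    (hp : HasDerivAt p (dp r) r) (hdp : HasDerivAt (fun r => r * dp r) (r * Z) r)
    (hN : HasDerivAt N (2 * M) r) (hp0 : p r ≠ 0) :
    HasDerivAt (fun r => r * dp r / p r * N r)
      (r * (2 * (dp r / p r) * M + (Z / p r - (dp r / p r) ^ 2) * N r)) r := by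
  refine ((hdp.fun_div hp hp0).fun_mul hN).of_eq (fun _ => rfl) ?_
  field_simp
  ring

lemma integral_nonneg_of_flux {T T' G : ℝ → ℝ} {α β : ℝ} (hαβ : α ≤ β)
    (hT : ∀ r ∈ Icc α β, HasDerivAt T (T' r) r) (hα : T α = 0) (hβ : T β = 0)
    (hG : ContinuousOn G (Icc α β)) (hle : ∀ r ∈ Icc α β, T' r ≤ G r) :
    0 ≤ ∫ r in α..β, G r := by
  have := intervalIntegral.sub_le_integral_of_hasDeriv_right_of_le hαβ
    (fun r hr => (hT r hr).continuousAt.continuousWithinAt)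
    (fun r hr => (hT r (Ioo_subset_Icc_self hr)).hasDerivWithinAt)
    (hG.integrableOn_Icc) (fun r hr => hle r (Ioo_subset_Icc_self hr))
  rwa [hα, hβ, sub_self] at this

namespace Profile

variable {a b c y : ℝ} {R : ℝ≥0∞} {u v du dv : ℝ → ℝ}

lemma continuousOn_triple (H : Profile a b c y R u v du dv) {k α β s₀ α₀ β₀ : ℝ} (hα : 0 < α)
    (hβ : β ∈ Iset R) {W₀ W₁ W₂ X₀ X₁ X₂ Y₀ Y₁ Y₂ : ℝ → ℝ → ℝ}
    (h₀ : IsPolar s₀ α₀ β₀ W₀ X₀ Y₀) (h₁ : IsPolar s₀ α₀ β₀ W₁ X₁ Y₁)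
    (h₂ : IsPolar s₀ α₀ β₀ W₂ X₂ Y₂) :
    ContinuousOn (fun r => r * ∫ φ in -π..π, tripleForm k r (u r) (b + c * v r)
      (-a - 2 * b * v r + c * (u r ^ 2 + 3 * v r ^ 2))
      (-a + 2 * b * v r + c * (3 * u r ^ 2 + v r ^ 2))
      (-a + 2 * b * v r + c * (u r ^ 2 + v r ^ 2))
      (W₀ r φ) (W₁ r φ) (W₂ r φ) (X₀ r φ) (X₁ r φ) (X₂ r φ) (Y₀ r φ) (Y₁ r φ) (Y₂ r φ))
      (Icc α β) := by
  have hI : ∀ r ∈ Icc α β, r ∈ Iset R := fun r hr =>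
    Iset_of_le hβ (hα.trans_le hr.1) hr.2
  have cu : ContinuousOn u (Icc α β) := H.continuousOn_u.mono hI
  have cv : ContinuousOn v (Icc α β) := H.continuousOn_v.mono hI
  have cinv : ContinuousOn (fun r : ℝ => (r ^ 2)⁻¹) (Icc α β) :=
    ContinuousOn.inv₀ (by fun_prop) fun r hr => pow_ne_zero 2 (hI r hr).1.ne'
  have a0 := h₀.cont; have a1 := h₁.cont; have a2 := h₂.cont
  have b0 := h₀.cont_r; have b1 := h₁.cont_r; have b2 := h₂.cont_r
  have d0 := h₀.cont_φ; have d1 := h₁.cont_φ; have d2 := h₂.cont_φ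
  have s := fun {G : ℝ → ℝ → ℝ} => @continuous_slice G
  obtain ⟨K1, e1, k1⟩ := exists_angular_integral (G := fun r φ => X₀ r φ ^ 2) (by fun_prop)
  obtain ⟨K2, e2, k2⟩ := exists_angular_integral (G := fun r φ => X₁ r φ ^ 2) (by fun_prop)
  obtain ⟨K3, e3, k3⟩ := exists_angular_integral (G := fun r φ => X₂ r φ ^ 2) (by fun_prop)
  obtain ⟨K4, e4, k4⟩ := exists_angular_integral (G := fun r φ => Y₀ r φ ^ 2) (by fun_prop)
  obtain ⟨K5, e5, k5⟩ := exists_angular_integral (G := fun r φ => (Y₁ r φ - k * W₂ r φ) ^ 2)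
    (by fun_prop)
  obtain ⟨K6, e6, k6⟩ := exists_angular_integral (G := fun r φ => (Y₂ r φ + k * W₁ r φ) ^ 2)
    (by fun_prop)
  obtain ⟨K7, e7, k7⟩ := exists_angular_integral (G := fun r φ => W₀ r φ ^ 2) (by fun_prop)
  obtain ⟨K8, e8, k8⟩ := exists_angular_integral (G := fun r φ => W₁ r φ ^ 2) (by fun_prop)
  obtain ⟨K9, e9, k9⟩ := exists_angular_integral (G := fun r φ => W₂ r φ ^ 2) (by fun_prop)
  obtain ⟨K10, e10, k10⟩ := exists_angular_integral (G := fun r φ => W₀ r φ * W₁ r φ) (by fun_prop)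
  have he : ∀ r, (r * ∫ φ in -π..π, tripleForm k r (u r) (b + c * v r)
      (-a - 2 * b * v r + c * (u r ^ 2 + 3 * v r ^ 2))
      (-a + 2 * b * v r + c * (3 * u r ^ 2 + v r ^ 2))
      (-a + 2 * b * v r + c * (u r ^ 2 + v r ^ 2))
      (W₀ r φ) (W₁ r φ) (W₂ r φ) (X₀ r φ) (X₁ r φ) (X₂ r φ) (Y₀ r φ) (Y₁ r φ) (Y₂ r φ))
      = r * (K1 r + K2 r + K3 r + (K4 r + (K5 r + K6 r)) * (r ^ 2)⁻¹
        + (-a - 2 * b * v r + c * (u r ^ 2 + 3 * v r ^ 2)) * K7 r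
        + (-a + 2 * b * v r + c * (3 * u r ^ 2 + v r ^ 2)) * K8 r
        + (-a + 2 * b * v r + c * (u r ^ 2 + v r ^ 2)) * K9 r
        + 4 * u r * (b + c * v r) * K10 r) := by
    intro r
    rw [integral_tripleForm (s a0 r) (s a1 r) (s a2 r) (s b0 r) (s b1 r) (s b2 r) (s d0 r)
      (s d1 r) (s d2 r), div_eq_mul_inv, e1, e2, e3, e4, e5, e6, e7, e8, e9, e10]
  simp_rw [he]
  fun_prop

lemma triple_nonneg (H : Profile a b c y R u v du dv) (hR : 0 < R)
    (hstab : RadiallyStable a b c R u v) {k : ℝ} (hk : k ^ 2 = 1) {α β : ℝ} (hα : 0 < α)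
    (hαβ : α < β) (hβ : β ∈ Iset R) {W₀ W₁ W₂ X₀ X₁ X₂ Y₀ Y₁ Y₂ : ℝ → ℝ → ℝ}
    (h₀ : IsPolar 1 α β W₀ X₀ Y₀) (h₁ : IsPolar 1 α β W₁ X₁ Y₁) (h₂ : IsPolar 1 α β W₂ X₂ Y₂) :
    0 ≤ ∫ r in α..β, r * ∫ φ in -π..π, tripleForm k r (u r) (b + c * v r)
      (-a - 2 * b * v r + c * (u r ^ 2 + 3 * v r ^ 2))
      (-a + 2 * b * v r + c * (3 * u r ^ 2 + v r ^ 2))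
      (-a + 2 * b * v r + c * (u r ^ 2 + v r ^ 2))
      (W₀ r φ) (W₁ r φ) (W₂ r φ) (X₀ r φ) (X₁ r φ) (X₂ r φ) (Y₀ r φ) (Y₁ r φ) (Y₂ r φ) := by
  obtain ⟨hdu, q, dq, z, hq, hdq, -, hddq, -, hz, hqv⟩ := H.exists_weights hR hstab
  have hI : ∀ r ∈ Icc α β, r ∈ Iset R := fun r hr =>
    Iset_of_le hβ (hα.trans_le hr.1) hr.2
  have cu : ContinuousOn u (Icc α β) := H.continuousOn_u.mono hI
  have cv : ContinuousOn v (Icc α β) := H.continuousOn_v.mono hI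
  have cinv : ContinuousOn (fun r : ℝ => (r ^ 2)⁻¹) (Icc α β) :=
    ContinuousOn.inv₀ (by fun_prop) fun r hr => pow_ne_zero 2 (hI r hr).1.ne'
  set m₀ := angularMean W₀ with hm₀
  set m₁ := angularMean W₁ with hm₁
  set m₂ := angularMean W₂ with hm₂
  set n₀ := angularMean X₀ with hn₀
  set n₁ := angularMean X₁ with hn₁
  set n₂ := angularMean X₂ with hn₂
  set B : ℝ → ℝ := fun r => (n₁ r ^ 2 + 1 / r ^ 2 * m₁ r ^ 2 + n₀ r ^ 2
      + (-a + 2 * b * v r + c * (3 * u r ^ 2 + v r ^ 2)) * m₁ r ^ 2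
      + (-a - 2 * b * v r + c * (u r ^ 2 + 3 * v r ^ 2)) * m₀ r ^ 2
      + 4 * u r * m₁ r * m₀ r * (b + c * v r)) * r with hB
  set E : ℝ → ℝ := fun r => r * ∫ φ in -π..π, tripleForm k r (u r) (b + c * v r)
      (-a - 2 * b * v r + c * (u r ^ 2 + 3 * v r ^ 2))
      (-a + 2 * b * v r + c * (3 * u r ^ 2 + v r ^ 2))
      (-a + 2 * b * v r + c * (u r ^ 2 + v r ^ 2))
      (W₀ r φ) (W₁ r φ) (W₂ r φ) (X₀ r φ) (X₁ r φ) (X₂ r φ) (Y₀ r φ) (Y₁ r φ) (Y₂ r φ) with hE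
  have hBint : 0 ≤ ∫ r in α..β, B r := by
    have h := hstab m₁ m₀ h₁.contDiff_mean h₀.contDiff_mean h₁.hasCompactSupport_mean
      h₀.hasCompactSupport_mean (h₁.tsupport_mean.trans hI) (h₀.tsupport_mean.trans hI)
    have hd1 : ∀ r, deriv m₁ r = n₁ r := fun r => (h₁.deriv_mean r).deriv
    have hd0 : ∀ r, deriv m₀ r = n₀ r := fun r => (h₀.deriv_mean r).deriv
    rw [setIntegral_Iset_eq hα hαβ hβ] at h
    · simpa only [hd1, hd0] using h
    · intro r hr
      rw [deriv_eq_zero_of_notMem_Ioo h₁.contDiff_mean (fun r hr => h₁.mean_eq_zero hr) r hr,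
        deriv_eq_zero_of_notMem_Ioo h₀.contDiff_mean (fun r hr => h₀.mean_eq_zero hr) r hr,
        hm₁, hm₀, h₁.mean_eq_zero hr, h₀.mean_eq_zero hr]
      ring
  have cm₀ : Continuous m₀ := h₀.continuous_mean
  have cm₁ : Continuous m₁ := h₁.continuous_mean
  have cn₀ : Continuous n₀ := h₀.continuous_mean_r
  have cn₁ : Continuous n₁ := h₁.continuous_mean_r
  have cB : ContinuousOn B (Icc α β) := by
    simp only [hB, one_div]
    fun_prop
  have cE : ContinuousOn E (Icc α β) := H.continuousOn_triple hα hβ h₀ h₁ h₂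
  set ddu : ℝ → ℝ := fun r => u r * (-a + 2 * b * v r + c * (u r ^ 2 + v r ^ 2))
        + u r / r ^ 2 - du r / r with hddu
  set dg : ℝ → ℝ := fun r => du r / r - u r / r ^ 2 with hdg
  have hflux : 0 ≤ ∫ r in α..β, (E r - 2 * π * B r) := by
    refine integral_nonneg_of_flux hαβ.le
      (T := fun r => r * dq r / q r * ((∫ φ in -π..π, W₀ r φ ^ 2) - 2 * π * m₀ r ^ 2)
        + r * ddu r / du r * ((∫ φ in -π..π, W₁ r φ ^ 2) - 2 * π * m₁ r ^ 2)
        + r * dg r / (u r / r) * ((∫ φ in -π..π, W₂ r φ ^ 2) - 2 * π * m₂ r ^ 2)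
        + 2 * π * (r * du r / u r * m₂ r ^ 2))
      (fun r hr => ((((hasDerivAt_mul_logDeriv_mul (hdq r (hI r hr)) (hddq r (hI r hr))
          (h₀.deriv_variance r) (hq r (hI r hr)).ne').fun_add
        (hasDerivAt_mul_logDeriv_mul (H.deriv_du r (hI r hr)) (H.deriv_mul_ddu (hI r hr))
          (h₁.deriv_variance r) (hdu r (hI r hr)).ne')).fun_add
        (hasDerivAt_mul_logDeriv_mul (p := fun r => u r / r) (dp := dg)
          (Z := (u r * (-a + 2 * b * v r + c * (u r ^ 2 + v r ^ 2))
            + 2 * u r / r ^ 2 - 2 * du r / r) / r) ?_ ?_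
          (h₂.deriv_variance r) (div_pos (H.u_pos r (hI r hr)) (hI r hr).1).ne')).fun_add
        ((hasDerivAt_mul_logDeriv_mul (H.deriv_u r (hI r hr)) (H.deriv_mul_du (hI r hr))
          (M := m₂ r * n₂ r) (((h₂.deriv_mean r).fun_pow 2).of_eq (fun _ => rfl)
            (by push_cast; ring)) (H.u_pos r (hI r hr)).ne').const_mul (2 * π)))) ?_ ?_
      (cE.sub (cB.const_smul (2 * π))) fun r hr => ?_
    · have h0 := (hI r hr).1.ne'
      refine ((H.deriv_u r (hI r hr)).fun_div (hasDerivAt_id' r) h0).of_eq (fun _ => rfl) ?_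
      simp only [hdg]
      field_simp
    · have h0 := (hI r hr).1.ne'
      have e1 := (H.deriv_du r (hI r hr)).fun_sub
        ((H.deriv_u r (hI r hr)).fun_div (hasDerivAt_id' r) h0)
      have e2 : (fun s => s * dg s) =ᶠ[𝓝 r] fun s => du s - u s / s := by
        filter_upwards [eventually_ne_nhds h0] with s hs
        simp only [hdg]
        field_simp
      refine (e1.congr_of_eventuallyEq e2).of_eq (fun _ => rfl) ?_
      field_simp
      ring
    · have hn : α ∉ Ioo α β := fun h => lt_irrefl _ h.1
      simp only [h₀.integral_sq_eq_zero hn, h₁.integral_sq_eq_zero hn,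
        h₂.integral_sq_eq_zero hn, hm₀, hm₁, hm₂, h₀.mean_eq_zero hn, h₁.mean_eq_zero hn,
        h₂.mean_eq_zero hn]
      ring
    · have hn : β ∉ Ioo α β := fun h => lt_irrefl _ h.2
      simp only [h₀.integral_sq_eq_zero hn, h₁.integral_sq_eq_zero hn,
        h₂.integral_sq_eq_zero hn, hm₀, hm₁, hm₂, h₀.mean_eq_zero hn, h₁.mean_eq_zero hn,
        h₂.mean_eq_zero hn]
      ring
    · have hr' := hI r hr
      have hr0 := hr'.1
      have hu0 := H.u_pos r hr'
      have hp0 := hdu r hr'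
      have key := le_integral_tripleForm (h₀.angular r) (h₁.angular r) (h₂.angular r)
        (continuous_slice h₀.cont_r r) (continuous_slice h₁.cont_r r)
        (continuous_slice h₂.cont_r r) (integral_eq_angularMean W₀ r)
        (integral_eq_angularMean W₁ r) (integral_eq_angularMean W₂ r)
        (integral_eq_angularMean X₀ r) (integral_eq_angularMean X₁ r)
        (integral_eq_angularMean X₂ r) hk hr0 hu0 hp0 (hq r hr') (hz r hr')
        (A₁ := -a + 2 * b * v r + c * (3 * u r ^ 2 + v r ^ 2))
        (A₂ := -a + 2 * b * v r + c * (u r ^ 2 + v r ^ 2))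
        (dq r / q r) (ddu r / du r) (dg r / (u r / r)) (du r / u r)
      have key' := mul_le_mul_of_nonneg_left key hr0.le
      have z1 : ((2 / r ^ 2 + (-a + 2 * b * v r + c * (3 * u r ^ 2 + v r ^ 2))) * du r
          - 2 * u r / r ^ 3 + 2 * u r * (b + c * v r) * dv r) / du r
          = 2 / r ^ 2 + (-a + 2 * b * v r + c * (3 * u r ^ 2 + v r ^ 2))
            - 2 * u r / (r ^ 3 * du r) - 2 * u r * |b + c * v r| * q r / du r := by
        rw [hqv r hr']
        field_simp
        ring
      have z2 : (u r * (-a + 2 * b * v r + c * (u r ^ 2 + v r ^ 2))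
            + 2 * u r / r ^ 2 - 2 * du r / r) / r / (u r / r)
          = 2 / r ^ 2 + (-a + 2 * b * v r + c * (u r ^ 2 + v r ^ 2)) - 2 * du r / (r * u r) := by
        field_simp
        ring
      have z3 : (u r * (-a + 2 * b * v r + c * (u r ^ 2 + v r ^ 2)) + u r / r ^ 2) / u r
          = 1 / r ^ 2 + (-a + 2 * b * v r + c * (u r ^ 2 + v r ^ 2)) := by
        field_simp
        ring
      rw [z1, z2, z3]
      simp only [hE, hB]
      linarith
  have hi : ∀ {f : ℝ → ℝ}, ContinuousOn f (Icc α β) → IntervalIntegrable f volume α β :=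
    fun hf => by rw [← uIcc_of_le hαβ.le] at hf; exact hf.intervalIntegrable
  rw [intervalIntegral.integral_sub (hi cE) ((hi cB).const_mul _),
    intervalIntegral.integral_const_mul] at hflux
  have := mul_nonneg (by have := pi_pos; positivity : 0 ≤ 2 * π) hBint
  linarith

lemma continuousOn_pair (H : Profile a b c y R u v du dv) {h α β s₀ α₀ β₀ : ℝ} (hα : 0 < α)
    (hβ : β ∈ Iset R) {W₁ W₂ X₁ X₂ Y₁ Y₂ : ℝ → ℝ → ℝ}
    (h₁ : IsPolar s₀ α₀ β₀ W₁ X₁ Y₁) (h₂ : IsPolar s₀ α₀ β₀ W₂ X₂ Y₂) :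
    ContinuousOn (fun r => r * ∫ φ in -π..π, pairForm h r
      (-a - b * v r - √3 * b * u r + c * (u r ^ 2 + v r ^ 2))
      (-a - b * v r + √3 * b * u r + c * (u r ^ 2 + v r ^ 2))
      (W₁ r φ) (W₂ r φ) (X₁ r φ) (X₂ r φ) (Y₁ r φ) (Y₂ r φ)) (Icc α β) := by
  have hI : ∀ r ∈ Icc α β, r ∈ Iset R := fun r hr =>
    Iset_of_le hβ (hα.trans_le hr.1) hr.2
  have cu : ContinuousOn u (Icc α β) := H.continuousOn_u.mono hI
  have cv : ContinuousOn v (Icc α β) := H.continuousOn_v.mono hI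
  have cinv : ContinuousOn (fun r : ℝ => (r ^ 2)⁻¹) (Icc α β) :=
    ContinuousOn.inv₀ (by fun_prop) fun r hr => pow_ne_zero 2 (hI r hr).1.ne'
  have a1 := h₁.cont; have a2 := h₂.cont
  have b1 := h₁.cont_r; have b2 := h₂.cont_r
  have d1 := h₁.cont_φ; have d2 := h₂.cont_φ
  have s := fun {G : ℝ → ℝ → ℝ} => @continuous_slice G
  obtain ⟨K2, e2, k2⟩ := exists_angular_integral (G := fun r φ => X₁ r φ ^ 2) (by fun_prop)
  obtain ⟨K3, e3, k3⟩ := exists_angular_integral (G := fun r φ => X₂ r φ ^ 2) (by fun_prop)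
  obtain ⟨K5, e5, k5⟩ := exists_angular_integral
    (G := fun r φ => ((Y₁ r φ - h * W₂ r φ) ^ 2 + (Y₂ r φ + h * W₁ r φ) ^ 2)) (by fun_prop)
  obtain ⟨K8, e8, k8⟩ := exists_angular_integral (G := fun r φ => W₁ r φ ^ 2) (by fun_prop)
  obtain ⟨K9, e9, k9⟩ := exists_angular_integral (G := fun r φ => W₂ r φ ^ 2) (by fun_prop)
  simp_rw [fun r => integral_pairForm (s a1 r) (s a2 r) (s b1 r) (s b2 r) (s d1 r) (s d2 r),
    div_eq_mul_inv, e2, e3, e5, e8, e9]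
  fun_prop

lemma pair_nonneg (H : Profile a b c y R u v du dv) (hR : 0 < R)
    {h : ℝ} (hh : h ^ 2 = (1 / 2) ^ 2) {α β : ℝ} (hα : 0 < α)
    (hαβ : α < β) (hβ : β ∈ Iset R) {W₁ W₂ X₁ X₂ Y₁ Y₂ : ℝ → ℝ → ℝ}
    (h₁ : IsPolar (-1) α β W₁ X₁ Y₁) (h₂ : IsPolar (-1) α β W₂ X₂ Y₂) :
    0 ≤ ∫ r in α..β, r * ∫ φ in -π..π, pairForm h r
      (-a - b * v r - √3 * b * u r + c * (u r ^ 2 + v r ^ 2))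
      (-a - b * v r + √3 * b * u r + c * (u r ^ 2 + v r ^ 2))
      (W₁ r φ) (W₂ r φ) (X₁ r φ) (X₂ r φ) (Y₁ r φ) (Y₂ r φ) := by
  have hI : ∀ r ∈ Icc α β, r ∈ Iset R := fun r hr =>
    Iset_of_le hβ (hα.trans_le hr.1) hr.2
  have h3 : √3 ^ 2 = 3 := Real.sq_sqrt (by norm_num)
  have hF : ∀ r ∈ Icc α β, 0 < u r - √3 * v r := fun r hr => by
    have h1 := H.u_pos r (hI r hr)
    have h2 := mul_nonneg (Real.sqrt_nonneg 3) (neg_nonneg.2 (H.v_neg r (hI r hr)).le)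
    linarith
  have hG : ∀ r ∈ Icc α β, 0 < -(√3 * v r) - u r := fun r hr => by
    have h1 := H.u_lt hR r (hI r hr)
    linarith
  refine integral_nonneg_of_flux hαβ.le
      (T := fun r => r * (du r - √3 * dv r) / (u r - √3 * v r) * (∫ φ in -π..π, W₁ r φ ^ 2)
        + r * (-(√3 * dv r) - du r) / (-(√3 * v r) - u r) * (∫ φ in -π..π, W₂ r φ ^ 2))
      (fun r hr => (hasDerivAt_mul_logDeriv_mul (p := fun r => u r - √3 * v r)
          (dp := fun r => du r - √3 * dv r)
          (Z := (u r * (-a + 2 * b * v r + c * (u r ^ 2 + v r ^ 2)) + u r / r ^ 2)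
            - √3 * (v r * (-a - b * v r + c * (u r ^ 2 + v r ^ 2)) + b * u r ^ 2))
          ((H.deriv_u r (hI r hr)).fun_sub ((H.deriv_v r (hI r hr)).const_mul _)) ?_
          (h₁.deriv_integral_sq r) (hF r hr).ne').fun_add
        (hasDerivAt_mul_logDeriv_mul (p := fun r => -(√3 * v r) - u r)
          (dp := fun r => -(√3 * dv r) - du r)
          (Z := -(√3 * (v r * (-a - b * v r + c * (u r ^ 2 + v r ^ 2)) + b * u r ^ 2))
            - (u r * (-a + 2 * b * v r + c * (u r ^ 2 + v r ^ 2)) + u r / r ^ 2))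
          (((H.deriv_v r (hI r hr)).const_mul _).fun_neg.fun_sub (H.deriv_u r (hI r hr))) ?_
          (h₂.deriv_integral_sq r) (hG r hr).ne')) ?_ ?_ ?_ fun r hr => ?_
  · exact ((H.deriv_mul_du (hI r hr)).fun_sub ((H.deriv_mul_dv (hI r hr)).const_mul √3)).of_eq
      (fun s => by ring) (by ring)
  · exact (((H.deriv_mul_dv (hI r hr)).const_mul √3).fun_neg.fun_sub
      (H.deriv_mul_du (hI r hr))).of_eq (fun s => by ring) (by ring)
  · have hn : α ∉ Ioo α β := fun h => lt_irrefl _ h.1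
    simp only [h₁.integral_sq_eq_zero hn, h₂.integral_sq_eq_zero hn]
    ring
  · have hn : β ∉ Ioo α β := fun h => lt_irrefl _ h.2
    simp only [h₁.integral_sq_eq_zero hn, h₂.integral_sq_eq_zero hn]
    ring
  · exact H.continuousOn_pair hα hβ h₁ h₂
  · have hr' := hI r hr
    have hr0 := hr'.1
    have key := mul_le_mul_of_nonneg_left (le_integral_pairForm (h₁.angular r) (h₂.angular r)
      (continuous_slice h₁.cont_r r) (continuous_slice h₂.cont_r r) hh (hF r hr) (hG r hr)
      (V₁ := -a - b * v r - √3 * b * u r + c * (u r ^ 2 + v r ^ 2))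
      (V₂ := -a - b * v r + √3 * b * u r + c * (u r ^ 2 + v r ^ 2)) (r := r)
      ((du r - √3 * dv r) / (u r - √3 * v r)) ((-(√3 * dv r) - du r) / (-(√3 * v r) - u r))) hr0.le
    refine le_trans (le_of_eq ?_) key
    have hF' := (hF r hr).ne'
    have hG' := (hG r hr).ne'
    have z1 : ((u r * (-a + 2 * b * v r + c * (u r ^ 2 + v r ^ 2)) + u r / r ^ 2)
            - √3 * (v r * (-a - b * v r + c * (u r ^ 2 + v r ^ 2)) + b * u r ^ 2))
          / (u r - √3 * v r)
        = (-a - b * v r - √3 * b * u r + c * (u r ^ 2 + v r ^ 2))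
          + (u r - √3 * v r - (-(√3 * v r) - u r)) / (2 * r ^ 2 * (u r - √3 * v r)) := by
      rw [div_eq_iff hF', add_mul, div_mul_eq_mul_div, mul_div_mul_right _ _ hF']
      field_simp
      ring_nf
      rw [h3]
      ring
    have z2 : (-(√3 * (v r * (-a - b * v r + c * (u r ^ 2 + v r ^ 2)) + b * u r ^ 2))
            - (u r * (-a + 2 * b * v r + c * (u r ^ 2 + v r ^ 2)) + u r / r ^ 2))
          / (-(√3 * v r) - u r)
        = (-a - b * v r + √3 * b * u r + c * (u r ^ 2 + v r ^ 2))
          + (-(√3 * v r) - u r - (u r - √3 * v r)) / (2 * r ^ 2 * (-(√3 * v r) - u r)) := by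
      rw [div_eq_iff hG', add_mul, div_mul_eq_mul_div, mul_div_mul_right _ _ hG']
      field_simp
      ring_nf
      rw [h3]
      ring
    rw [z1, z2]
    ring

end Profile

/-- A `C¹` function in polar coordinates, vanishing for `r ≥ β`. -/
structure IsPolarDisk (s β : ℝ) (W Wr Wφ : ℝ → ℝ → ℝ) : Prop where
  cont : Continuous fun z : ℝ × ℝ => W z.1 z.2
  cont_r : Continuous fun z : ℝ × ℝ => Wr z.1 z.2
  cont_φ : Continuous fun z : ℝ × ℝ => Wφ z.1 z.2
  deriv_r : ∀ r φ, HasDerivAt (fun r => W r φ) (Wr r φ) r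
  deriv_φ : ∀ r φ, HasDerivAt (W r) (Wφ r φ) φ
  per : ∀ r φ, W r (φ + 2 * π) = s * W r φ
  zero : ∀ r, β ≤ r → ∀ φ, W r φ = 0

namespace IsPolarDisk

variable {s β : ℝ} {W Wr Wφ : ℝ → ℝ → ℝ}

lemma zero_r (h : IsPolarDisk s β W Wr Wφ) {r : ℝ} (hr : β ≤ r) (φ : ℝ) : Wr r φ = 0 := by
  have h1 : HasDerivWithinAt (fun r => W r φ) 0 (Ici r) r :=
    (hasDerivWithinAt_const r (Ici r) (0 : ℝ)).congr (fun t ht => h.zero t (hr.trans ht) φ)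
      (h.zero r hr φ)
  exact (uniqueDiffOn_Ici r r self_mem_Ici).eq_deriv _ (h.deriv_r r φ).hasDerivWithinAt h1

lemma zero_φ (h : IsPolarDisk s β W Wr Wφ) {r : ℝ} (hr : β ≤ r) (φ : ℝ) : Wφ r φ = 0 :=
  (h.deriv_φ r φ).unique ((hasDerivAt_const φ (0 : ℝ)).of_eq (fun t => h.zero r hr t) rfl)

lemma mul_cutoff (h : IsPolarDisk s β W Wr Wφ) {χ : ℝ → ℝ} (hχ : ContDiff ℝ 1 χ) {α : ℝ}
    (hα : ∀ r ≤ α, χ r = 0) :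
    IsPolar s α β (fun r φ => χ r * W r φ) (fun r φ => deriv χ r * W r φ + χ r * Wr r φ)
      (fun r φ => χ r * Wφ r φ) := by
  have h1 := h.cont
  have h2 := h.cont_r
  have h3 := h.cont_φ
  have h4 := hχ.continuous
  have h5 : Continuous (deriv χ) := hχ.continuous_deriv_one
  refine ⟨by fun_prop, by fun_prop, by fun_prop, fun r φ => ?_,
    fun r φ => (h.deriv_φ r φ).const_mul _, fun r φ => by rw [h.per]; ring, fun r hr φ => ?_⟩
  · exact ((hχ.differentiable_one r).hasDerivAt).fun_mul (h.deriv_r r φ)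
  · rcases le_or_gt r α with hr' | hr'
    · rw [hα r hr', zero_mul]
    · rw [h.zero r (not_lt.1 fun h' => hr ⟨hr', h'⟩), mul_zero]

end IsPolarDisk

lemma tripleForm_mul_cutoff (k r U κ A₀ A₁ A₂ f₀ f₁ f₂ g₀ g₁ g₂ d₀ d₁ d₂ x x' : ℝ) :
    tripleForm k r U κ A₀ A₁ A₂ (x * f₀) (x * f₁) (x * f₂) (x' * f₀ + x * g₀) (x' * f₁ + x * g₁)
      (x' * f₂ + x * g₂) (x * d₀) (x * d₁) (x * d₂)
    = x ^ 2 * tripleForm k r U κ A₀ A₁ A₂ f₀ f₁ f₂ g₀ g₁ g₂ d₀ d₁ d₂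
      + x' ^ 2 * (f₀ ^ 2 + f₁ ^ 2 + f₂ ^ 2) + 2 * x * x' * (f₀ * g₀ + f₁ * g₁ + f₂ * g₂) := by
  unfold tripleForm
  ring

lemma pairForm_mul_cutoff (h r V₁ V₂ f₁ f₂ g₁ g₂ d₁ d₂ x x' : ℝ) :
    pairForm h r V₁ V₂ (x * f₁) (x * f₂) (x' * f₁ + x * g₁) (x' * f₂ + x * g₂) (x * d₁) (x * d₂)
    = x ^ 2 * pairForm h r V₁ V₂ f₁ f₂ g₁ g₂ d₁ d₂
      + x' ^ 2 * (f₁ ^ 2 + f₂ ^ 2) + 2 * x * x' * (f₁ * g₁ + f₂ * g₂) := by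
  unfold pairForm
  ring

lemma integral_cutoff_combination {F S M : ℝ → ℝ} (hF : Continuous F) (hS : Continuous S)
    (hM : Continuous M) (x x' : ℝ) :
    ∫ φ in -π..π, (x ^ 2 * F φ + x' ^ 2 * S φ + 2 * x * x' * M φ)
      = x ^ 2 * (∫ φ in -π..π, F φ) + x' ^ 2 * (∫ φ in -π..π, S φ)
        + 2 * x * x' * ∫ φ in -π..π, M φ := by
  have hi : ∀ {F : ℝ → ℝ} (_ : Continuous F), IntervalIntegrable F volume (-π) π :=
    fun h => h.intervalIntegrable _ _
  rw [intervalIntegral.integral_add (hi (by fun_prop)) (hi (by fun_prop)),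
    intervalIntegral.integral_add (hi (by fun_prop)) (hi (by fun_prop)),
    intervalIntegral.integral_const_mul, intervalIntegral.integral_const_mul,
    intervalIntegral.integral_const_mul]

/-- Removal of a logarithmic cutoff at the origin. -/
lemma integral_nonneg_of_log_cutoff {J S M : ℝ → ℝ} {β : ℝ} (hβ : 0 < β)
    (hJ : IntegrableOn J (Ioi 0)) (hJ0 : ∀ r, β ≤ r → J r = 0) (hS : Continuous S)
    (hM : Continuous M)
    (hcut : ∀ (χ : ℝ → ℝ) (α : ℝ), 0 < α → α < β → ContDiff ℝ 1 χ → (∀ r ≤ α, χ r = 0) →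
      0 ≤ ∫ r in α..β, (χ r ^ 2 * J r
        + r * (deriv χ r ^ 2 * S r + 2 * χ r * deriv χ r * M r))) :
    0 ≤ ∫ r in Ioi 0, J r := by
  obtain ⟨C, hC, hl⟩ := exists_log_cutoff
  choose! l hl using hl
  obtain ⟨K₁, hK₁⟩ := (isCompact_Icc (a := 0) (b := β)).exists_bound_of_continuousOn
    hS.continuousOn
  obtain ⟨K₂, hK₂⟩ := (isCompact_Icc (a := 0) (b := β)).exists_bound_of_continuousOn
    hM.continuousOn
  have hKa : 0 ≤ K₁ := (norm_nonneg _).trans (hK₁ 0 ⟨le_rfl, hβ.le⟩)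
  have hKb : 0 ≤ K₂ := (norm_nonneg _).trans (hK₂ 0 ⟨le_rfl, hβ.le⟩)
  have hlow : ∀ n : ℝ, 0 < n → exp (-(2 * n)) < β →
      -(K₁ * C ^ 2 * (log β * (1 / n) ^ 2 + 2 * (1 / n)) + 2 * C * K₂ * β * (1 / n))
        ≤ ∫ r in Ioi 0, l n r ^ 2 * J r := by
    intro n hn hnβ
    obtain ⟨h1, h2, h3, h4, h5⟩ := hl n hn
    have h1' : ContDiff ℝ 1 (l n) := h1.of_le (by exact_mod_cast le_top)
    have hα := exp_pos (-(2 * n))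
    set α := exp (-(2 * n)) with hαdef
    have hc := hcut (l n) α hα hnβ h1' h3
    have hcont := h1'.continuous
    have hcont' : Continuous (deriv (l n)) := h1'.continuous_deriv_one
    have hint : IntegrableOn (fun r => l n r ^ 2 * J r) (Ioi 0) := by
      refine hJ.bdd_mul (c := 1) (by fun_prop) (Eventually.of_forall fun r => ?_)
      rw [Real.norm_eq_abs, abs_of_nonneg (sq_nonneg _)]
      exact pow_le_one₀ (h2 r).1 (h2 r).2
    have hsub : Ioc α β ⊆ Ioi 0 := fun r hr => hα.trans hr.1
    have hint' : IntervalIntegrable (fun r => l n r ^ 2 * J r) volume α β :=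
      (intervalIntegrable_iff_integrableOn_Ioc_of_le hnβ.le).2 (hint.mono_set hsub)
    have herr : IntervalIntegrable
        (fun r => r * (deriv (l n) r ^ 2 * S r + 2 * l n r * deriv (l n) r * M r)) volume α β :=
      Continuous.intervalIntegrable (by fun_prop) _ _
    rw [intervalIntegral.integral_add hint' herr] at hc
    have hinv : IntervalIntegrable (fun r : ℝ => r⁻¹) volume α β :=
      intervalIntegral.intervalIntegrable_inv
        (fun r hr => by rw [uIcc_of_le hnβ.le] at hr; exact (hα.trans_le hr.1).ne')
        continuousOn_id
    have hbd : ∫ r in α..β, r * (deriv (l n) r ^ 2 * S r + 2 * l n r * deriv (l n) r * M r)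
        ≤ ∫ r in α..β, (K₁ * C ^ 2 * (1 / n) ^ 2 * r⁻¹ + 2 * C * K₂ * (1 / n)) := by
      refine intervalIntegral.integral_mono_on hnβ.le herr
        ((hinv.const_mul _).add (by simp)) fun r hr => ?_
      have hr0 := hα.trans_le hr.1
      have hd := h5 r hr0
      have hs := (le_abs_self (S r)).trans (hK₁ r ⟨hr0.le, hr.2⟩)
      have hm : |M r| ≤ K₂ := hK₂ r ⟨hr0.le, hr.2⟩
      have hd2 : deriv (l n) r ^ 2 ≤ (C / (n * r)) ^ 2 := by
        rw [← sq_abs]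
        exact pow_le_pow_left₀ (abs_nonneg _) hd 2
      have e1 : deriv (l n) r ^ 2 * S r ≤ (C / (n * r)) ^ 2 * K₁ :=
        (mul_le_mul_of_nonneg_left hs (sq_nonneg _)).trans (mul_le_mul_of_nonneg_right hd2 hKa)
      have e2 : l n r * (deriv (l n) r * M r) ≤ 1 * (C / (n * r) * K₂) := by
        refine (le_abs_self _).trans ?_
        rw [abs_mul, abs_mul, abs_of_nonneg (h2 r).1]
        exact mul_le_mul (h2 r).2 (mul_le_mul hd hm (abs_nonneg _) ((abs_nonneg _).trans hd))
          (by positivity) one_pos.le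
      have e3 := mul_le_mul_of_nonneg_left (add_le_add e1 (mul_le_mul_of_nonneg_left e2
        (zero_le_two (α := ℝ)))) hr0.le
      refine (le_of_eq ?_).trans (e3.trans (le_of_eq ?_))
      · ring
      · field_simp
    rw [intervalIntegral.integral_add (hinv.const_mul _) (by simp),
      intervalIntegral.integral_const_mul, intervalIntegral.integral_const,
      integral_inv_of_pos hα hβ, log_div hβ.ne' hα.ne', hαdef, log_exp, smul_eq_mul] at hbd
    have hset : ∫ r in α..β, l n r ^ 2 * J r = ∫ r in Ioi 0, l n r ^ 2 * J r := by
      rw [intervalIntegral.integral_of_le hnβ.le]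
      refine (setIntegral_eq_of_subset_of_forall_sdiff_eq_zero measurableSet_Ioi hsub
        fun r hr => ?_).symm
      rcases le_or_gt r α with h | h
      · rw [h3 r h]
        ring
      · rw [hJ0 r (not_lt.1 fun h' => hr.2 ⟨h, h'.le⟩), mul_zero]
    rw [← hset]
    have h6 : K₁ * C ^ 2 * (1 / n) ^ 2 * (log β - -(2 * n))
        = K₁ * C ^ 2 * (log β * (1 / n) ^ 2 + 2 * (1 / n)) := by
      field_simp
      ring
    have h7 : 0 ≤ exp (-(2 * n)) * (2 * C * K₂ * (1 / n)) := by positivity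
    rw [h6] at hbd
    linarith
  have hinv : Tendsto (fun n : ℝ => 1 / n) atTop (𝓝 0) := by
    simpa only [one_div] using tendsto_inv_atTop_zero
  have hl0 : Tendsto (fun n : ℝ => -(K₁ * C ^ 2 * (log β * (1 / n) ^ 2 + 2 * (1 / n))
      + 2 * C * K₂ * β * (1 / n))) atTop (𝓝 0) := by
    have h := (Continuous.tendsto (by fun_prop : Continuous fun x : ℝ =>
      -(K₁ * C ^ 2 * (log β * x ^ 2 + 2 * x) + 2 * C * K₂ * β * x)) 0).comp hinv
    simpa [Function.comp_def] using h
  have hlim : Tendsto (fun n : ℝ => ∫ r in Ioi 0, l n r ^ 2 * J r) atTop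
      (𝓝 (∫ r in Ioi 0, J r)) := by
    refine tendsto_integral_filter_of_dominated_convergence (fun r => |J r|) ?_ ?_ hJ.abs ?_
    · filter_upwards [eventually_gt_atTop 0] with n hn
      exact ((hl n hn).1.continuous.pow 2).aestronglyMeasurable.mul hJ.1
    · filter_upwards [eventually_gt_atTop 0] with n hn
      refine Eventually.of_forall fun r => ?_
      rw [Real.norm_eq_abs, abs_mul, abs_of_nonneg (sq_nonneg (l n r))]
      exact mul_le_of_le_one_left (abs_nonneg _)
        (pow_le_one₀ ((hl n hn).2.1 r).1 ((hl n hn).2.1 r).2)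
    · refine (ae_restrict_iff' measurableSet_Ioi).2 (Eventually.of_forall fun r hr => ?_)
      refine tendsto_const_nhds.congr' ?_
      filter_upwards [eventually_gt_atTop 0, eventually_ge_atTop (-log r)] with n hn hnr
      have h1 : exp (-n) ≤ r := by
        rw [← exp_log (mem_Ioi.1 hr)]
        exact exp_le_exp.2 (by linarith)
      rw [(hl n hn).2.2.2.1 r h1]
      ring
  refine le_of_tendsto_of_tendsto hl0 hlim ?_
  filter_upwards [eventually_gt_atTop 0, eventually_gt_atTop (-log β / 2)] with n hn hnβ
  refine hlow n hn ?_
  rw [← exp_log hβ]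
  exact exp_lt_exp.2 (by linarith)

namespace Profile

variable {a b c y : ℝ} {R : ℝ≥0∞} {u v du dv : ℝ → ℝ}

lemma integral_polar_nonneg (H : Profile a b c y R u v du dv) (hR : 0 < R)
    (hstab : RadiallyStable a b c R u v) {k : ℝ} (hk : k ^ 2 = 1) {β : ℝ} (hβ : β ∈ Iset R)
    {W₀ W₁ W₂ W₃ W₄ X₀ X₁ X₂ X₃ X₄ Y₀ Y₁ Y₂ Y₃ Y₄ : ℝ → ℝ → ℝ}
    (h₀ : IsPolarDisk 1 β W₀ X₀ Y₀) (h₁ : IsPolarDisk 1 β W₁ X₁ Y₁)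
    (h₂ : IsPolarDisk 1 β W₂ X₂ Y₂) (h₃ : IsPolarDisk (-1) β W₃ X₃ Y₃)
    (h₄ : IsPolarDisk (-1) β W₄ X₄ Y₄) {J : ℝ → ℝ} (hJ : IntegrableOn J (Ioi 0))
    (hJ0 : ∀ r, β ≤ r → J r = 0)
    (hJe : ∀ r ∈ Ioo 0 β, J r = r * ∫ φ in -π..π, (tripleForm k r (u r) (b + c * v r)
      (-a - 2 * b * v r + c * (u r ^ 2 + 3 * v r ^ 2))
      (-a + 2 * b * v r + c * (3 * u r ^ 2 + v r ^ 2))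
      (-a + 2 * b * v r + c * (u r ^ 2 + v r ^ 2))
      (W₀ r φ) (W₁ r φ) (W₂ r φ) (X₀ r φ) (X₁ r φ) (X₂ r φ) (Y₀ r φ) (Y₁ r φ) (Y₂ r φ)
      + pairForm (k / 2) r (-a - b * v r - √3 * b * u r + c * (u r ^ 2 + v r ^ 2))
      (-a - b * v r + √3 * b * u r + c * (u r ^ 2 + v r ^ 2))
      (W₃ r φ) (W₄ r φ) (X₃ r φ) (X₄ r φ) (Y₃ r φ) (Y₄ r φ))) :
    0 ≤ ∫ r in Ioi 0, J r := by
  have a0 := h₀.cont; have a1 := h₁.cont; have a2 := h₂.cont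
  have a3 := h₃.cont; have a4 := h₄.cont
  have b0 := h₀.cont_r; have b1 := h₁.cont_r; have b2 := h₂.cont_r
  have b3 := h₃.cont_r; have b4 := h₄.cont_r
  have d0 := h₀.cont_φ; have d1 := h₁.cont_φ; have d2 := h₂.cont_φ
  have d3 := h₃.cont_φ; have d4 := h₄.cont_φ
  refine integral_nonneg_of_log_cutoff (S := fun r => ∫ φ in -π..π,
      ((W₀ r φ ^ 2 + W₁ r φ ^ 2 + W₂ r φ ^ 2) + (W₃ r φ ^ 2 + W₄ r φ ^ 2)))
    (M := fun r => ∫ φ in -π..π, ((W₀ r φ * X₀ r φ + W₁ r φ * X₁ r φ + W₂ r φ * X₂ r φ)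
      + (W₃ r φ * X₃ r φ + W₄ r φ * X₄ r φ))) hβ.1 hJ hJ0
    (continuous_angular_integral (by fun_prop)) (continuous_angular_integral (by fun_prop))
    fun χ α hα hαβ hχ hχ0 => ?_
  have t := H.triple_nonneg hR hstab hk hα hαβ hβ (h₀.mul_cutoff hχ hχ0) (h₁.mul_cutoff hχ hχ0)
    (h₂.mul_cutoff hχ hχ0)
  have t' := H.continuousOn_triple (k := k) hα hβ (h₀.mul_cutoff hχ hχ0)
    (h₁.mul_cutoff hχ hχ0) (h₂.mul_cutoff hχ hχ0)
  have p := H.pair_nonneg hR (h := k / 2) (by rw [div_pow, div_pow, hk, one_pow]) hα hαβ hβ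
    (h₃.mul_cutoff hχ hχ0) (h₄.mul_cutoff hχ hχ0)
  have p' := H.continuousOn_pair (h := k / 2) hα hβ (h₃.mul_cutoff hχ hχ0)
    (h₄.mul_cutoff hχ hχ0)
  have hi : ∀ {f : ℝ → ℝ}, ContinuousOn f (Icc α β) → IntervalIntegrable f volume α β :=
    fun hf => by rw [← uIcc_of_le hαβ.le] at hf; exact hf.intervalIntegrable
  refine (add_nonneg t p).trans (le_of_eq ?_)
  rw [← intervalIntegral.integral_add (hi t') (hi p'), intervalIntegral.integral_of_le hαβ.le,
    intervalIntegral.integral_of_le hαβ.le, integral_Ioc_eq_integral_Ioo,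
    integral_Ioc_eq_integral_Ioo]
  refine setIntegral_congr_fun measurableSet_Ioo fun r hr => ?_
  have hr0 := hα.trans hr.1
  have s := fun {G : ℝ → ℝ → ℝ} => @continuous_slice G
  have a0 := s a0 r; have a1 := s a1 r; have a2 := s a2 r; have a3 := s a3 r; have a4 := s a4 r
  have b0 := s b0 r; have b1 := s b1 r; have b2 := s b2 r; have b3 := s b3 r; have b4 := s b4 r
  have d0 := s d0 r; have d1 := s d1 r; have d2 := s d2 r; have d3 := s d3 r; have d4 := s d4 r
  simp only [tripleForm_mul_cutoff, pairForm_mul_cutoff]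
  rw [hJe r ⟨hr0, hr.2⟩]
  have ct : ∀ κ U A₀ A₁ A₂ : ℝ, Continuous fun φ => tripleForm k r U κ A₀ A₁ A₂
      (W₀ r φ) (W₁ r φ) (W₂ r φ) (X₀ r φ) (X₁ r φ) (X₂ r φ) (Y₀ r φ) (Y₁ r φ) (Y₂ r φ) := by
    intro κ U A₀ A₁ A₂
    simp only [tripleForm, div_eq_mul_inv]
    fun_prop
  have cp : ∀ V₁ V₂ : ℝ, Continuous fun φ => pairForm (k / 2) r V₁ V₂
      (W₃ r φ) (W₄ r φ) (X₃ r φ) (X₄ r φ) (Y₃ r φ) (Y₄ r φ) := by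
    intro V₁ V₂
    simp only [pairForm, div_eq_mul_inv]
    fun_prop
  have hi' : ∀ {F : ℝ → ℝ} (_ : Continuous F), IntervalIntegrable F volume (-π) π :=
    fun h => h.intervalIntegrable _ _
  rw [integral_cutoff_combination (ct _ _ _ _ _) (by fun_prop) (by fun_prop),
    integral_cutoff_combination (cp _ _) (by fun_prop) (by fun_prop),
    intervalIntegral.integral_add (hi' (ct _ _ _ _ _)) (hi' (cp _ _)),
    intervalIntegral.integral_add (hi' (by fun_prop : Continuous fun φ =>
      W₀ r φ ^ 2 + W₁ r φ ^ 2 + W₂ r φ ^ 2)) (hi' (by fun_prop)),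
    intervalIntegral.integral_add (hi' (by fun_prop : Continuous fun φ =>
      W₀ r φ * X₀ r φ + W₁ r φ * X₁ r φ + W₂ r φ * X₂ r φ)) (hi' (by fun_prop))]
  ring

end Profile

/-- The point of the plane with polar coordinates `(r, φ)`. -/
def polarPoint (r φ : ℝ) : EuclideanSpace ℝ (Fin 2) :=
  (r * cos φ) • EuclideanSpace.single 0 1 + (r * sin φ) • EuclideanSpace.single 1 1

lemma polarPoint_zero (r φ : ℝ) : polarPoint r φ 0 = r * cos φ := by
  simp [polarPoint]

lemma polarPoint_one (r φ : ℝ) : polarPoint r φ 1 = r * sin φ := by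
  simp [polarPoint]

lemma norm_polarPoint (r φ : ℝ) : ‖polarPoint r φ‖ = |r| := by
  rw [EuclideanSpace.norm_eq, Fin.sum_univ_two, polarPoint_zero, polarPoint_one,
    Real.norm_eq_abs, Real.norm_eq_abs, sq_abs, sq_abs, ← Real.sqrt_sq_eq_abs]
  congr 1
  linear_combination r ^ 2 * cos_sq_add_sin_sq φ

lemma continuous_polarPoint : Continuous fun z : ℝ × ℝ => polarPoint z.1 z.2 := by
  unfold polarPoint
  fun_prop

/-- The directional derivative of `f` along the unit vector with angle `φ`. -/
def radialDeriv (f : EuclideanSpace ℝ (Fin 2) → ℝ) (r φ : ℝ) : ℝ :=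
  fderiv ℝ f (polarPoint r φ) (EuclideanSpace.single 0 1) * cos φ
    + fderiv ℝ f (polarPoint r φ) (EuclideanSpace.single 1 1) * sin φ

/-- The derivative of `f` in polar coordinates with respect to the angle. -/
def angularDeriv (f : EuclideanSpace ℝ (Fin 2) → ℝ) (r φ : ℝ) : ℝ :=
  r * (fderiv ℝ f (polarPoint r φ) (EuclideanSpace.single 1 1) * cos φ
    - fderiv ℝ f (polarPoint r φ) (EuclideanSpace.single 0 1) * sin φ)

lemma radialDeriv_sq_add (f : EuclideanSpace ℝ (Fin 2) → ℝ) {r : ℝ} (hr : r ≠ 0) (φ : ℝ) :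
    fderiv ℝ f (polarPoint r φ) (EuclideanSpace.single 0 1) ^ 2
      + fderiv ℝ f (polarPoint r φ) (EuclideanSpace.single 1 1) ^ 2
    = radialDeriv f r φ ^ 2 + angularDeriv f r φ ^ 2 / r ^ 2 := by
  unfold radialDeriv angularDeriv
  generalize fderiv ℝ f (polarPoint r φ) (EuclideanSpace.single 0 1) = p
  generalize fderiv ℝ f (polarPoint r φ) (EuclideanSpace.single 1 1) = q
  rw [mul_pow, mul_div_cancel_left₀ _ (pow_ne_zero 2 hr)]
  linear_combination -(p ^ 2 + q ^ 2) * cos_sq_add_sin_sq φ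

lemma isPolarDisk_comp {f : EuclideanSpace ℝ (Fin 2) → ℝ} (hf : ContDiff ℝ 1 f) {β : ℝ}
    (hβ : 0 < β) (hz : ∀ x, β ≤ ‖x‖ → f x = 0) :
    IsPolarDisk 1 β (fun r φ => f (polarPoint r φ)) (radialDeriv f) (angularDeriv f) := by
  have h1 := continuous_polarPoint
  have h2 := hf.continuous
  have h3 : Continuous (fderiv ℝ f) := hf.continuous_fderiv one_ne_zero
  have h4 : ∀ x, HasFDerivAt f (fderiv ℝ f x) x := fun x =>
    (hf.differentiable one_ne_zero x).hasFDerivAt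
  have h5 : ∀ i : Fin 2, Continuous fun z : ℝ × ℝ =>
      fderiv ℝ f (polarPoint z.1 z.2) (EuclideanSpace.single i 1) := fun i =>
    (h3.comp h1).clm_apply continuous_const
  have h50 := h5 0
  have h51 := h5 1
  refine ⟨by fun_prop, by unfold radialDeriv; fun_prop, by unfold angularDeriv; fun_prop,
    fun r φ => ?_, fun r φ => ?_, fun r φ => ?_, fun r hr φ => hz _ ?_⟩
  · have h6 : HasDerivAt (fun r => polarPoint r φ)
        (cos φ • EuclideanSpace.single 0 1 + sin φ • EuclideanSpace.single 1 1) r := by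
      have h7 := ((hasDerivAt_id' r).mul_const (cos φ)).smul_const
        (EuclideanSpace.single (0 : Fin 2) (1 : ℝ))
      have h8 := ((hasDerivAt_id' r).mul_const (sin φ)).smul_const
        (EuclideanSpace.single (1 : Fin 2) (1 : ℝ))
      have h9 := h7.fun_add h8
      rwa [one_mul, one_mul] at h9
    have h9 := (h4 (polarPoint r φ)).comp_hasDerivAt r h6
    rw [map_add, map_smul, map_smul, smul_eq_mul, smul_eq_mul] at h9
    exact h9.of_eq (fun _ => rfl) (by unfold radialDeriv; ring)
  · have h6 : HasDerivAt (polarPoint r)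
        ((r * -sin φ) • EuclideanSpace.single 0 1
          + (r * cos φ) • EuclideanSpace.single 1 1) φ := by
      have h7 := ((hasDerivAt_cos φ).const_mul r).smul_const
        (EuclideanSpace.single (0 : Fin 2) (1 : ℝ))
      have h8 := ((hasDerivAt_sin φ).const_mul r).smul_const
        (EuclideanSpace.single (1 : Fin 2) (1 : ℝ))
      exact h7.fun_add h8
    have h9 := (h4 (polarPoint r φ)).comp_hasDerivAt φ h6
    rw [map_add, map_smul, map_smul, smul_eq_mul, smul_eq_mul] at h9
    exact h9.of_eq (fun _ => rfl) (by unfold angularDeriv; ring)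
  · simp only [polarPoint, cos_add_two_pi, sin_add_two_pi, one_mul]
  · rwa [norm_polarPoint, abs_of_nonneg (hβ.le.trans hr)]

namespace IsPolarDisk

variable {s β : ℝ} {W Wr Wφ V Vr Vφ : ℝ → ℝ → ℝ}

lemma add (h : IsPolarDisk s β W Wr Wφ) (h' : IsPolarDisk s β V Vr Vφ) :
    IsPolarDisk s β (fun r φ => W r φ + V r φ) (fun r φ => Wr r φ + Vr r φ)
      (fun r φ => Wφ r φ + Vφ r φ) :=
  ⟨h.cont.add h'.cont, h.cont_r.add h'.cont_r, h.cont_φ.add h'.cont_φ,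
    fun r φ => (h.deriv_r r φ).fun_add (h'.deriv_r r φ),
    fun r φ => (h.deriv_φ r φ).fun_add (h'.deriv_φ r φ),
    fun r φ => by rw [h.per, h'.per]; ring,
    fun r hr φ => by rw [h.zero r hr, h'.zero r hr, add_zero]⟩

lemma mul_angle (h : IsPolarDisk 1 β W Wr Wφ) {A A' : ℝ → ℝ} (hA : ∀ φ, HasDerivAt A (A' φ) φ)
    (hA' : Continuous A') (hs : ∀ φ, A (φ + 2 * π) = s * A φ) :
    IsPolarDisk s β (fun r φ => W r φ * A φ) (fun r φ => Wr r φ * A φ)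
      (fun r φ => Wφ r φ * A φ + W r φ * A' φ) := by
  have h0 : Continuous A := continuous_iff_continuousAt.2 fun φ => (hA φ).continuousAt
  have h1 := h.cont
  have h2 := h.cont_r
  have h3 := h.cont_φ
  exact ⟨by fun_prop, by fun_prop, by fun_prop,
    fun r φ => (h.deriv_r r φ).mul_const _,
    fun r φ => (h.deriv_φ r φ).fun_mul (hA φ),
    fun r φ => by rw [h.per, hs]; ring,
    fun r hr φ => by rw [h.zero r hr, zero_mul]⟩

/-- Rotation of a pair of functions by the angle `k h φ`. -/
lemma rotate {k h : ℝ} {F Fr Fφ G Gr Gφ : ℝ → ℝ → ℝ} (hF : IsPolarDisk 1 β F Fr Fφ)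
    (hG : IsPolarDisk 1 β G Gr Gφ) (hc : ∀ φ, cos (h * (φ + 2 * π)) = s * cos (h * φ))
    (hs : ∀ φ, sin (h * (φ + 2 * π)) = s * sin (h * φ)) :
    IsPolarDisk s β (fun r φ => F r φ * cos (h * φ) + G r φ * (k * sin (h * φ)))
        (fun r φ => Fr r φ * cos (h * φ) + Gr r φ * (k * sin (h * φ)))
        (fun r φ => (Fφ r φ * cos (h * φ) + F r φ * -(h * sin (h * φ)))
          + (Gφ r φ * (k * sin (h * φ)) + G r φ * (k * (h * cos (h * φ))))) ∧
      IsPolarDisk s β (fun r φ => F r φ * (-k * sin (h * φ)) + G r φ * cos (h * φ))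
        (fun r φ => Fr r φ * (-k * sin (h * φ)) + Gr r φ * cos (h * φ))
        (fun r φ => (Fφ r φ * (-k * sin (h * φ)) + F r φ * (-k * (h * cos (h * φ))))
          + (Gφ r φ * cos (h * φ) + G r φ * -(h * sin (h * φ)))) := by
  have h1 : ∀ φ, HasDerivAt (fun φ => cos (h * φ)) (-(h * sin (h * φ))) φ := fun φ =>
    (((hasDerivAt_id' φ).const_mul h).cos).of_eq (fun _ => rfl) (by ring)
  have h2 : ∀ φ, HasDerivAt (fun φ => sin (h * φ)) (h * cos (h * φ)) φ := fun φ =>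
    (((hasDerivAt_id' φ).const_mul h).sin).of_eq (fun _ => rfl) (by ring)
  have h3 : ∀ m : ℝ, ∀ φ, m * sin (h * (φ + 2 * π)) = s * (m * sin (h * φ)) := fun m φ => by
    rw [hs]; ring
  exact ⟨(hF.mul_angle h1 (by fun_prop) hc).add
      (hG.mul_angle (fun φ => (h2 φ).const_mul k) (by fun_prop) (h3 k)),
    (hF.mul_angle (fun φ => (h2 φ).const_mul (-k)) (by fun_prop) (h3 (-k))).add
      (hG.mul_angle h1 (by fun_prop) hc)⟩

end IsPolarDisk

lemma rotate_sq_add_sq {k : ℝ} (hk : k ^ 2 = 1) (p q t : ℝ) :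
    (p * cos t + q * (k * sin t)) ^ 2 + (p * (-k * sin t) + q * cos t) ^ 2 = p ^ 2 + q ^ 2 := by
  linear_combination (p ^ 2 + q ^ 2) * cos_sq_add_sin_sq t + (p ^ 2 + q ^ 2) * sin t ^ 2 * hk

lemma rotate_angular_sq {k : ℝ} (hk : k ^ 2 = 1) (h p q dp dq t : ℝ) :
    ((dp * cos t + p * -(h * sin t)) + (dq * (k * sin t) + q * (k * (h * cos t)))
        - k * h * (p * (-k * sin t) + q * cos t)) ^ 2
      + ((dp * (-k * sin t) + p * (-k * (h * cos t))) + (dq * cos t + q * -(h * sin t))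
        + k * h * (p * cos t + q * (k * sin t))) ^ 2 = dp ^ 2 + dq ^ 2 := by
  rw [← rotate_sq_add_sq hk dp dq t]
  congr 2
  · linear_combination p * h * sin t * hk
  · linear_combination q * h * sin t * hk

/-- The potential part of the second variation in terms of the rotated components. -/
lemma potential_identity {k s₂ s₃ : ℝ} (hk : k ^ 2 = 1) (h₂ : s₂ ^ 2 = 2) (h₃ : s₃ ^ 2 = 3)
    (a b c U V φ p00 p01 p02 p11 p12 p22 : ℝ) (ht : p00 + p11 + p22 = 0)
    {f₀ f₁ f₂ f₃ f₄ w₁ w₂ w₃ w₄ : ℝ} (e₀ : f₀ = s₂ * s₃ / 2 * p22)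
    (e₁ : f₁ = s₂ / 2 * (p00 - p11)) (e₂ : f₂ = s₂ * p01) (e₃ : f₃ = s₂ * p02)
    (e₄ : f₄ = s₂ * p12) (l₁ : w₁ = f₁ * cos φ + f₂ * (k * sin φ))
    (l₂ : w₂ = f₁ * (-k * sin φ) + f₂ * cos φ)
    (l₃ : w₃ = f₃ * cos (1 / 2 * φ) + f₄ * (k * sin (1 / 2 * φ)))
    (l₄ : w₄ = f₃ * (-k * sin (1 / 2 * φ)) + f₄ * cos (1 / 2 * φ))
    {T N D M : ℝ}
    (hT : T = p00 ^ 2 + p11 ^ 2 + p22 ^ 2 + 2 * (p01 ^ 2 + p02 ^ 2 + p12 ^ 2))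
    (hN : N = U * (s₂ / 2) * (cos φ * (p00 ^ 2 + p02 ^ 2 - p11 ^ 2 - p12 ^ 2)
      + 2 * (k * sin φ) * (p01 * (p00 + p11) + p02 * p12))
      + V * (s₂ * s₃ / 2) * (p02 ^ 2 + p12 ^ 2 + p22 ^ 2 - T / 3))
    (hD : D = U ^ 2 + V ^ 2)
    (hM : M = U * (s₂ / 2) * (cos φ * (p00 - p11) + 2 * (k * sin φ) * p01)
      + V * (s₂ * s₃ / 2) * p22) :
    - a * T - 2 * (s₂ * s₃ * b) * N + c * (D * T + 2 * M ^ 2)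
    = (-a - 2 * b * V + c * (U ^ 2 + 3 * V ^ 2)) * f₀ ^ 2
      + (-a + 2 * b * V + c * (3 * U ^ 2 + V ^ 2)) * w₁ ^ 2
      + (-a + 2 * b * V + c * (U ^ 2 + V ^ 2)) * w₂ ^ 2
      + 4 * U * (b + c * V) * (f₀ * w₁)
      + ((-a - b * V - s₃ * b * U + c * (U ^ 2 + V ^ 2)) * w₃ ^ 2
      + (-a - b * V + s₃ * b * U + c * (U ^ 2 + V ^ 2)) * w₄ ^ 2) := by
  have h11 : p11 = -p00 - p22 := by linarith
  have r1 : w₁ ^ 2 + w₂ ^ 2 = f₁ ^ 2 + f₂ ^ 2 := by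
    rw [l₁, l₂]; exact rotate_sq_add_sq hk _ _ _
  have r2 : w₃ ^ 2 + w₄ ^ 2 = f₃ ^ 2 + f₄ ^ 2 := by
    rw [l₃, l₄]; exact rotate_sq_add_sq hk _ _ _
  have r3 : w₃ ^ 2 - w₄ ^ 2 = cos φ * (f₃ ^ 2 - f₄ ^ 2) + 2 * (k * sin φ) * (f₃ * f₄) := by
    have c1 : cos φ = cos (1 / 2 * φ) ^ 2 - sin (1 / 2 * φ) ^ 2 := by
      rw [← cos_two_mul']; ring_nf
    have c2 : sin φ = 2 * sin (1 / 2 * φ) * cos (1 / 2 * φ) := by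
      rw [← sin_two_mul]; ring_nf
    rw [l₃, l₄, c1, c2]
    linear_combination (f₄ ^ 2 - f₃ ^ 2) * sin (1 / 2 * φ) ^ 2 * hk
  have q₀ : f₀ ^ 2 = 3 / 2 * p22 ^ 2 := by
    rw [e₀]; linear_combination p22 ^ 2 / 4 * (s₃ ^ 2 * h₂ + 2 * h₃)
  have q₁ : f₁ ^ 2 = (p00 - p11) ^ 2 / 2 := by
    rw [e₁]; linear_combination (p00 - p11) ^ 2 / 4 * h₂
  have q₂ : f₂ ^ 2 = 2 * p01 ^ 2 := by rw [e₂]; linear_combination p01 ^ 2 * h₂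
  have q₃ : f₃ ^ 2 = 2 * p02 ^ 2 := by rw [e₃]; linear_combination p02 ^ 2 * h₂
  have q₄ : f₄ ^ 2 = 2 * p12 ^ 2 := by rw [e₄]; linear_combination p12 ^ 2 * h₂
  have q₅ : f₃ * f₄ = 2 * (p02 * p12) := by
    rw [e₃, e₄]; linear_combination p02 * p12 * h₂
  have hT' : T = f₀ ^ 2 + (f₁ ^ 2 + f₂ ^ 2) + (f₃ ^ 2 + f₄ ^ 2) := by
    rw [hT, q₀, q₁, q₂, q₃, q₄, h11]
    ring
  have hM' : M = U * w₁ + V * f₀ := by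
    rw [hM, l₁, e₀, e₁, e₂]; ring
  have hNw : s₂ * s₃ * N = -2 * U * (f₀ * w₁) + s₃ / 2 * U * (w₃ ^ 2 - w₄ ^ 2)
      + V * (f₀ ^ 2 - (f₁ ^ 2 + f₂ ^ 2) + (f₃ ^ 2 + f₄ ^ 2) / 2) := by
    have h₆ : s₂ ^ 2 * s₃ ^ 2 = 6 := by rw [h₂, h₃]; norm_num
    rw [r3, hN, hT, l₁, q₀, q₁, q₂, q₃, q₄, q₅, e₀, e₁, e₂, h11]
    linear_combination (U * s₃ / 2 * (cos φ * (p00 ^ 2 + p02 ^ 2 - (-p00 - p22) ^ 2 - p12 ^ 2)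
        + 2 * (k * sin φ) * (p01 * (p00 + (-p00 - p22)) + p02 * p12))
        + U * s₃ * p22 * ((p00 - (-p00 - p22)) / 2 * cos φ + p01 * (k * sin φ))) * h₂
      + V / 2 * (p02 ^ 2 + p12 ^ 2 + p22 ^ 2 - (p00 ^ 2 + (-p00 - p22) ^ 2 + p22 ^ 2
        + 2 * (p01 ^ 2 + p02 ^ 2 + p12 ^ 2)) / 3) * h₆
  rw [← r1, ← r2] at hT' hNw
  rw [hM', hD, hT']
  linear_combination (-2 * b) * hNw

/-- Coordinates of a symmetric traceless matrix in an orthonormal basis. -/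
def s0Coord (M : Matrix (Fin 3) (Fin 3) ℝ) : Fin 5 → ℝ :=
  ![√2 * √3 / 2 * M 2 2, √2 / 2 * (M 0 0 - M 1 1), √2 * M 0 1, √2 * M 0 2, √2 * M 1 2]

lemma sum_s0Coord_sq {M : Matrix (Fin 3) (Fin 3) ℝ} (hs : M.IsSymm) (ht : M.trace = 0) :
    ∑ i, s0Coord M i ^ 2 = ∑ i, ∑ j, M i j ^ 2 := by
  have h₂ : √2 ^ 2 = (2 : ℝ) := sq_sqrt (by norm_num)
  have h₃ : √3 ^ 2 = (3 : ℝ) := sq_sqrt (by norm_num)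
  rw [Matrix.trace_fin_three] at ht
  have h11 : M 1 1 = -M 0 0 - M 2 2 := by linarith
  have h5 : ∑ i, s0Coord M i ^ 2 = (√2 * √3 / 2 * M 2 2) ^ 2 + (√2 / 2 * (M 0 0 - M 1 1)) ^ 2
      + (√2 * M 0 1) ^ 2 + (√2 * M 0 2) ^ 2 + (√2 * M 1 2) ^ 2 := by
    rw [Fin.sum_univ_five]; rfl
  simp only [h5, Fin.sum_univ_three, mul_pow, div_pow, h₂, h₃, hs.apply 0 1, hs.apply 0 2,
    hs.apply 1 2, h11]
  ring

lemma fderiv_s0Coord {P : EuclideanSpace ℝ (Fin 2) → Matrix (Fin 3) (Fin 3) ℝ}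
    {x : EuclideanSpace ℝ (Fin 2)} (hd : ∀ i j, DifferentiableAt ℝ (fun y => P y i j) x)
    (e : EuclideanSpace ℝ (Fin 2)) (i : Fin 5) :
    fderiv ℝ (fun y => s0Coord (P y) i) x e
      = s0Coord (Matrix.of fun i j => fderiv ℝ (fun y => P y i j) x e) i := by
  have h := fun i j => (hd i j).hasFDerivAt
  fin_cases i
  · exact congrArg (fun T => T e) ((h 2 2).const_mul (√2 * √3 / 2)).fderiv
  · exact congrArg (fun T => T e) (((h 0 0).sub (h 1 1)).const_mul (√2 / 2)).fderiv
  · exact congrArg (fun T => T e) ((h 0 1).const_mul √2).fderiv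
  · exact congrArg (fun T => T e) ((h 0 2).const_mul √2).fderiv
  · exact congrArg (fun T => T e) ((h 1 2).const_mul √2).fderiv

lemma gradSq_eq_sum {P : EuclideanSpace ℝ (Fin 2) → Matrix (Fin 3) (Fin 3) ℝ}
    (hd : ∀ i j, Differentiable ℝ (fun y => P y i j)) (hs : ∀ x, (P x).IsSymm)
    (ht : ∀ x, (P x).trace = 0) {r : ℝ} (hr : r ≠ 0) (φ : ℝ) :
    gradSq P (polarPoint r φ) = ∑ i, (radialDeriv (fun y => s0Coord (P y) i) r φ ^ 2
      + angularDeriv (fun y => s0Coord (P y) i) r φ ^ 2 / r ^ 2) := by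
  have key : ∀ e x, ∑ i : Fin 3, ∑ j : Fin 3, (fderiv ℝ (fun y => P y i j) x e) ^ 2
      = ∑ i, fderiv ℝ (fun y => s0Coord (P y) i) x e ^ 2 := fun e x => by
    simp only [fderiv_s0Coord (fun i j => hd i j x)]
    rw [sum_s0Coord_sq]
    · rfl
    · ext i j
      have : (fun y => P y j i) = fun y => P y i j := funext fun y => (hs y).apply i j
      simp only [Matrix.transpose_apply, Matrix.of_apply, this]
    · have h0 : (fun y => P y 0 0 + P y 1 1 + P y 2 2) = fun _ => (0 : ℝ) := funext fun y => by
        rw [← ht y, Matrix.trace_fin_three]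
      have h1 := congrArg (fun T => T e) ((((hd 0 0 x).hasFDerivAt.add
        (hd 1 1 x).hasFDerivAt).add (hd 2 2 x).hasFDerivAt).congr_fderiv rfl).fderiv
      have h2 : fderiv ℝ (fun y => P y 0 0 + P y 1 1 + P y 2 2) x e = 0 := by
        rw [h0]; simp
      rw [Matrix.trace_fin_three]
      exact h1.symm.trans h2
  unfold gradSq
  rw [Fin.sum_univ_two, key, key, ← Finset.sum_add_distrib]
  exact Finset.sum_congr rfl fun i _ => radialDeriv_sq_add _ hr φ

lemma rotated_forms_eq {k : ℝ} (hk : k ^ 2 = 1) (r φ U κ A₀ A₁ A₂ V₁ V₂ : ℝ)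
    (p g d : Fin 5 → ℝ) :
    tripleForm k r U κ A₀ A₁ A₂ (p 0)
        (p 1 * cos (1 * φ) + p 2 * (k * sin (1 * φ)))
        (p 1 * (-k * sin (1 * φ)) + p 2 * cos (1 * φ)) (g 0)
        (g 1 * cos (1 * φ) + g 2 * (k * sin (1 * φ)))
        (g 1 * (-k * sin (1 * φ)) + g 2 * cos (1 * φ)) (d 0)
        ((d 1 * cos (1 * φ) + p 1 * -(1 * sin (1 * φ)))
          + (d 2 * (k * sin (1 * φ)) + p 2 * (k * (1 * cos (1 * φ)))))
        ((d 1 * (-k * sin (1 * φ)) + p 1 * (-k * (1 * cos (1 * φ))))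
          + (d 2 * cos (1 * φ) + p 2 * -(1 * sin (1 * φ))))
      + pairForm (k / 2) r V₁ V₂
        (p 3 * cos (1 / 2 * φ) + p 4 * (k * sin (1 / 2 * φ)))
        (p 3 * (-k * sin (1 / 2 * φ)) + p 4 * cos (1 / 2 * φ))
        (g 3 * cos (1 / 2 * φ) + g 4 * (k * sin (1 / 2 * φ)))
        (g 3 * (-k * sin (1 / 2 * φ)) + g 4 * cos (1 / 2 * φ))
        ((d 3 * cos (1 / 2 * φ) + p 3 * -(1 / 2 * sin (1 / 2 * φ)))
          + (d 4 * (k * sin (1 / 2 * φ)) + p 4 * (k * (1 / 2 * cos (1 / 2 * φ)))))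
        ((d 3 * (-k * sin (1 / 2 * φ)) + p 3 * (-k * (1 / 2 * cos (1 / 2 * φ))))
          + (d 4 * cos (1 / 2 * φ) + p 4 * -(1 / 2 * sin (1 / 2 * φ))))
    = ∑ i, (g i ^ 2 + d i ^ 2 / r ^ 2)
      + (A₀ * p 0 ^ 2 + A₁ * (p 1 * cos φ + p 2 * (k * sin φ)) ^ 2
        + A₂ * (p 1 * (-k * sin φ) + p 2 * cos φ) ^ 2
        + 4 * U * κ * (p 0 * (p 1 * cos φ + p 2 * (k * sin φ)))
        + (V₁ * (p 3 * cos (1 / 2 * φ) + p 4 * (k * sin (1 / 2 * φ))) ^ 2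
        + V₂ * (p 3 * (-k * sin (1 / 2 * φ)) + p 4 * cos (1 / 2 * φ)) ^ 2)) := by
  have g1 := rotate_sq_add_sq hk (g 1) (g 2) (1 * φ)
  have g2 := rotate_sq_add_sq hk (g 3) (g 4) (1 / 2 * φ)
  have d1 := rotate_angular_sq hk 1 (p 1) (p 2) (d 1) (d 2) (1 * φ)
  have d2 := rotate_angular_sq hk (1 / 2) (p 3) (p 4) (d 3) (d 4) (1 / 2 * φ)
  rw [mul_one k] at d1
  rw [mul_one_div] at d2
  have hsum : ∑ i, (g i ^ 2 + d i ^ 2 / r ^ 2) = g 0 ^ 2 + d 0 ^ 2 / r ^ 2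
      + (g 1 ^ 2 + g 2 ^ 2) + (d 1 ^ 2 + d 2 ^ 2) / r ^ 2
      + (g 3 ^ 2 + g 4 ^ 2) + (d 3 ^ 2 + d 4 ^ 2) / r ^ 2 := by
    rw [Fin.sum_univ_five]; ring
  unfold tripleForm pairForm
  rw [d1, d2, hsum, ← g1, ← g2, one_mul φ]
  ring

lemma Qmap_polarPoint (k : ℤ) (u v : ℝ → ℝ) {r : ℝ} (hr : 0 < r) (φ : ℝ) :
    Qmap k u v (polarPoint r φ) = (u r * (√2 / 2)) • !![cos φ, (k : ℝ) * sin φ, 0;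
      (k : ℝ) * sin φ, -cos φ, 0; 0, 0, 0] + (v r * (√2 * √3 / 2)) • E0base := by
  have hn : ‖polarPoint r φ‖ = r := by rw [norm_polarPoint, abs_of_pos hr]
  have h0 : polarPoint r φ ≠ 0 := norm_pos_iff.1 (by rw [hn]; exact hr)
  have h2 : √2 ^ 2 = (2 : ℝ) := sq_sqrt (by norm_num)
  have h6 : √(3 / 2) = √2 * √3 / 2 := by
    rw [← Real.sqrt_mul (by norm_num), Real.sqrt_eq_iff_mul_self_eq (by norm_num) (by positivity),
      div_mul_div_comm, Real.mul_self_sqrt (by norm_num)]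
    norm_num
  have h7 : u r / (√2 * r) * r = u r * (√2 / 2) := by
    have : √2 ≠ 0 := by positivity
    field_simp
    rw [h2]
  have h8 : Mk k (polarPoint r φ) = r • !![cos φ, (k : ℝ) * sin φ, 0;
      (k : ℝ) * sin φ, -cos φ, 0; 0, 0, 0] := by
    rw [Mk, polarPoint_zero, polarPoint_one]
    ext i j
    fin_cases i <;> fin_cases j <;> simp [mul_left_comm]
  rw [Qmap, if_neg h0, hn, h6, mul_comm _ (v r), ← h7, h8, mul_smul, mul_smul]

/-- The integrand of the second variation. -/
def variationDensity (a2 b2 c2 : ℝ) (Q P : EuclideanSpace ℝ (Fin 2) → Matrix (Fin 3) (Fin 3) ℝ)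
    (x : EuclideanSpace ℝ (Fin 2)) : ℝ :=
  gradSq P x - a2 * (P x * P x).trace - 2 * b2 * (P x * P x * Q x).trace
    + c2 * ((Q x * Q x).trace * (P x * P x).trace + 2 * ((Q x * P x).trace) ^ 2)

lemma potential_eq {k : ℝ} (hk : k ^ 2 = 1) (a b c U V φ : ℝ)
    {M Q : Matrix (Fin 3) (Fin 3) ℝ} (hs : M.IsSymm) (ht : M.trace = 0)
    (hQ : Q = (U * (√2 / 2)) • !![cos φ, k * sin φ, 0; k * sin φ, -cos φ, 0; 0, 0, 0]
      + (V * (√2 * √3 / 2)) • E0base) :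
    - a * (M * M).trace - 2 * (√2 * √3 * b) * (M * M * Q).trace
      + c * ((Q * Q).trace * (M * M).trace + 2 * (Q * M).trace ^ 2)
    = (-a - 2 * b * V + c * (U ^ 2 + 3 * V ^ 2)) * s0Coord M 0 ^ 2
      + (-a + 2 * b * V + c * (3 * U ^ 2 + V ^ 2))
        * (s0Coord M 1 * cos φ + s0Coord M 2 * (k * sin φ)) ^ 2
      + (-a + 2 * b * V + c * (U ^ 2 + V ^ 2))
        * (s0Coord M 1 * (-k * sin φ) + s0Coord M 2 * cos φ) ^ 2
      + 4 * U * (b + c * V)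
        * (s0Coord M 0 * (s0Coord M 1 * cos φ + s0Coord M 2 * (k * sin φ)))
      + ((-a - b * V - √3 * b * U + c * (U ^ 2 + V ^ 2))
        * (s0Coord M 3 * cos (1 / 2 * φ) + s0Coord M 4 * (k * sin (1 / 2 * φ))) ^ 2
      + (-a - b * V + √3 * b * U + c * (U ^ 2 + V ^ 2))
        * (s0Coord M 3 * (-k * sin (1 / 2 * φ)) + s0Coord M 4 * cos (1 / 2 * φ)) ^ 2) := by
  have h₂ : √2 ^ 2 = (2 : ℝ) := sq_sqrt (by norm_num)
  have h₃ : √3 ^ 2 = (3 : ℝ) := sq_sqrt (by norm_num)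
  have h10 := hs.apply 0 1
  have h20 := hs.apply 0 2
  have h21 := hs.apply 1 2
  rw [Matrix.trace_fin_three] at ht
  refine potential_identity hk h₂ h₃ a b c U V φ (M 0 0) (M 0 1) (M 0 2) (M 1 1) (M 1 2) (M 2 2)
    ht rfl rfl rfl rfl rfl rfl rfl rfl rfl ?_ ?_ ?_ ?_
  · simp only [Matrix.trace_fin_three, Matrix.mul_apply, Fin.sum_univ_three, h10, h20, h21]
    ring
  · rw [hQ]
    simp [Matrix.trace_fin_three, Matrix.mul_apply, Fin.sum_univ_three, h10, h20, h21, E0base]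
    ring
  · rw [hQ]
    simp [Matrix.trace_fin_three, E0base]
    linear_combination (U ^ 2 / 2 * (cos φ ^ 2 + k ^ 2 * sin φ ^ 2) + √3 ^ 2 / 6 * V ^ 2) * h₂
      + V ^ 2 / 3 * h₃ + U ^ 2 * sin φ ^ 2 * hk + U ^ 2 * cos_sq_add_sin_sq φ
  · rw [hQ, Matrix.trace_mul_comm]
    simp [Matrix.trace_fin_three, Matrix.mul_apply, Fin.sum_univ_three, h10, h20, h21, E0base]
    linear_combination -(V * (√2 * √3 / 2)) / 3 * ht

lemma integral_polarPoint {F : EuclideanSpace ℝ (Fin 2) → ℝ} (hF : Integrable F) :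
    IntegrableOn (fun r => r * ∫ φ in -π..π, F (polarPoint r φ)) (Ioi 0) ∧
      ∫ x, F x = ∫ r in Ioi 0, r * ∫ φ in -π..π, F (polarPoint r φ) := by
  let e := (MeasurableEquiv.toLp 2 (Fin 2 → ℝ)).symm.trans (MeasurableEquiv.finTwoArrow (α := ℝ))
  have he : MeasurePreserving e volume volume :=
    (EuclideanSpace.volume_preserving_symm_measurableEquiv_toLp (Fin 2)).trans
      (volume_preserving_finTwoArrow ℝ)
  have hes : ∀ p : ℝ × ℝ, e.symm (polarCoord.symm p) = polarPoint p.1 p.2 := fun p => by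
    rw [e.symm_apply_eq]
    refine Prod.ext ?_ ?_
    · exact (polarPoint_zero p.1 p.2).symm
    · exact (polarPoint_one p.1 p.2).symm
  have hG : Integrable (F ∘ e.symm) := (he.symm e).integrable_comp_of_integrable hF
  have h1 : ∫ x, F x = ∫ z, F (e.symm z) :=
    ((he.symm e).integral_comp e.symm.measurableEmbedding F).symm
  have h2 := integral_comp_polarCoord_symm (F ∘ e.symm)
  have h3 : IntegrableOn (fun p : ℝ × ℝ => p.1 • (F ∘ e.symm) (polarCoord.symm p))
      polarCoord.target := by
    have h6 : IntegrableOn (F ∘ e.symm) (polarCoord.symm '' polarCoord.target) := hG.integrableOn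
    rw [integrableOn_image_iff_integrableOn_abs_det_fderiv_smul volume
      polarCoord.open_target.measurableSet
      (fun p _ => (hasFDerivAt_polarCoord_symm p).hasFDerivWithinAt) polarCoord.symm.injOn] at h6
    refine h6.congr_fun (fun p hp => ?_) polarCoord.open_target.measurableSet
    simp only [det_fderivPolarCoordSymm]
    rw [abs_of_pos hp.1]
  have h4 : (fun p : ℝ × ℝ => p.1 • (F ∘ e.symm) (polarCoord.symm p))
      = fun p => p.1 * F (polarPoint p.1 p.2) := by
    funext p; simp only [Function.comp_apply, hes, smul_eq_mul]
  rw [h4] at h3 h2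
  rw [polarCoord_target] at h3 h2
  have h5 : ∀ r, r * ∫ φ in -π..π, F (polarPoint r φ)
      = ∫ φ in Ioo (-π) π, r * F (polarPoint r φ) := fun r => by
    rw [intervalIntegral.integral_of_le (by linarith [pi_pos]), integral_Ioc_eq_integral_Ioo,
      integral_const_mul]
  simp only [h5]
  rw [IntegrableOn, Measure.volume_eq_prod, ← Measure.prod_restrict] at h3
  refine ⟨h3.integral_prod_left, ?_⟩
  rw [h1]
  refine h2.symm.trans ?_
  rw [Measure.volume_eq_prod, ← Measure.prod_restrict]
  exact integral_prod _ h3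

lemma variationDensity_polarPoint (k : ℤ) (a b c : ℝ) (u v : ℝ → ℝ)
    {P : EuclideanSpace ℝ (Fin 2) → Matrix (Fin 3) (Fin 3) ℝ}
    (hd : ∀ i j, Differentiable ℝ (fun y => P y i j)) (hs : ∀ x, (P x).IsSymm)
    (ht : ∀ x, (P x).trace = 0) {r : ℝ} (hr : 0 < r) (φ : ℝ) :
    variationDensity a (√2 * √3 * b) c (Qmap k u v) P (polarPoint r φ)
    = ∑ i, (radialDeriv (fun y => s0Coord (P y) i) r φ ^ 2
        + angularDeriv (fun y => s0Coord (P y) i) r φ ^ 2 / r ^ 2)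
      + (- a * (P (polarPoint r φ) * P (polarPoint r φ)).trace
        - 2 * (√2 * √3 * b)
          * (P (polarPoint r φ) * P (polarPoint r φ) * Qmap k u v (polarPoint r φ)).trace
        + c * ((Qmap k u v (polarPoint r φ) * Qmap k u v (polarPoint r φ)).trace
          * (P (polarPoint r φ) * P (polarPoint r φ)).trace
          + 2 * (Qmap k u v (polarPoint r φ) * P (polarPoint r φ)).trace ^ 2)) := by
  rw [variationDensity, gradSq_eq_sum hd hs ht hr.ne']
  ring

lemma contDiff_s0Coord {P : EuclideanSpace ℝ (Fin 2) → Matrix (Fin 3) (Fin 3) ℝ}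
    (hP : ∀ i j, ContDiff ℝ 1 fun y => P y i j) (i : Fin 5) :
    ContDiff ℝ 1 fun y => s0Coord (P y) i := by
  fin_cases i
  · exact contDiff_const.mul (hP 2 2)
  · exact contDiff_const.mul ((hP 0 0).sub (hP 1 1))
  · exact contDiff_const.mul (hP 0 1)
  · exact contDiff_const.mul (hP 0 2)
  · exact contDiff_const.mul (hP 1 2)

lemma s0Coord_zero (i : Fin 5) : s0Coord 0 i = 0 := by
  fin_cases i <;> simp [s0Coord]

lemma Profile.integral_variationDensity_nonneg {a b c y : ℝ} {R : ℝ≥0∞} {u v du dv : ℝ → ℝ}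
    (H : Profile a b c y R u v du dv) (hR : 0 < R) (hstab : RadiallyStable a b c R u v)
    {k : ℤ} (hk : (k : ℝ) ^ 2 = 1) {P : EuclideanSpace ℝ (Fin 2) → Matrix (Fin 3) (Fin 3) ℝ}
    (hP : ∀ i j, ContDiff ℝ 1 fun y => P y i j) (hs : ∀ x, (P x).IsSymm)
    (ht : ∀ x, (P x).trace = 0) {β : ℝ} (hβ : β ∈ Iset R) (hz : ∀ x, β ≤ ‖x‖ → P x = 0)
    (hint : Integrable (variationDensity a (√2 * √3 * b) c (Qmap k u v) P)) :
    0 ≤ ∫ x, variationDensity a (√2 * √3 * b) c (Qmap k u v) P x := by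
  have hd : ∀ i j, Differentiable ℝ (fun y => P y i j) := fun i j =>
    (hP i j).differentiable one_ne_zero
  obtain ⟨hJ, hJe⟩ := integral_polarPoint hint
  rw [hJe]
  have hD : ∀ i, IsPolarDisk 1 β (fun r φ => s0Coord (P (polarPoint r φ)) i)
      (radialDeriv fun y => s0Coord (P y) i) (angularDeriv fun y => s0Coord (P y) i) := fun i =>
    isPolarDisk_comp (contDiff_s0Coord hP i) hβ.1 fun x hx => by rw [hz x hx, s0Coord_zero]
  have c1 : ∀ φ, cos (1 * (φ + 2 * π)) = 1 * cos (1 * φ) := fun φ => by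
    rw [one_mul, one_mul, one_mul, cos_add_two_pi]
  have s1 : ∀ φ, sin (1 * (φ + 2 * π)) = 1 * sin (1 * φ) := fun φ => by
    rw [one_mul, one_mul, one_mul, sin_add_two_pi]
  have c2 : ∀ φ, cos (1 / 2 * (φ + 2 * π)) = -1 * cos (1 / 2 * φ) := fun φ => by
    rw [mul_add, show 1 / 2 * (2 * π) = π by ring, cos_add_pi, neg_one_mul]
  have s2 : ∀ φ, sin (1 / 2 * (φ + 2 * π)) = -1 * sin (1 / 2 * φ) := fun φ => by
    rw [mul_add, show 1 / 2 * (2 * π) = π by ring, sin_add_pi, neg_one_mul]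
  obtain ⟨h₁, h₂⟩ := (hD 1).rotate (k := k) (hD 2) c1 s1
  obtain ⟨h₃, h₄⟩ := (hD 3).rotate (k := k) (hD 4) c2 s2
  refine H.integral_polar_nonneg hR hstab hk hβ (hD 0) h₁ h₂ h₃ h₄ hJ (fun r hr => ?_)
    fun r hr => ?_
  · have hr0 : 0 < r := hβ.1.trans_le hr
    have h0 : ∀ φ, variationDensity a (√2 * √3 * b) c (Qmap k u v) P (polarPoint r φ) = 0 :=
      fun φ => by
        have hzP : P (polarPoint r φ) = 0 := hz _ (by rwa [norm_polarPoint, abs_of_pos hr0])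
        rw [variationDensity_polarPoint k a b c u v hd hs ht hr0, hzP]
        simp [(hD _).zero_r hr, (hD _).zero_φ hr]
    simp [h0]
  · congr 1
    refine intervalIntegral.integral_congr fun φ _ => ?_
    rw [variationDensity_polarPoint k a b c u v hd hs ht hr.1,
      potential_eq hk a b c (u r) (v r) φ (hs _) (ht _) (Qmap_polarPoint k u v hr.1 φ)]
    exact (rotated_forms_eq hk r φ (u r) (b + c * v r) _ _ _ _ _
      (fun i => s0Coord (P (polarPoint r φ)) i)
      (fun i => radialDeriv (fun y => s0Coord (P y) i) r φ)
      (fun i => angularDeriv (fun y => s0Coord (P y) i) r φ)).symm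

lemma sqrt_six : √6 = √2 * √3 := by
  rw [← Real.sqrt_mul (by norm_num)]
  norm_num

lemma sPlus_pos {a b c : ℝ} (hb : 0 < b) (hc : 0 < c) : 0 < sPlus a b c := by
  unfold sPlus
  positivity

lemma sPlus_sq {a b c : ℝ} (ha : 0 ≤ a) (hc : 0 < c) :
    2 * c * sPlus a b c ^ 2 = b * sPlus a b c + 3 * a := by
  have h1 : √(b ^ 2 + 24 * a * c) ^ 2 = b ^ 2 + 24 * a * c := sq_sqrt (by positivity)
  unfold sPlus
  generalize √(b ^ 2 + 24 * a * c) = s at h1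
  field_simp
  linear_combination 2 * h1

lemma ProfileSolution.toProfile {a2 b2 c2 : ℝ} {k : ℤ} {R : ℝ≥0∞} {u v : ℝ → ℝ}
    (hsol : ProfileSolution a2 b2 c2 k R u v) (ha : 0 ≤ a2) (hb : 0 < b2) (hc : 0 < c2)
    (hk : (k : ℝ) ^ 2 = 1) (hu : ∀ r ∈ Iset R, 0 < u r) (hv : ∀ r ∈ Iset R, v r < 0) :
    Profile a2 (b2 / √6) c2 (sPlus a2 b2 c2 / √6) R u v (deriv u) (deriv v) := by
  have h6 : √6 ^ 2 = (6 : ℝ) := sq_sqrt (by norm_num)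
  have h6' : √6 ≠ (0 : ℝ) := by positivity
  have hs := sPlus_pos (a := a2) hb hc
  have hd : ∀ {f : ℝ → ℝ}, ContDiffOn ℝ 2 f (Iset R) → ∀ r ∈ Iset R,
      HasDerivAt f (deriv f r) r ∧ HasDerivAt (deriv f) (deriv (deriv f) r) r := by
    intro f hf r hr
    have hf' : ContDiffOn ℝ 1 (deriv f) (Iset R) :=
      hf.deriv_of_isOpen (isOpen_Iset R) (by norm_num)
    have hn := (isOpen_Iset R).mem_nhds hr
    exact ⟨((hf.differentiableOn (by norm_num)).differentiableAt hn).hasDerivAt,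
      ((hf'.differentiableOn (by norm_num)).differentiableAt hn).hasDerivAt⟩
  exact {
    a_nonneg := ha
    b_pos := by positivity
    c_pos := hc
    y_pos := by positivity
    a_eq := by
      have h1 := sPlus_sq (b := b2) ha hc
      field_simp
      rw [h6]
      linear_combination -2 * h1
    deriv_u := fun r hr => (hd hsol.smooth_u r hr).1
    deriv_v := fun r hr => (hd hsol.smooth_v r hr).1
    deriv_du := fun r hr => (hd hsol.smooth_u r hr).2.of_eq (fun _ => rfl) (by
      have h1 := hsol.ode_u r hr
      rw [hk, hfun] at h1
      linear_combination -h1)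
    deriv_dv := fun r hr => (hd hsol.smooth_v r hr).2.of_eq (fun _ => rfl) (by
      have h1 := hsol.ode_v r hr
      rw [gfun] at h1
      linear_combination -h1)
    u_pos := hu
    v_neg := hv
    u_zero := hsol.bc0_u
    dv_zero := hsol.bc0_v
    u_end := by
      have h1 : √3 * (sPlus a2 b2 c2 / √6) = sPlus a2 b2 c2 / √2 := by
        rw [sqrt_six]
        field_simp
      rw [h1]
      exact hsol.bcR_u
    v_end := hsol.bcR_v }

lemma exists_radius_of_isCompact {R : ℝ≥0∞} (hR : 0 < R) {K : Set (EuclideanSpace ℝ (Fin 2))}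
    (hK : IsCompact K) (hKR : K ⊆ ball2 R) : ∃ β ∈ Iset R, ∀ x ∈ K, ‖x‖ < β := by
  obtain ⟨M, hM, hMR⟩ : ∃ M : ℝ, (∀ x ∈ K, ‖x‖ ≤ M) ∧ ENNReal.ofReal M < R := by
    rcases K.eq_empty_or_nonempty with rfl | hne
    · exact ⟨0, by simp, by simpa using hR⟩
    · obtain ⟨x, hx, hmax⟩ := hK.exists_isMaxOn hne continuous_norm.continuousOn
      exact ⟨‖x‖, hmax, hKR hx⟩
  obtain ⟨β, h1, h2⟩ := ENNReal.lt_iff_exists_nnreal_btwn.1 hMR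
  have h3 : max M 0 < β := by
    rw [← ENNReal.ofReal_coe_nnreal] at h1
    exact max_lt_iff.2 (ENNReal.ofReal_lt_ofReal_iff'.1 h1)
  exact ⟨β, ⟨(le_max_right _ _).trans_lt h3, by rwa [ENNReal.ofReal_coe_nnreal]⟩,
    fun x hx => (hM x hx).trans_lt ((le_max_left _ _).trans_lt h3)⟩

lemma variationDensity_eq_zero {a2 b2 c2 : ℝ}
    {Q P : EuclideanSpace ℝ (Fin 2) → Matrix (Fin 3) (Fin 3) ℝ} {x : EuclideanSpace ℝ (Fin 2)}
    (hx : x ∉ tsupport P) : variationDensity a2 b2 c2 Q P x = 0 := by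
  have h0 := notMem_tsupport_iff_eventuallyEq.1 hx
  have h1 : ∀ i j, fderiv ℝ (fun y => P y i j) x = 0 := fun i j => by
    have h2 : (fun y => P y i j) =ᶠ[𝓝 x] fun _ => (0 : ℝ) := by
      filter_upwards [h0] with y hy
      rw [hy]; rfl
    rw [h2.fderiv_eq]
    simp
  have h3 : P x = 0 := h0.self_of_nhds
  simp [variationDensity, gradSq, h1, h3]

/-- **Stability of degree `±1/2` point defects**: if `(u,v)` is a profile solution with
`u > 0`, `v < 0` whose second variation `B` is nonnegative, then the second variation of the
Landau–de Gennes energy at the associated `k`-radially symmetric map `Q` (for `k = ±1`) is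
nonnegative in every smooth compactly supported direction `P : B_R → S₀`. -/
theorem stmt5 (a2 b2 c2 : ℝ) (ha : 0 ≤ a2) (hb : 0 < b2) (hc : 0 < c2)
    (k : ℤ) (hk : k = 1 ∨ k = -1) (R : ℝ≥0∞) (hR : 0 < R)
    (u v : ℝ → ℝ) (hsol : ProfileSolution a2 b2 c2 k R u v)
    (hu : ∀ r ∈ Iset R, 0 < u r) (hv : ∀ r ∈ Iset R, v r < 0)
    (hstab : ∀ ξ η : ℝ → ℝ, ContDiff ℝ 1 ξ → ContDiff ℝ 1 η →
      HasCompactSupport ξ → HasCompactSupport η →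
      tsupport ξ ⊆ Iset R → tsupport η ⊆ Iset R →
      0 ≤ Bform a2 b2 c2 k R u v ξ η)
    (P : EuclideanSpace ℝ (Fin 2) → Matrix (Fin 3) (Fin 3) ℝ)
    (hPsmooth : ∀ i j, ContDiff ℝ (⊤ : ℕ∞) fun x => P x i j)
    (hPc : HasCompactSupport P) (hPs : tsupport P ⊆ ball2 R)
    (hPsym : ∀ x, (P x).IsSymm) (hPtr : ∀ x, (P x).trace = 0) :
    0 ≤ Lform a2 b2 c2 R (Qmap k u v) P := by
  have hk2 : (k : ℝ) ^ 2 = 1 := by rcases hk with rfl | rfl <;> norm_num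
  have H := hsol.toProfile ha hb hc hk2 hu hv
  have hrad : RadiallyStable a2 (b2 / √6) c2 R u v := by
    intro ξ η hξ hη hξc hηc hξs hηs
    have h1 := hstab ξ η hξ hη hξc hηc hξs hηs
    rw [Bform, hk2, mul_div_assoc] at h1
    exact h1
  have hb2 : √2 * √3 * (b2 / √6) = b2 := by
    rw [← sqrt_six, mul_div_cancel₀ _ (by positivity)]
  obtain ⟨β, hβ, hK⟩ := exists_radius_of_isCompact hR hPc hPs
  have hL : Lform a2 b2 c2 R (Qmap k u v) P
      = ∫ x, variationDensity a2 b2 c2 (Qmap k u v) P x :=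
    setIntegral_eq_integral_of_forall_compl_eq_zero fun x hx =>
      variationDensity_eq_zero fun h => hx (hPs h)
  rw [hL]
  by_cases hint : Integrable (variationDensity a2 b2 c2 (Qmap k u v) P)
  · rw [← hb2] at hint ⊢
    have h1 := H.integral_variationDensity_nonneg hR hrad hk2
      (fun i j => (hPsmooth i j).of_le (by exact_mod_cast le_top)) hPsym hPtr hβ
      (fun x hx => image_eq_zero_of_notMem_tsupport fun h => (hK x h).not_ge hx) hint
    exact h1
  · rw [integral_undef hint]

end
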